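/- Rigidity dimension of representation-finite self-injective Nakayama algebras: if Λ = A_{n,m} with n > 1, m ≥ n, k₀ = ⌊m/n⌋ = 2 and s₁ = m − 2n, then rigdim(Λ) = 2 if s₁ = n − 1 and rigdim(Λ) = 3 if 0 ≤ s₁ < n − 1. -/

import Mathlib

open CategoryTheory CategoryTheory.Limits Opposite

universe u

namespace Rigidity

variable (Λ : Type u) [Ring Λ]

/-- `X` belongs to `add M`: it is a direct summand of a finite direct sum of copies of `M`. -/
def InAdd (M X : ModuleCat.{u} Λ) : Prop :=
  ∃ (r : ℕ) (Y : ModuleCat.{u} Λ), Nonempty ((X ⊞ Y) ≅ ⨁ (fun _ : Fin r => M))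

/-- An indecomposable object. -/
def Indec (X : ModuleCat.{u} Λ) : Prop :=
  ¬ IsZero X ∧ ∀ A B : ModuleCat.{u} Λ, Nonempty (X ≅ A ⊞ B) → IsZero A ∨ IsZero B

/-- A generator-cogenerator: `add M` contains the regular module and all
finitely generated injective modules. -/
def IsGenCogen (M : ModuleCat.{u} Λ) : Prop :=
  InAdd Λ M (ModuleCat.of Λ Λ) ∧
  ∀ I : ModuleCat.{u} Λ, Module.Finite Λ I → Injective I → InAdd Λ M I

/-- `g : A ⟶ X` is a right minimal `add M`-approximation. -/
def IsRMApprox (M : ModuleCat.{u} Λ) {A X : ModuleCat.{u} Λ} (g : A ⟶ X) : Prop :=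
  InAdd Λ M A ∧
  (∀ T : ModuleCat.{u} Λ, InAdd Λ M T → ∀ f : T ⟶ X, ∃ h : T ⟶ A, h ≫ g = f) ∧
  (∀ h : A ⟶ A, h ≫ g = g → IsIso h)

/-- `IsMSyzygy M X r W` : `W` is an `r`-th `M`-syzygy `Ω_M^r(X)` of `X`. -/
inductive IsMSyzygy (M : ModuleCat.{u} Λ) : ModuleCat.{u} Λ → ℕ → ModuleCat.{u} Λ → Prop
  | zero (X : ModuleCat.{u} Λ) : IsMSyzygy M X 0 X
  | succ (X : ModuleCat.{u} Λ) (r : ℕ) (W A : ModuleCat.{u} Λ) (g : A ⟶ W)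
      (hW : IsMSyzygy M X r W) (hg : IsRMApprox Λ M g) :
      IsMSyzygy M X (r + 1) (kernel g)

/-- The `M`-dimension of `X` is at most `r`. -/
def MdimLE (M X : ModuleCat.{u} Λ) (r : ℕ) : Prop :=
  ∃ W : ModuleCat.{u} Λ, IsMSyzygy Λ M X r W ∧ InAdd Λ M W

/-- projective dimension at most `r`, via a length `r` projective resolution. -/
def ProjDimLE (A : Type u) [Ring A] (N : ModuleCat.{u} A) (r : ℕ) : Prop :=
  ∃ (P : ℕ → ModuleCat.{u} A) (d : ∀ i : ℕ, P (i + 1) ⟶ P i) (f : P 0 ⟶ N),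
    (∀ i, Projective (P i)) ∧ (∀ i, r < i → IsZero (P i)) ∧ Epi f ∧
    (∃ w : d 0 ≫ f = 0, (ShortComplex.mk (d 0) f w).Exact) ∧
    (∀ i, ∃ w : d (i + 1) ≫ d i = 0, (ShortComplex.mk (d (i + 1)) (d i) w).Exact)

/-- global dimension at most `r`. -/
def GldimLE (A : Type u) [Ring A] (r : ℕ) : Prop :=
  ∀ N : ModuleCat.{u} A, ProjDimLE A N r

/-- the global dimension, as an element of `ℕ∞`. -/
noncomputable def gldim (A : Type u) [Ring A] : ℕ∞ :=
  sInf {c : ℕ∞ | ∃ r : ℕ, c = (r : ℕ∞) ∧ GldimLE A r}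

/-- dominant dimension at least `r`: there is an exact sequence
`0 → A → I^0 → ⋯ → I^(r-1)` with all `I^i` projective-injective. -/
def DomdimGE (A : Type u) [Ring A] (r : ℕ) : Prop :=
  ∃ (I : ℕ → ModuleCat.{u} A) (f : ModuleCat.of A A ⟶ I 0) (g : ∀ i : ℕ, I i ⟶ I (i + 1)),
    Mono f ∧ (∀ i, i < r → Injective (I i) ∧ Projective (I i)) ∧
    (2 ≤ r → ∃ w : f ≫ g 0 = 0, (ShortComplex.mk f (g 0) w).Exact) ∧
    (∀ i, i + 3 ≤ r → ∃ w : g i ≫ g (i + 1) = 0, (ShortComplex.mk (g i) (g (i + 1)) w).Exact)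

/-- the dominant dimension, as an element of `ℕ∞`. -/
noncomputable def domdim (A : Type u) [Ring A] : ℕ∞ :=
  sSup {c : ℕ∞ | ∃ r : ℕ, c = (r : ℕ∞) ∧ DomdimGE A r}

/-- the rigidity degree of a module, as an element of `ℕ∞`. -/
noncomputable def rigDeg [HasExt.{u} (ModuleCat.{u} Λ)] (M : ModuleCat.{u} Λ) : ℕ∞ :=
  sSup {c : ℕ∞ | ∃ r : ℕ, c = (r : ℕ∞) ∧ 0 < r ∧
    ∀ i : ℕ, 1 ≤ i → i ≤ r → Subsingleton (Abelian.Ext M M i)}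

/-- the rigidity dimension. -/
noncomputable def rigdim : ℕ∞ :=
  sSup {c : ℕ∞ | ∃ M : ModuleCat.{u} Λ, Module.Finite Λ M ∧ IsGenCogen Λ M ∧
    (∃ r : ℕ, GldimLE (End (op M)) r) ∧ c = domdim (End (op M))}

/-- An Auslander-Reiten (almost split) sequence. -/
def IsARSeq {X Y Z : ModuleCat.{u} Λ} (f : X ⟶ Y) (g : Y ⟶ Z) : Prop :=
  Mono f ∧ Epi g ∧ (∃ w : f ≫ g = 0, (ShortComplex.mk f g w).Exact) ∧
  Indec Λ X ∧ Indec Λ Z ∧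
  (¬ ∃ s : Z ⟶ Y, s ≫ g = 𝟙 Z) ∧
  (∀ (W : ModuleCat.{u} Λ) (h : W ⟶ Z), (¬ ∃ s : Z ⟶ W, s ≫ h = 𝟙 Z) →
    ∃ h' : W ⟶ Y, h' ≫ g = h)

/-- `X` has composition length `t`. -/
def HasCompLength (X : ModuleCat.{u} Λ) (t : ℕ) : Prop :=
  (∃ c : Fin (t + 1) → Submodule Λ X, StrictMono c ∧ c 0 = ⊥ ∧ c (Fin.last t) = ⊤) ∧
  ∀ r : ℕ, (∃ c : Fin (r + 1) → Submodule Λ X, StrictMono c ∧ c 0 = ⊥ ∧ c (Fin.last r) = ⊤) →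
    r ≤ t


/-- powers of the Jacobson radical, as left submodules of `Λ`. -/
def radPow (Λ : Type u) [Ring Λ] : ℕ → Submodule Λ Λ
  | 0 => ⊤
  | r + 1 => Submodule.span Λ
      {x : Λ | ∃ a ∈ Ideal.jacobson (⊥ : Ideal Λ), ∃ b ∈ radPow Λ r, x = a * b}

/-- `Λ` is the connected self-injective Nakayama algebra over `k`
with `n` simple modules and Loewy length `m`. -/
structure IsSelfInjNakayama (k : Type u) (Λ : Type u) [Field k] [Ring Λ] [Algebra k Λ]
    (n m : ℕ) : Prop where
  findim : FiniteDimensional k Λ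
  connected : ∀ e : Λ, IsIdempotentElem e → e ∈ Set.center Λ → e = 0 ∨ e = 1
  selfinj : Injective (ModuleCat.of Λ Λ)
  uniserial : ∀ X : ModuleCat.{u} Λ, Module.Finite Λ X → Indec Λ X →
    ∀ N₁ N₂ : Submodule Λ X, N₁ ≤ N₂ ∨ N₂ ≤ N₁
  simples : ∃ S : Fin n → ModuleCat.{u} Λ, (∀ i, IsSimpleModule Λ (S i)) ∧
    (∀ i j, Nonempty (S i ≅ S j) → i = j) ∧
    ∀ T : ModuleCat.{u} Λ, IsSimpleModule Λ T → ∃ i, Nonempty (T ≅ S i)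
  loewy_top : radPow Λ m = ⊥
  loewy_bot : radPow Λ (m - 1) ≠ ⊥

end Rigidity

set_option linter.unusedSectionVars false

namespace Rigidity

section HomFunctor
variable {Λ : Type u} [Ring Λ]

/-- The endomorphism ring of `op M` is the opposite of the endomorphism ring of `M`. -/
def endOpIso (M : ModuleCat.{u} Λ) : End (op M) ≃+* (End M)ᵐᵒᵖ where
  toFun f := MulOpposite.op f.unop
  invFun f := Quiver.Hom.op f.unop
  left_inv _ := rfl
  right_inv _ := rfl
  map_mul' _ _ := rfl
  map_add' _ _ := rfl

/-- The functor `Hom(M, -)` with values in modules over the endomorphism ring. -/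
noncomputable def homF (M : ModuleCat.{u} Λ) : ModuleCat.{u} Λ ⥤ ModuleCat.{u} (End (op M)) :=
  preadditiveCoyonedaObj M ⋙ ModuleCat.restrictScalars (endOpIso M).toRingHom

variable (M : ModuleCat.{u} Λ)

instance : (homF M).Additive := by unfold homF; infer_instance

instance : PreservesLimits (homF M) := by unfold homF; infer_instance

instance : PreservesFiniteLimits (homF M) :=
  PreservesLimits.preservesFiniteLimits _

/-- A morphism out of `M` as an element of the module `Hom(M, X)`. -/
def toHomF {M X : ModuleCat.{u} Λ} (x : M ⟶ X) : (homF M).obj X := x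

/-- An element of the module `Hom(M, X)` as a morphism. -/
def ofHomF {M X : ModuleCat.{u} Λ} (x : (homF M).obj X) : M ⟶ X := x

@[simp] lemma ofHomF_toHomF {M X : ModuleCat.{u} Λ} (x : M ⟶ X) : ofHomF (toHomF x) = x := rfl

lemma ofHomF_injective {M X : ModuleCat.{u} Λ} {x y : (homF M).obj X}
    (h : ofHomF x = ofHomF y) : x = y := h

lemma ofHomF_map {M X Y : ModuleCat.{u} Λ} (g : X ⟶ Y) (x : (homF M).obj X) :
    ofHomF (((homF M).map g) x) = ofHomF x ≫ g := rfl

lemma ofHomF_smul {M X : ModuleCat.{u} Λ} (a : End (op M)) (x : (homF M).obj X) :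
    ofHomF (a • x) = a.unop ≫ ofHomF x := rfl

lemma full_homF (hM : IsSeparator M) : (homF M).Full := by
  have := IsGrothendieckAbelian.GabrielPopescu.full M hM
  have := ModuleCat.restrictScalars_isEquivalence_of_ringEquiv (endOpIso M)
  unfold homF
  exact Functor.Full.comp _ (ModuleCat.restrictScalars (endOpIso M).toRingHom)

lemma faithful_homF (hM : IsSeparator M) : (homF M).Faithful := by
  have := (isSeparator_iff_faithful_preadditiveCoyonedaObj M).1 hM
  unfold homF
  infer_instance

lemma preservesInjective_homF (hM : IsSeparator M) {X : ModuleCat.{u} Λ} (hX : Injective X) :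
    Injective ((homF M).obj X) := by
  have := IsGrothendieckAbelian.GabrielPopescu.preservesInjectiveObjects M hM
  have := ModuleCat.restrictScalars_isEquivalence_of_ringEquiv (endOpIso M)
  have h : Injective ((preadditiveCoyonedaObj M).obj X) :=
    Functor.PreservesInjectiveObjects.injective_obj hX
  exact (Equivalence.map_injective_iff
    (ModuleCat.restrictScalars (endOpIso M).toRingHom).asEquivalence _).2 h

lemma injective_of_homF (hM : IsSeparator M) {X : ModuleCat.{u} Λ}
    (hX : Injective ((homF M).obj X)) : Injective X := by
  have := full_homF M hM
  have := faithful_homF M hM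
  exact Functor.injective_of_map_injective (homF M) hX

/-- `Hom(M, M)` is the regular module. -/
noncomputable def homFSelfEquiv : ((homF M).obj M) ≃ₗ[End (op M)] End (op M) where
  toFun x := Quiver.Hom.op (ofHomF x)
  invFun x := toHomF (Quiver.Hom.unop x)
  left_inv _ := rfl
  right_inv _ := rfl
  map_add' _ _ := rfl
  map_smul' _ _ := rfl

/-- `Hom(M, M)` is the regular module, as an isomorphism. -/
noncomputable def homFSelf : (homF M).obj M ≅ ModuleCat.of (End (op M)) (End (op M)) :=
  (homFSelfEquiv M).toModuleIso

instance : Projective ((homF M).obj M) := by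
  have : Projective (ModuleCat.of (End (op M)) (End (op M))) :=
    ModuleCat.projective_of_free (Module.Free.chooseBasis _ _)
  exact Projective.of_iso (homFSelf M).symm this

lemma exact_homF_iff (S : ShortComplex (ModuleCat.{u} Λ)) :
    (S.map (homF M)).Exact ↔ ∀ y : M ⟶ S.X₂, y ≫ S.g = 0 → ∃ x : M ⟶ S.X₁, x ≫ S.f = y := by
  rw [ShortComplex.moduleCat_exact_iff]
  constructor
  · intro h y hy
    obtain ⟨x, hx⟩ := h (toHomF y) (by
      change toHomF (y ≫ S.g) = 0
      rw [hy]; rfl)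
    exact ⟨ofHomF x, hx⟩
  · intro h y hy
    obtain ⟨x, hx⟩ := h (ofHomF y) hy
    exact ⟨toHomF x, hx⟩

lemma epi_homF_iff {X Y : ModuleCat.{u} Λ} (g : X ⟶ Y) :
    Epi ((homF M).map g) ↔ ∀ y : M ⟶ Y, ∃ x : M ⟶ X, x ≫ g = y := by
  rw [ModuleCat.epi_iff_surjective]
  constructor
  · intro h y
    obtain ⟨x, hx⟩ := h (toHomF y)
    exact ⟨ofHomF x, hx⟩
  · intro h y
    obtain ⟨x, hx⟩ := h (ofHomF y)
    exact ⟨toHomF x, hx⟩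

lemma mono_homF {X Y : ModuleCat.{u} Λ} (g : X ⟶ Y) [Mono g] : Mono ((homF M).map g) :=
  inferInstance

lemma shortExact_homF {S : ShortComplex (ModuleCat.{u} Λ)} (hS : S.ShortExact)
    (h : ∀ y : M ⟶ S.X₃, ∃ x : M ⟶ S.X₂, x ≫ S.g = y) : (S.map (homF M)).ShortExact := by
  have := hS.mono_f
  have := hS.epi_g
  refine { exact := ?_, mono_f := ?_, epi_g := ?_ }
  · rw [exact_homF_iff]
    intro y hy
    exact ⟨hS.exact.lift y hy, hS.exact.lift_f y hy⟩
  · exact mono_homF M S.f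
  · exact (epi_homF_iff M S.g).2 h

end HomFunctor

section AddClosure
variable {Λ : Type u} [Ring Λ]

lemma inAdd_iff (M X : ModuleCat.{u} Λ) :
    InAdd Λ M X ↔ ∃ r : ℕ, Nonempty (Retract X (⨁ fun _ : Fin r => M)) := by
  constructor
  · rintro ⟨r, Y, ⟨e⟩⟩
    exact ⟨r, ⟨{ i := biprod.inl ≫ e.hom, r := e.inv ≫ biprod.fst, retract := by simp }⟩⟩
  · rintro ⟨r, ⟨h⟩⟩
    let S : ShortComplex (ModuleCat.{u} Λ) := ShortComplex.mk h.i (cokernel.π h.i) (by simp)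
    have hS : S.Exact := ShortComplex.exact_of_g_is_cokernel _ (cokernelIsCokernel h.i)
    have := (inferInstance : Epi (cokernel.π h.i))
    let s : S.Splitting := ShortComplex.Splitting.ofExactOfRetraction S hS h.r h.retract this
    exact ⟨r, _, ⟨s.isoBinaryBiproduct.symm⟩⟩

lemma InAdd.of_retract {M X Y : ModuleCat.{u} Λ} (h : InAdd Λ M Y) (e : Retract X Y) :
    InAdd Λ M X := by
  rw [inAdd_iff] at h ⊢
  obtain ⟨r, ⟨f⟩⟩ := h
  exact ⟨r, ⟨e.trans f⟩⟩

lemma InAdd.of_iso {M X Y : ModuleCat.{u} Λ} (h : InAdd Λ M Y) (e : X ≅ Y) :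
    InAdd Λ M X := h.of_retract (Retract.ofIso e)

lemma InAdd.self (M : ModuleCat.{u} Λ) : InAdd Λ M M := by
  rw [inAdd_iff]
  exact ⟨1, ⟨{ i := biproduct.ι (fun _ : Fin 1 => M) 0, r := biproduct.π (fun _ : Fin 1 => M) 0,
               retract := by simp }⟩⟩

lemma InAdd.biproduct {M : ModuleCat.{u} Λ} {s : ℕ} {X : Fin s → ModuleCat.{u} Λ}
    (h : ∀ i, InAdd Λ M (X i)) : InAdd Λ M (⨁ X) := by
  simp_rw [inAdd_iff] at h ⊢
  choose r f using h
  let φ : (Σ i, Fin (r i)) ≃ Fin (∑ i, r i) := finSigmaFinEquiv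
  refine ⟨∑ i, r i, ⟨?_⟩⟩
  let e : Retract (⨁ X) (⨁ fun i => ⨁ fun _ : Fin (r i) => M) :=
    { i := biproduct.map fun i => (f i).some.i
      r := biproduct.map fun i => (f i).some.r
      retract := by
        apply biproduct.hom_ext
        intro j
        simp }
  refine e.trans ((Retract.ofIso ?_))
  exact biproductBiproductIso _ _ ≪≫ 
    biproduct.whiskerEquiv (f := fun _ : (Σ i, Fin (r i)) => M) (g := fun _ => M) φ
      (fun _ => Iso.refl M)

lemma InAdd.zero {M X : ModuleCat.{u} Λ} (h : IsZero X) : InAdd Λ M X := by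
  rw [inAdd_iff]
  exact ⟨0, ⟨{ i := 0, r := 0, retract := h.eq_of_src _ _ }⟩⟩

lemma InAdd.biprod {M X Y : ModuleCat.{u} Λ} (hX : InAdd Λ M X) (hY : InAdd Λ M Y) :
    InAdd Λ M (X ⊞ Y) := by
  have h : InAdd Λ M (⨁ ![X, Y]) := InAdd.biproduct (fun i => by fin_cases i <;> assumption)
  let i₁ : X ⟶ ⨁ ![X, Y] := biproduct.ι ![X, Y] 0
  let i₂ : Y ⟶ ⨁ ![X, Y] := biproduct.ι ![X, Y] 1
  let p₁ : ⨁ ![X, Y] ⟶ X := biproduct.π ![X, Y] 0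
  let p₂ : ⨁ ![X, Y] ⟶ Y := biproduct.π ![X, Y] 1
  have h₁₁ : i₁ ≫ p₁ = 𝟙 X := biproduct.ι_π_self ![X, Y] 0
  have h₂₂ : i₂ ≫ p₂ = 𝟙 Y := biproduct.ι_π_self ![X, Y] 1
  have h₁₂ : i₁ ≫ p₂ = 0 := biproduct.ι_π_ne ![X, Y] (by decide)
  have h₂₁ : i₂ ≫ p₁ = 0 := biproduct.ι_π_ne ![X, Y] (by decide)
  refine h.of_retract { i := biprod.desc i₁ i₂, r := biprod.lift p₁ p₂, retract := ?_ }
  apply biprod.hom_ext' <;> apply biprod.hom_ext <;> simp [h₁₁, h₁₂, h₂₁, h₂₂]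

lemma finite_of_retract {X Y : ModuleCat.{u} Λ} [Module.Finite Λ Y] (e : Retract X Y) :
    Module.Finite Λ X := by
  exact Module.Finite.of_surjective e.r.hom fun x =>
    ⟨e.i x, ConcreteCategory.congr_hom e.retract x⟩

instance finite_biproduct {s : ℕ} (X : Fin s → ModuleCat.{u} Λ) [∀ i, Module.Finite Λ (X i)] :
    Module.Finite Λ (⨁ X : ModuleCat.{u} Λ) :=
  Module.Finite.equiv (ModuleCat.biproductIsoPi X).toLinearEquiv.symm

lemma InAdd.finite {M X : ModuleCat.{u} Λ} [Module.Finite Λ M] (h : InAdd Λ M X) :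
    Module.Finite Λ X := by
  obtain ⟨r, ⟨e⟩⟩ := (inAdd_iff M X).1 h
  exact finite_of_retract e

lemma isSeparator_of_inAdd {M : ModuleCat.{u} Λ} (h : InAdd Λ M (ModuleCat.of Λ Λ)) :
    IsSeparator M := by
  obtain ⟨r, ⟨e⟩⟩ := (inAdd_iff M _).1 h
  rw [Preadditive.isSeparator_iff]
  intro X Y f hf
  ext x
  let g : ModuleCat.of Λ Λ ⟶ X := ModuleCat.ofHom (LinearMap.toSpanSingleton Λ X x)
  have hg : g ≫ f = 0 := by
    have : e.r ≫ g ≫ f = 0 := by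
      apply biproduct.hom_ext'
      intro j
      have := hf (biproduct.ι (fun _ : Fin r => M) j ≫ e.r ≫ g)
      simpa using this
    rw [← Category.id_comp (g ≫ f), ← e.retract, Category.assoc, this, comp_zero]
  have := ConcreteCategory.congr_hom hg (1 : Λ)
  simpa [g] using this

lemma projective_biproduct {s : ℕ} {X : Fin s → ModuleCat.{u} Λ} (h : ∀ i, Projective (X i)) :
    Projective (⨁ X) where
  factors {E Z} f g _ := ⟨biproduct.desc fun i => Projective.factorThru (biproduct.ι X i ≫ f) g, by
    apply biproduct.hom_ext'
    intro j
    simp⟩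

lemma projective_homF {M X : ModuleCat.{u} Λ} (h : InAdd Λ M X) :
    Projective ((homF M).obj X) := by
  obtain ⟨r, ⟨e⟩⟩ := (inAdd_iff M X).1 h
  have h2 : Projective ((homF M).obj (⨁ fun _ : Fin r => M)) :=
    Projective.of_iso ((homF M).mapBiproduct (fun _ : Fin r => M)).symm
      (projective_biproduct (X := fun _ : Fin r => (homF M).obj M) fun _ => inferInstance)
  exact (e.map (homF M)).projective

lemma exists_lift_of_projective_homF {M X Y Z : ModuleCat.{u} Λ} (hM : IsSeparator M)
    (hX : Projective ((homF M).obj X)) (g : Y ⟶ Z)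
    (hg : ∀ y : M ⟶ Z, ∃ x : M ⟶ Y, x ≫ g = y) (f : X ⟶ Z) :
    ∃ h : X ⟶ Y, h ≫ g = f := by
  have := full_homF M hM
  have := faithful_homF M hM
  have := (epi_homF_iff M g).2 hg
  refine ⟨(homF M).preimage (Projective.factorThru ((homF M).map f) ((homF M).map g)), ?_⟩
  apply (homF M).map_injective
  simp

lemma exists_lift_of_inAdd {M X Y Z : ModuleCat.{u} Λ} (hX : InAdd Λ M X) (g : Y ⟶ Z)
    (hg : ∀ y : M ⟶ Z, ∃ x : M ⟶ Y, x ≫ g = y) (f : X ⟶ Z) :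
    ∃ h : X ⟶ Y, h ≫ g = f := by
  obtain ⟨r, ⟨e⟩⟩ := (inAdd_iff M X).1 hX
  choose t ht using fun i : Fin r => hg (biproduct.ι (fun _ : Fin r => M) i ≫ e.r ≫ f)
  refine ⟨e.i ≫ biproduct.desc t, ?_⟩
  have : biproduct.desc t ≫ g = e.r ≫ f := by
    apply biproduct.hom_ext'
    intro j
    simp [ht]
  rw [Category.assoc, this, e.retract_assoc]

end AddClosure

section Realisation
variable {Λ : Type u} [Ring Λ]

lemma exists_finset_support {M : ModuleCat.{u} Λ} [Module.Finite Λ M] {ι : Type u}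
    (y : M →ₗ[Λ] (ι →₀ M)) : ∃ S : Finset ι, ∀ x j, j ∉ S → y x j = 0 := by
  classical
  obtain ⟨G, hG⟩ := (inferInstance : Module.Finite Λ M).fg_top
  refine ⟨G.biUnion fun g => (y g).support, fun x j hj => ?_⟩
  have hx : x ∈ Submodule.span Λ (G : Set M) := hG ▸ Submodule.mem_top
  induction hx using Submodule.span_induction with
  | mem g hg =>
    by_contra h
    exact hj (Finset.mem_biUnion.2 ⟨g, hg, Finsupp.mem_support_iff.2 h⟩)
  | zero => simp
  | add a b _ _ ha hb => simp [ha, hb]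
  | smul c a _ ha => simp [ha]

lemma bijective_linearCombination_homF {M : ModuleCat.{u} Λ} [Module.Finite Λ M] (ι : Type u) :
    Function.Bijective (Finsupp.linearCombination (End (op M)) (fun j : ι =>
      (toHomF (ModuleCat.ofHom (Finsupp.lsingle j)) :
        (homF M).obj (ModuleCat.of Λ (ι →₀ M))))) := by
  classical
  set φ := Finsupp.linearCombination (End (op M)) (fun j : ι =>
      (toHomF (ModuleCat.ofHom (Finsupp.lsingle j)) :
        (homF M).obj (ModuleCat.of Λ (ι →₀ M)))) with hφ
  have key : ∀ (a : ι →₀ End (op M)) (j : ι), ((homF M).map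
      (ModuleCat.ofHom (Finsupp.lapply j : (ι →₀ M) →ₗ[Λ] M))) (φ a) =
      toHomF (a j).unop := by
    intro a j
    induction a using Finsupp.induction_linear with
    | zero => simp; rfl
    | add a b ha hb => rw [map_add, map_add, ha, hb]; rfl
    | single i a =>
      rw [hφ, Finsupp.linearCombination_single, map_smul]
      by_cases h : i = j
      · subst h
        rw [Finsupp.single_eq_same]
        apply ofHomF_injective
        rw [ofHomF_smul, ofHomF_map]
        ext x
        simp
      · rw [Finsupp.single_eq_of_ne (Ne.symm h)]
        apply ofHomF_injective
        rw [ofHomF_smul, ofHomF_map]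
        ext x
        simp [h]
  constructor
  · rw [injective_iff_map_eq_zero]
    intro a ha
    ext j
    have := key a j
    rw [ha, map_zero] at this
    exact congrArg (fun z => (ofHomF z).op) this.symm
  · intro y
    obtain ⟨S, hS⟩ := exists_finset_support (ofHomF y).hom
    refine ⟨∑ j ∈ S, Finsupp.single j
      (ofHomF y ≫ ModuleCat.ofHom (Finsupp.lapply j : (ι →₀ M) →ₗ[Λ] M)).op, ?_⟩
    apply ofHomF_injective
    ext x j
    set a : ι →₀ End (op M) := ∑ j ∈ S, Finsupp.single j
      (ofHomF y ≫ ModuleCat.ofHom (Finsupp.lapply j : (ι →₀ M) →ₗ[Λ] M)).op with ha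
    have h1 := congrArg (fun z => (ofHomF z).hom x) (key a j)
    refine Eq.trans h1 ?_
    rw [ofHomF_toHomF, ha, Finsupp.finsetSum_apply]
    simp only [Finsupp.single_apply]
    by_cases hj : j ∈ S
    · rw [Finset.sum_eq_single_of_mem j hj (by intro b _ hb; simp [hb])]
      simp
    · rw [Finset.sum_eq_zero (by
        intro b hb
        rw [if_neg]
        rintro rfl
        exact hj hb), hS x j hj]
      rfl

lemma exists_iso_homF_of_projective {M : ModuleCat.{u} Λ} [Module.Finite Λ M]
    (hM : IsSeparator M) (J : ModuleCat.{u} (End (op M))) (hJ : Projective J) :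
    ∃ X : ModuleCat.{u} Λ, Nonempty (J ≅ (homF M).obj X) := by
  have := full_homF M hM
  have := faithful_homF M hM
  let Q := ModuleCat.of Λ (J →₀ M)
  let e : ModuleCat.of (End (op M)) (J →₀ End (op M)) ≅ (homF M).obj Q :=
    (LinearEquiv.ofBijective _ (bijective_linearCombination_homF J)).toModuleIso
  let p : (homF M).obj Q ⟶ J :=
    e.inv ≫ ModuleCat.ofHom (Finsupp.linearCombination (End (op M)) (fun j : J => j))
  have hp : Epi p := by
    have : Epi (ModuleCat.ofHom
        (Finsupp.linearCombination (End (op M)) (fun j : J => j))) := by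
      rw [ModuleCat.epi_iff_surjective]
      intro j
      exact ⟨Finsupp.single j 1,
        (Finsupp.linearCombination_single _ _ _).trans (one_smul (End (op M)) j)⟩
    exact epi_comp _ _
  let s := Projective.factorThru (𝟙 J) p
  have hs : s ≫ p = 𝟙 J := Projective.factorThru_comp _ _
  obtain ⟨X, i, r, h1, h2⟩ := IsIdempotentComplete.idempotents_split Q
    ((homF M).preimage (p ≫ s)) (by
      apply (homF M).map_injective
      simp [reassoc_of% hs])
  have h3 : (homF M).map r ≫ (homF M).map i = p ≫ s := by
    rw [← Functor.map_comp, h2, Functor.map_preimage]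
  have h4 : (homF M).map i ≫ (homF M).map r = 𝟙 _ := by
    rw [← Functor.map_comp, h1, CategoryTheory.Functor.map_id]
  refine ⟨X, ⟨⟨s ≫ (homF M).map r, (homF M).map i ≫ p, ?_, ?_⟩⟩⟩
  · rw [Category.assoc, reassoc_of% h3, hs, Category.comp_id, hs]
  · rw [Category.assoc, ← reassoc_of% h3, h4]
    simp [← Functor.map_comp, h1]

end Realisation

section ExtLifting
open Abelian
variable {Λ : Type u} [Ring Λ]

lemma exists_lift_of_ext_one {S : ShortComplex (ModuleCat.{u} Λ)} (hS : S.ShortExact)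
    {U : ModuleCat.{u} Λ} (h : Subsingleton (Ext U S.X₁ 1)) (y : U ⟶ S.X₃) :
    ∃ x : U ⟶ S.X₂, x ≫ S.g = y := by
  obtain ⟨x, hx⟩ := Ext.covariant_sequence_exact₃ U hS (Ext.mk₀ y) (zero_add 1)
    (Subsingleton.elim _ _)
  obtain ⟨x, rfl⟩ := (Ext.mk₀_bijective _ _).2 x
  refine ⟨x, (Ext.mk₀_bijective _ _).1 ?_⟩
  rw [← hx, Ext.mk₀_comp_mk₀]

lemma ext_one_of_exists_lift {S : ShortComplex (ModuleCat.{u} Λ)} (hS : S.ShortExact)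
    (hI : Injective S.X₂) {U : ModuleCat.{u} Λ}
    (h : ∀ y : U ⟶ S.X₃, ∃ x : U ⟶ S.X₂, x ≫ S.g = y) : Subsingleton (Ext U S.X₁ 1) := by
  refine subsingleton_of_forall_eq 0 fun x₁ => ?_
  obtain ⟨x₃, rfl⟩ := Ext.covariant_sequence_exact₁ U hS x₁ (Ext.eq_zero_of_injective _)
    (zero_add 1)
  obtain ⟨y, rfl⟩ := (Ext.mk₀_bijective _ _).2 x₃
  obtain ⟨x, rfl⟩ := h y
  rw [← Ext.mk₀_comp_mk₀, Ext.comp_assoc_of_second_deg_zero, hS.comp_extClass, Ext.comp_zero]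

lemma ext_one_of_ext_two {S : ShortComplex (ModuleCat.{u} Λ)} (hS : S.ShortExact)
    (hI : Injective S.X₂) {U : ModuleCat.{u} Λ} (h : Subsingleton (Ext U S.X₁ 2)) :
    Subsingleton (Ext U S.X₃ 1) := by
  refine subsingleton_of_forall_eq 0 fun x₃ => ?_
  obtain ⟨x₂, rfl⟩ := Ext.covariant_sequence_exact₃ U hS x₃ (n₁ := 2) rfl
    (Subsingleton.elim _ _)
  rw [Ext.eq_zero_of_injective x₂, Ext.zero_comp]

lemma ext_two_of_ext_one {S : ShortComplex (ModuleCat.{u} Λ)} (hS : S.ShortExact)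
    (hI : Injective S.X₂) {U : ModuleCat.{u} Λ} (h : Subsingleton (Ext U S.X₃ 1)) :
    Subsingleton (Ext U S.X₁ 2) := by
  refine subsingleton_of_forall_eq 0 fun x₁ => ?_
  obtain ⟨x₃, rfl⟩ := Ext.covariant_sequence_exact₁ U hS x₁ (Ext.eq_zero_of_injective _)
    (n₀ := 1) rfl
  rw [Subsingleton.elim x₃ 0, Ext.zero_comp]

lemma subsingleton_ext_of_inAdd {M U V : ModuleCat.{u} Λ} {j : ℕ}
    (h : Subsingleton (Ext U M j)) (hV : InAdd Λ M V) : Subsingleton (Ext U V j) := by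
  obtain ⟨r, ⟨e⟩⟩ := (inAdd_iff M V).1 hV
  refine subsingleton_of_forall_eq 0 fun x => ?_
  have h1 : x.comp (Ext.mk₀ e.i) (add_zero j) = 0 := by
    rw [← Ext.comp_mk₀_id (x.comp (Ext.mk₀ e.i) (add_zero j)), ← biproduct.total]
    rw [Ext.mk₀_sum, Ext.comp_sum]
    refine Finset.sum_eq_zero fun i _ => ?_
    rw [← Ext.mk₀_comp_mk₀, ← Ext.comp_assoc_of_third_deg_zero]
    rw [Subsingleton.elim (Ext.comp (x.comp (Ext.mk₀ e.i) (add_zero j)) _ _) 0, Ext.zero_comp]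
  rw [← Ext.comp_mk₀_id x, ← e.retract, ← Ext.mk₀_comp_mk₀,
    ← Ext.comp_assoc_of_third_deg_zero, h1, Ext.zero_comp]

end ExtLifting

section DominantDimension
open Abelian
variable {Λ : Type u} [Ring Λ]

lemma exact_of_homF {M : ModuleCat.{u} Λ} (hM : InAdd Λ M (ModuleCat.of Λ Λ))
    {S : ShortComplex (ModuleCat.{u} Λ)}
    (h : ∀ y : M ⟶ S.X₂, y ≫ S.g = 0 → ∃ x : M ⟶ S.X₁, x ≫ S.f = y) : S.Exact := by
  rw [ShortComplex.moduleCat_exact_iff]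
  intro z hz
  let q : S.X₁ ⟶ kernel S.g := kernel.lift S.g S.f S.zero
  have hq : ∀ y : M ⟶ kernel S.g, ∃ x : M ⟶ S.X₁, x ≫ q = y := by
    intro y
    obtain ⟨x, hx⟩ := h (y ≫ kernel.ι S.g) (by simp)
    refine ⟨x, ?_⟩
    rw [← cancel_mono (kernel.ι S.g)]
    simpa [q] using hx
  let t : ModuleCat.of Λ Λ ⟶ S.X₂ := ModuleCat.ofHom (LinearMap.toSpanSingleton Λ S.X₂ z)
  have ht : t ≫ S.g = 0 := by
    ext
    simpa [t] using hz
  obtain ⟨x, hx⟩ := exists_lift_of_inAdd hM q hq (kernel.lift S.g t ht)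
  refine ⟨x (1 : Λ), ?_⟩
  have h2 : x ≫ S.f = t := by
    have := congrArg (· ≫ kernel.ι S.g) hx
    simpa [q] using this
  have h3 := ConcreteCategory.congr_hom h2 (1 : Λ)
  simpa [t] using h3

lemma exists_lift_cokernel {M Z X₀ X₁ X₂ : ModuleCat.{u} Λ} {a : Z ⟶ X₀} {b : X₀ ⟶ X₁}
    {c : X₁ ⟶ X₂} {w : a ≫ b = 0} (h : (ShortComplex.mk a b w).Exact) (w' : b ≫ c = 0)
    (hF : ∀ y : M ⟶ X₁, y ≫ c = 0 → ∃ x : M ⟶ X₀, x ≫ b = y) (y : M ⟶ cokernel a) :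
    ∃ x : M ⟶ X₀, x ≫ cokernel.π a = y := by
  have : Mono (cokernel.desc a b w) := h.mono_cokernelDesc
  have h0 : cokernel.desc a b w ≫ c = 0 := by
    rw [← cancel_epi (cokernel.π a)]
    simpa using w'
  obtain ⟨x, hx⟩ := hF (y ≫ cokernel.desc a b w) (by rw [Category.assoc, h0, comp_zero])
  refine ⟨x, ?_⟩
  rw [← cancel_mono (cokernel.desc a b w)]
  simpa using hx

lemma shortExact_cokernel {X Y : ModuleCat.{u} Λ} (f : X ⟶ Y) [Mono f] :
    (ShortComplex.mk f (cokernel.π f) (cokernel.condition f)).ShortExact where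
  exact := ShortComplex.exact_of_g_is_cokernel _ (cokernelIsCokernel f)

lemma exists_homF_coresolution {M : ModuleCat.{u} Λ} [Module.Finite Λ M]
    (hM : InAdd Λ M (ModuleCat.of Λ Λ)) {r : ℕ} (hr : 3 ≤ r) (h : DomdimGE (End (op M)) r) :
    ∃ (X : ℕ → ModuleCat.{u} Λ) (a : M ⟶ X 0) (b : ∀ i, X i ⟶ X (i + 1)),
      Mono a ∧ (∀ i, i < r → Injective (X i)) ∧
      (∃ w : a ≫ b 0 = 0, (ShortComplex.mk a (b 0) w).Exact) ∧
      (∀ i, i + 3 ≤ r → ∃ w : b i ≫ b (i + 1) = 0,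
        ((ShortComplex.mk (b i) (b (i + 1)) w).map (homF M)).Exact) := by
  have hs := isSeparator_of_inAdd hM
  have := full_homF M hs
  have := faithful_homF M hs
  obtain ⟨I, f, g, hf, hI, h0, h1⟩ := h
  have hX : ∀ i : ℕ, ∃ X : ModuleCat.{u} Λ, i < r → Nonempty (I i ≅ (homF M).obj X) := by
    intro i
    by_cases hi : i < r
    · obtain ⟨X, hX⟩ := exists_iso_homF_of_projective hs (I i) (hI i hi).2
      exact ⟨X, fun _ => hX⟩
    · exact ⟨M, fun h => absurd h hi⟩
  choose X e using hX
  let a : M ⟶ X 0 := (homF M).preimage ((homFSelf M).hom ≫ f ≫ (e 0 (by lia)).some.hom)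
  let b : ∀ i, X i ⟶ X (i + 1) := fun i =>
    if hi : i + 1 < r then (homF M).preimage
      ((e i (by lia)).some.inv ≫ g i ≫ (e (i + 1) hi).some.hom) else 0
  have ha : (homF M).map a = (homFSelf M).hom ≫ f ≫ (e 0 (by lia)).some.hom := by simp [a]
  have hb : ∀ i (hi : i + 1 < r), (homF M).map (b i) =
      (e i (by lia)).some.inv ≫ g i ≫ (e (i + 1) hi).some.hom := by
    intro i hi
    simp [b, hi]
  refine ⟨X, a, b, ?_, ?_, ?_, ?_⟩
  · apply (homF M).mono_of_mono_map
    rw [ha]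
    infer_instance
  · intro i hi
    exact injective_of_homF M hs (Injective.of_iso (e i hi).some (hI i hi).1)
  · obtain ⟨w, hw⟩ := h0 (by lia)
    have w' : a ≫ b 0 = 0 := by
      apply (homF M).map_injective
      rw [Functor.map_comp, ha, hb 0 (by lia)]
      simp [reassoc_of% w]
    refine ⟨w', exact_of_homF hM ?_⟩
    refine (exact_homF_iff M (ShortComplex.mk a (b 0) w')).1 ?_
    refine ShortComplex.exact_of_iso (ShortComplex.isoMk (homFSelf M).symm (e 0 (by lia)).some
      (e 1 (by lia)).some ?_ ?_) hw
    · change (homFSelf M).inv ≫ (homF M).map a = f ≫ (e 0 (by lia)).some.hom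
      rw [ha, Iso.inv_hom_id_assoc]
    · change (e 0 (by lia)).some.hom ≫ (homF M).map (b 0) = g 0 ≫ (e 1 (by lia)).some.hom
      rw [hb 0 (by lia), Iso.hom_inv_id_assoc]
  · intro i hi
    obtain ⟨w, hw⟩ := h1 i hi
    have w' : b i ≫ b (i + 1) = 0 := by
      apply (homF M).map_injective
      rw [Functor.map_comp, hb i (by lia), hb (i + 1) (by lia)]
      simp [reassoc_of% w]
    refine ⟨w', ?_⟩
    refine ShortComplex.exact_of_iso (ShortComplex.isoMk (e i (by lia)).some
      (e (i + 1) (by lia)).some (e (i + 2) (by lia)).some ?_ ?_) hw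
    · change (e i (by lia)).some.hom ≫ (homF M).map (b i) =
        g i ≫ (e (i + 1) (by lia)).some.hom
      rw [hb i (by lia), Iso.hom_inv_id_assoc]
    · change (e (i + 1) (by lia)).some.hom ≫ (homF M).map (b (i + 1)) =
        g (i + 1) ≫ (e (i + 2) (by lia)).some.hom
      rw [hb (i + 1) (by lia), Iso.hom_inv_id_assoc]

lemma ext_one_of_domdimGE {M : ModuleCat.{u} Λ} [Module.Finite Λ M]
    (hM : InAdd Λ M (ModuleCat.of Λ Λ)) {r : ℕ} (hr : 3 ≤ r) (h : DomdimGE (End (op M)) r) :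
    Subsingleton (Ext M M 1) := by
  obtain ⟨X, a, b, ha, hX, ⟨w, h0⟩, h1⟩ := exists_homF_coresolution hM hr h
  obtain ⟨w1, h1⟩ := h1 0 (by lia)
  refine ext_one_of_exists_lift (shortExact_cokernel a) (hX 0 (by lia)) ?_
  exact exists_lift_cokernel h0 w1 ((exact_homF_iff M _).1 h1)

lemma ext_two_of_domdimGE {M : ModuleCat.{u} Λ} [Module.Finite Λ M]
    (hM : InAdd Λ M (ModuleCat.of Λ Λ)) {r : ℕ} (hr : 4 ≤ r) (h : DomdimGE (End (op M)) r) :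
    Subsingleton (Ext M M 2) := by
  obtain ⟨X, a, b, ha, hX, ⟨w, h0⟩, h1⟩ := exists_homF_coresolution hM (by lia) h
  obtain ⟨w1, h1'⟩ := h1 0 (by lia)
  obtain ⟨w2, h2⟩ := h1 1 (by lia)
  have hm : Mono (cokernel.desc a (b 0) w) := h0.mono_cokernelDesc
  refine ext_two_of_ext_one (shortExact_cokernel a) (hX 0 (by lia)) ?_
  refine ext_one_of_exists_lift (shortExact_cokernel (cokernel.desc a (b 0) w))
    (hX 1 (by lia)) ?_
  have w3 : cokernel.desc a (b 0) w ≫ b 1 = 0 := by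
    rw [← cancel_epi (cokernel.π a)]
    simpa using w1
  refine exists_lift_cokernel (b := b 1) (w := w3) ?_ w2 ((exact_homF_iff M _).1 h2)
  have h4 : (ShortComplex.mk (b 0) (b 1) w1).Exact :=
    exact_of_homF hM ((exact_homF_iff M _).1 h1')
  let φ : ShortComplex.mk (b 0) (b 1) w1 ⟶ ShortComplex.mk (cokernel.desc a (b 0) w) (b 1) w3 :=
    { τ₁ := cokernel.π a, τ₂ := 𝟙 _, τ₃ := 𝟙 _ }
  have : Epi φ.τ₁ := (inferInstance : Epi (cokernel.π a))
  have : IsIso φ.τ₂ := (inferInstance : IsIso (𝟙 _))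
  have : Mono φ.τ₃ := (inferInstance : Mono (𝟙 _))
  exact (ShortComplex.exact_iff_of_epi_of_isIso_of_mono φ).1 h4

/-- If the dominant dimension is at least three, morphisms between objects of `add M` lift
along short exact sequences starting in `add M`. -/
lemma exists_lift_of_domdimGE_three {M : ModuleCat.{u} Λ} [Module.Finite Λ M]
    (hM : InAdd Λ M (ModuleCat.of Λ Λ)) {r : ℕ} (hr : 3 ≤ r) (h : DomdimGE (End (op M)) r)
    {S : ShortComplex (ModuleCat.{u} Λ)} (hS : S.ShortExact) (h₁ : InAdd Λ M S.X₁)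
    {U : ModuleCat.{u} Λ} (hU : InAdd Λ M U) (y : U ⟶ S.X₃) :
    ∃ x : U ⟶ S.X₂, x ≫ S.g = y :=
  exists_lift_of_inAdd hU S.g (exists_lift_of_ext_one hS
    (subsingleton_ext_of_inAdd (ext_one_of_domdimGE hM hr h) h₁)) y

/-- If the dominant dimension is at least four, morphisms from `add M` to a second cosyzygy of
an object of `add M` lift. -/
lemma exists_lift_of_domdimGE_four {M : ModuleCat.{u} Λ} [Module.Finite Λ M]
    (hM : InAdd Λ M (ModuleCat.of Λ Λ)) {r : ℕ} (hr : 4 ≤ r) (h : DomdimGE (End (op M)) r)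
    {S T : ShortComplex (ModuleCat.{u} Λ)} (hS : S.ShortExact) (h₁ : InAdd Λ M S.X₁)
    (h₂ : Injective S.X₂) (hT : T.ShortExact) (e : S.X₃ ≅ T.X₁)
    {U : ModuleCat.{u} Λ} (hU : InAdd Λ M U) (y : U ⟶ T.X₃) :
    ∃ x : U ⟶ T.X₂, x ≫ T.g = y := by
  have h3 := ext_one_of_ext_two hS h₂
    (subsingleton_ext_of_inAdd (ext_two_of_domdimGE hM hr h) h₁)
  have h4 : Subsingleton (Ext M T.X₁ 1) :=
    subsingleton_ext_of_inAdd (M := S.X₃) h3 ((InAdd.self _).of_iso e.symm)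
  exact exists_lift_of_inAdd hU T.g (exists_lift_of_ext_one hT h4) y

lemma domdimGE_of_exists_lift {M : ModuleCat.{u} Λ} [Module.Finite Λ M]
    (hM : InAdd Λ M (ModuleCat.of Λ Λ))
    (hE : ∀ X : ModuleCat.{u} Λ, Module.Finite Λ X → ∃ (I : ModuleCat.{u} Λ) (i : X ⟶ I),
      Mono i ∧ Injective I ∧ InAdd Λ M I)
    {X₀ : ModuleCat.{u} Λ} (a : M ⟶ X₀) (ha : Mono a) (hX₀ : Injective X₀)
    (hX₀' : InAdd Λ M X₀) :
    DomdimGE (End (op M)) 2 ∧ ((∀ y : M ⟶ cokernel a, ∃ x : M ⟶ X₀, x ≫ cokernel.π a = y) →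
      DomdimGE (End (op M)) 3) := by
  have hs := isSeparator_of_inAdd hM
  have := hX₀'.finite
  have : Module.Finite Λ (cokernel a : ModuleCat.{u} Λ) :=
    Module.Finite.of_surjective (cokernel.π a).hom
      ((ModuleCat.epi_iff_surjective _).1 inferInstance)
  obtain ⟨X₁, b, hb, hX₁, hX₁'⟩ := hE (cokernel a) inferInstance
  have := hX₁'.finite
  have : Module.Finite Λ (cokernel b : ModuleCat.{u} Λ) :=
    Module.Finite.of_surjective (cokernel.π b).hom
      ((ModuleCat.epi_iff_surjective _).1 inferInstance)
  obtain ⟨X₂, c, hc, hX₂, hX₂'⟩ := hE (cokernel b) inferInstance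
  let X : ℕ → ModuleCat.{u} Λ := fun i => match i with
    | 0 => X₀
    | 1 => X₁
    | _ => X₂
  let d : ∀ i, X i ⟶ X (i + 1) := fun i => match i with
    | 0 => cokernel.π a ≫ b
    | 1 => cokernel.π b ≫ c
    | _ => 0
  have hX : ∀ i, Injective (X i) ∧ InAdd Λ M (X i) := fun i => match i with
    | 0 => ⟨hX₀, hX₀'⟩
    | 1 => ⟨hX₁, hX₁'⟩
    | _ + 2 => ⟨hX₂, hX₂'⟩
  have w0 : (homFSelf M).inv ≫ (homF M).map a ≫ (homF M).map (d 0) = 0 := by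
    rw [← Functor.map_comp]
    simp [d]
  have e0 : (ShortComplex.mk ((homFSelf M).inv ≫ (homF M).map a) ((homF M).map (d 0))
      (by simpa using w0)).Exact := by
    have w : a ≫ d 0 = 0 := by simp [d]
    have : ((ShortComplex.mk a (d 0) w).map (homF M)).Exact := by
      rw [exact_homF_iff]
      intro y hy
      have hy' : y ≫ cokernel.π a = 0 := by
        rw [← cancel_mono b]
        simpa [d] using hy
      exact ⟨(shortExact_cokernel a).exact.lift y hy', (shortExact_cokernel a).exact.lift_f y hy'⟩
    refine ShortComplex.exact_of_iso (ShortComplex.isoMk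
      (S₁ := (ShortComplex.mk a (d 0) w).map (homF M)) (homFSelf M)
      (Iso.refl ((homF M).obj X₀)) (Iso.refl ((homF M).obj X₁)) ?_ ?_) this
    · change (homFSelf M).hom ≫ (homFSelf M).inv ≫ (homF M).map a = (homF M).map a ≫ 𝟙 _
      rw [Iso.hom_inv_id_assoc, Category.comp_id]
    · change 𝟙 _ ≫ (homF M).map (d 0) = (homF M).map (d 0) ≫ 𝟙 _
      rw [Category.id_comp, Category.comp_id]
  refine ⟨⟨fun i => (homF M).obj (X i), (homFSelf M).inv ≫ (homF M).map a,
      fun i => (homF M).map (d i), ?_, ?_, ?_, ?_⟩, fun hl => ⟨fun i => (homF M).obj (X i),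
      (homFSelf M).inv ≫ (homF M).map a, fun i => (homF M).map (d i), ?_, ?_, ?_, ?_⟩⟩
  · exact mono_comp _ _
  · exact fun i _ => ⟨preservesInjective_homF M hs (hX i).1, projective_homF (hX i).2⟩
  · exact fun _ => ⟨_, e0⟩
  · intro i hi
    lia
  · exact mono_comp _ _
  · exact fun i _ => ⟨preservesInjective_homF M hs (hX i).1, projective_homF (hX i).2⟩
  · exact fun _ => ⟨_, e0⟩
  · intro i hi
    obtain rfl : i = 0 := by lia
    have w : d 0 ≫ d 1 = 0 := by simp [d]
    refine ⟨by rw [← Functor.map_comp, w, Functor.map_zero], ?_⟩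
    change ((ShortComplex.mk (d 0) (d 1) w).map (homF M)).Exact
    rw [exact_homF_iff]
    intro y hy
    have hy' : y ≫ cokernel.π b = 0 := by
      rw [← cancel_mono c]
      simpa [d] using hy
    obtain ⟨x, hx⟩ := hl ((shortExact_cokernel b).exact.lift y hy')
    refine ⟨x, ?_⟩
    change x ≫ cokernel.π a ≫ b = y
    rw [reassoc_of% hx]
    exact (shortExact_cokernel b).exact.lift_f y hy'

end DominantDimension

section GlobalDimension
open Abelian ZeroObject
variable {A : Type u} [Ring A]

lemma shortExact_kernel {X Y : ModuleCat.{u} A} (f : X ⟶ Y) [Epi f] :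
    (ShortComplex.mk (kernel.ι f) f (kernel.condition f)).ShortExact where
  exact := ShortComplex.exact_of_f_is_kernel _ (kernelIsKernel f)

lemma hasProjectiveDimensionLT_of_projDimLE (r : ℕ) (N : ModuleCat.{u} A)
    (h : ProjDimLE A N r) : HasProjectiveDimensionLT N (r + 1) := by
  induction r generalizing N with
  | zero =>
    obtain ⟨P, d, f, hP, hz, hf, ⟨w, h0⟩, -⟩ := h
    have : Mono f := h0.mono_g ((hz 1 (by lia)).eq_of_src _ _)
    have : IsIso f := isIso_of_mono_of_epi f
    have := hP 0
    exact projective_iff_hasProjectiveDimensionLT_one.1 (Projective.of_iso (asIso f) this)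
  | succ r ih =>
    obtain ⟨P, d, f, hP, hz, hf, ⟨w, h0⟩, h1⟩ := h
    have hK : HasProjectiveDimensionLT (kernel f) (r + 1) := by
      apply ih
      have w' : d 1 ≫ kernel.lift f (d 0) w = 0 := by
        rw [← cancel_mono (kernel.ι f)]
        simpa using (h1 0).1
      refine ⟨fun i => P (i + 1), fun i => d (i + 1), kernel.lift f (d 0) w, fun i => hP _,
        fun i hi => hz _ (by lia), h0.epi_kernelLift, ⟨w', ?_⟩, fun i => h1 (i + 1)⟩
      obtain ⟨w2, h2⟩ := h1 0
      let φ : ShortComplex.mk (d 1) (kernel.lift f (d 0) w) w' ⟶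
          ShortComplex.mk (d 1) (d 0) w2 :=
        { τ₁ := 𝟙 _, τ₂ := 𝟙 _, τ₃ := kernel.ι f }
      have : Epi φ.τ₁ := (inferInstance : Epi (𝟙 _))
      have : IsIso φ.τ₂ := (inferInstance : IsIso (𝟙 _))
      have : Mono φ.τ₃ := (inferInstance : Mono (kernel.ι f))
      exact (ShortComplex.exact_iff_of_epi_of_isIso_of_mono φ).2 h2
    have := hP 0
    exact (shortExact_kernel f).hasProjectiveDimensionLT_X₃ (r + 1) hK inferInstance

lemma projDimLE_of_hasProjectiveDimensionLT (r : ℕ) (N : ModuleCat.{u} A)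
    (h : HasProjectiveDimensionLT N (r + 1)) : ProjDimLE A N r := by
  induction r generalizing N with
  | zero =>
    have hN : Projective N := projective_iff_hasProjectiveDimensionLT_one.2 h
    refine ⟨fun i => match i with | 0 => N | _ + 1 => 0, fun i => 0, 𝟙 N, ?_, ?_,
      inferInstance, ⟨by simp, ?_⟩, fun i => ⟨by simp, ?_⟩⟩
    · rintro (_ | i)
      · exact hN
      · exact (inferInstance : Projective (0 : ModuleCat.{u} A))
    · rintro (_ | i) hi
      · lia
      · exact isZero_zero _
    · rw [ShortComplex.exact_iff_mono _ rfl]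
      exact (inferInstance : Mono (𝟙 N))
    · exact ShortComplex.exact_of_isZero_X₂ _ (isZero_zero _)
  | succ r ih =>
    let p := Projective.π N
    obtain ⟨P, d, f, hP, hz, hf, ⟨w, h0⟩, h1⟩ := ih (kernel p)
      ((shortExact_kernel p).hasProjectiveDimensionLT_X₁ (r + 1)
        (hasProjectiveDimensionLT_of_ge _ 1 _ (by lia)) h)
    refine ⟨fun i => match i with | 0 => Projective.over N | i + 1 => P i,
      fun i => match i with | 0 => f ≫ kernel.ι p | i + 1 => d i, p, ?_, ?_,
      inferInstance, ⟨by simp, ?_⟩, ?_⟩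
    · rintro (_ | i)
      · exact (inferInstance : Projective (Projective.over N))
      · exact hP i
    · rintro (_ | i) hi
      · lia
      · exact hz i (by lia)
    · let φ : ShortComplex.mk (f ≫ kernel.ι p) p (by simp) ⟶
          ShortComplex.mk (kernel.ι p) p (kernel.condition p) :=
        { τ₁ := f, τ₂ := 𝟙 _, τ₃ := 𝟙 _ }
      have : Epi φ.τ₁ := hf
      have : IsIso φ.τ₂ := (inferInstance : IsIso (𝟙 _))
      have : Mono φ.τ₃ := (inferInstance : Mono (𝟙 _))
      exact (ShortComplex.exact_iff_of_epi_of_isIso_of_mono φ).2 (shortExact_kernel p).exact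
    · rintro (_ | i)
      · refine ⟨by simp [reassoc_of% w], ?_⟩
        let φ : ShortComplex.mk (d 0) f w ⟶
            ShortComplex.mk (d 0) (f ≫ kernel.ι p) (by simp [reassoc_of% w]) :=
          { τ₁ := 𝟙 _, τ₂ := 𝟙 _, τ₃ := kernel.ι p }
        have : Epi φ.τ₁ := (inferInstance : Epi (𝟙 _))
        have : IsIso φ.τ₂ := (inferInstance : IsIso (𝟙 _))
        have : Mono φ.τ₃ := (inferInstance : Mono (kernel.ι p))
        exact (ShortComplex.exact_iff_of_epi_of_isIso_of_mono φ).1 h0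
      · exact h1 i

lemma gldimLE_iff (r : ℕ) :
    GldimLE A r ↔ ∀ N : ModuleCat.{u} A, HasProjectiveDimensionLT N (r + 1) :=
  ⟨fun h N => hasProjectiveDimensionLT_of_projDimLE r N (h N),
    fun h N => projDimLE_of_hasProjectiveDimensionLT r N (h N)⟩

lemma injective_of_ext_one_cyclic (Y : ModuleCat.{u} A)
    (h : ∀ I : Submodule A A, Subsingleton (Ext (ModuleCat.of A (A ⧸ I)) Y 1)) :
    Injective Y := by
  rw [← Module.injective_iff_injective_object]
  apply Module.Baer.injective
  intro I g
  let S : ShortComplex (ModuleCat.{u} A) :=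
    ShortComplex.mk (ModuleCat.ofHom I.subtype) (ModuleCat.ofHom I.mkQ) (by
      ext x
      simp)
  have hS : S.ShortExact := by
    refine ModuleCat.shortComplex_shortExact S ?_ ?_ ?_
    · exact (LinearMap.exact_subtype_mkQ I)
    · exact I.injective_subtype
    · exact I.mkQ_surjective
  have hz : hS.extClass.comp (Ext.mk₀ (ModuleCat.ofHom g)) (add_zero 1) = 0 :=
    (h I).elim _ _
  obtain ⟨x, hx⟩ := Ext.contravariant_sequence_exact₁ hS Y (Ext.mk₀ (ModuleCat.ofHom g))
    (add_zero 1) hz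
  obtain ⟨x, rfl⟩ := (Ext.mk₀_bijective _ _).2 x
  rw [Ext.mk₀_comp_mk₀] at hx
  have hx' := (Ext.mk₀_bijective _ _).1 hx
  exact ⟨x.hom, fun y hy => ConcreteCategory.congr_hom hx' (⟨y, hy⟩ : I)⟩

lemma hasInjectiveDimensionLT_of_ext_cyclic (s : ℕ) (Y : ModuleCat.{u} A)
    (h : ∀ I : Submodule A A, Subsingleton (Ext (ModuleCat.of A (A ⧸ I)) Y (s + 1))) :
    HasInjectiveDimensionLT Y (s + 1) := by
  induction s generalizing Y with
  | zero => exact injective_iff_hasInjectiveDimensionLT_one.1 (injective_of_ext_one_cyclic Y h)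
  | succ s ih =>
    have hS := shortExact_cokernel (Injective.ι Y)
    refine hS.hasInjectiveDimensionLT_X₁ (s + 1) (ih _ fun I => ?_)
      (hasInjectiveDimensionLT_of_ge _ 1 _ (by lia))
    refine subsingleton_of_forall_eq 0 fun x₃ => ?_
    obtain ⟨x₂, rfl⟩ := Ext.covariant_sequence_exact₃ _ hS x₃ (n₁ := s + 2) rfl
      ((h I).elim _ _)
    rw [Ext.eq_zero_of_injective (I := Injective.under Y) x₂, Ext.zero_comp]

lemma gldimLE_of_cyclic (s : ℕ)
    (h : ∀ I : Submodule A A, HasProjectiveDimensionLT (ModuleCat.of A (A ⧸ I)) (s + 1)) :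
    GldimLE A s := by
  rw [gldimLE_iff]
  intro N
  have hY : ∀ Y : ModuleCat.{u} A, HasInjectiveDimensionLT Y (s + 1) := fun Y =>
    hasInjectiveDimensionLT_of_ext_cyclic s Y fun I =>
      HasProjectiveDimensionLT.subsingleton _ (s + 1) _ le_rfl Y
  exact HasProjectiveDimensionLT.mk fun i hi Y e =>
    have := hY Y
    e.eq_zero_of_hasInjectiveDimensionLT (s + 1) hi

end GlobalDimension

section Noetherian
variable {k Λ : Type u} [Field k] [Ring Λ] [Algebra k Λ]

lemma isNoetherian_end_op [FiniteDimensional k Λ] (M : ModuleCat.{u} Λ) [Module.Finite Λ M] :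
    IsNoetherianRing (End (op M)) := by
  let : Module k M := Module.compHom M (algebraMap k Λ)
  have : IsScalarTower k Λ M := IsScalarTower.of_algebraMap_smul fun _ _ => rfl
  have : SMulCommClass Λ k M := IsScalarTower.to_smulCommClass'
  have : Module.Finite k M := Module.Finite.trans Λ M
  let φ : k →+* End (op M) :=
    { toFun := fun c => Quiver.Hom.op (ModuleCat.ofHom (c • LinearMap.id))
      map_one' := by
        apply Quiver.Hom.unop_inj
        ext x
        simp
      map_mul' := fun a b => by
        apply Quiver.Hom.unop_inj
        ext x
        change (a * b) • x = b • (a • x)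
        rw [mul_comm, mul_smul]
      map_zero' := by
        apply Quiver.Hom.unop_inj
        ext x
        change (0 : k) • x = 0
        simp
      map_add' := fun a b => by
        apply Quiver.Hom.unop_inj
        ext x
        change (a + b) • x = a • x + b • x
        rw [add_smul] }
  let : Module k (End (op M)) := Module.compHom _ φ
  have : IsScalarTower k (End (op M)) (End (op M)) := ⟨fun a b c => mul_assoc (φ a) b c⟩
  obtain ⟨s, g, hg⟩ := Submodule.fg_iff_exists_fin_generating_family.1
    (inferInstance : Module.Finite Λ M).fg_top
  let ψ : End (op M) →ₗ[k] (Fin s → M) :=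
    { toFun := fun a i => a.unop.hom (g i)
      map_add' := fun a b => rfl
      map_smul' := fun c a => by
        funext i
        change a.unop.hom (c • g i) = c • a.unop.hom (g i)
        rw [← algebraMap_smul Λ c (g i), map_smul, algebraMap_smul] }
  have hψ : Function.Injective ψ := by
    rw [injective_iff_map_eq_zero]
    intro a ha
    apply Quiver.Hom.unop_inj
    apply ModuleCat.hom_ext
    apply LinearMap.ext_on_range hg
    intro i
    exact congrFun ha i
  have : IsNoetherian k (End (op M)) := isNoetherian_of_injective ψ hψ
  exact isNoetherian_of_tower k this

end Noetherian

section GldimEnd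
variable {Λ : Type u} [Ring Λ]

lemma exists_surjective_of_finite {A : Type u} [Ring A] {X : ModuleCat.{u} A}
    [Module.Finite A X] : ∃ (s : ℕ) (p : (⨁ fun _ : Fin s => ModuleCat.of A A) ⟶ X), Epi p := by
  obtain ⟨s, f, hf⟩ := Module.Finite.exists_fin' A X
  refine ⟨s, (ModuleCat.biproductIsoPi fun _ : Fin s => ModuleCat.of A A).hom ≫
    ModuleCat.ofHom f, ?_⟩
  have : Epi (ModuleCat.ofHom f) := (ModuleCat.epi_iff_surjective _).2 hf
  exact epi_comp _ _

/-- Bounded projective dimension on the image of `Hom(M, -)` bounds the global dimension. -/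
lemma gldimLE_end_op {M : ModuleCat.{u} Λ} [Module.Finite Λ M] [IsNoetherianRing Λ]
    (hM : InAdd Λ M (ModuleCat.of Λ Λ)) [IsNoetherianRing (End (op M))] (r : ℕ)
    (h : ∀ Z : ModuleCat.{u} Λ, Module.Finite Λ Z →
      HasProjectiveDimensionLT ((homF M).obj Z) (r + 1)) : GldimLE (End (op M)) (r + 2) := by
  have hs := isSeparator_of_inAdd hM
  have := full_homF M hs
  apply gldimLE_of_cyclic
  intro I
  obtain ⟨s, p, hp⟩ := exists_surjective_of_finite (X := ModuleCat.of (End (op M)) I)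
  let Q : ModuleCat.{u} Λ := ⨁ fun _ : Fin s => M
  let e : (homF M).obj Q ≅ ⨁ fun _ : Fin s => ModuleCat.of (End (op M)) (End (op M)) :=
    (homF M).mapBiproduct (fun _ : Fin s => M) ≪≫ biproduct.mapIso fun _ => homFSelf M
  let ι : ModuleCat.of (End (op M)) I ⟶ ModuleCat.of (End (op M)) (End (op M)) :=
    ModuleCat.ofHom I.subtype
  let f : Q ⟶ M := (homF M).preimage (e.hom ≫ p ≫ ι ≫ (homFSelf M).inv)
  have hf : (homF M).map f = (e.hom ≫ p) ≫ (ι ≫ (homFSelf M).inv) := by simp [f]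
  have hι : Mono ι := (ModuleCat.mono_iff_injective _).2 I.injective_subtype
  have hK : HasProjectiveDimensionLT (kernel (e.hom ≫ p)) (r + 1) := by
    have h1 := h (kernel f) (Module.Finite.of_injective (kernel.ι f).hom
      ((ModuleCat.mono_iff_injective _).1 inferInstance))
    refine hasProjectiveDimensionLT_of_iso
      (PreservesKernel.iso (homF M) f ≪≫ kernelIsoOfEq hf ≪≫ kernelCompMono _ _) (r + 1)
  have hQ : Projective ((homF M).obj Q) := projective_homF (InAdd.biproduct fun _ => InAdd.self M)
  have hI : HasProjectiveDimensionLT (ModuleCat.of (End (op M)) I) (r + 2) :=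
    (shortExact_kernel (e.hom ≫ p)).hasProjectiveDimensionLT_X₃ (r + 1) hK
      (hasProjectiveDimensionLT_of_ge _ 1 _ (by lia))
  let S : ShortComplex (ModuleCat.{u} (End (op M))) :=
    ShortComplex.mk ι (ModuleCat.ofHom I.mkQ) (by
      ext x
      simp [ι])
  have hS : S.ShortExact := by
    refine ModuleCat.shortComplex_shortExact S ?_ ?_ ?_
    · exact (LinearMap.exact_subtype_mkQ I)
    · exact I.injective_subtype
    · exact I.mkQ_surjective
  have : Projective (ModuleCat.of (End (op M)) (End (op M))) :=
    Projective.of_iso (homFSelf M) inferInstance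
  exact hS.hasProjectiveDimensionLT_X₃ (r + 2) hI (hasProjectiveDimensionLT_of_ge _ 1 _ (by lia))

end GldimEnd

section Length
variable (Λ : Type u) [Ring Λ]

/-- The composition length of a module, as a natural number. -/
noncomputable def len (X : Type u) [AddCommGroup X] [Module Λ X] : ℕ :=
  (Module.length Λ X).toNat

/-- A uniserial module: its submodules form a chain. -/
def Uni (X : Type u) [AddCommGroup X] [Module Λ X] : Prop :=
  ∀ N₁ N₂ : Submodule Λ X, N₁ ≤ N₂ ∨ N₂ ≤ N₁

variable {Λ} {X Y : Type u} [AddCommGroup X] [Module Λ X] [AddCommGroup Y] [Module Λ Y]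

lemma len_congr (e : X ≃ₗ[Λ] Y) : len Λ X = len Λ Y := by
  rw [len, len, e.length_eq]

lemma Uni.of_injective (h : Uni Λ Y) (f : X →ₗ[Λ] Y) (hf : Function.Injective f) : Uni Λ X := by
  intro N₁ N₂
  have := h (N₁.map f) (N₂.map f)
  rwa [Submodule.map_le_map_iff_of_injective hf, Submodule.map_le_map_iff_of_injective hf] at this

lemma Uni.of_surjective (h : Uni Λ X) (f : X →ₗ[Λ] Y) (hf : Function.Surjective f) : Uni Λ Y := by
  intro N₁ N₂
  have := h (N₁.comap f) (N₂.comap f)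
  rwa [Submodule.comap_le_comap_iff_of_surjective hf,
    Submodule.comap_le_comap_iff_of_surjective hf] at this

variable [IsArtinianRing Λ] [Module.Finite Λ X] [Module.Finite Λ Y]

lemma coe_len : (len Λ X : ℕ∞) = Module.length Λ X :=
  ENat.natCast_toNat Module.length_ne_top

lemma len_eq_of_exact {Z : Type u} [AddCommGroup Z] [Module Λ Z] [Module.Finite Λ Z]
    (f : X →ₗ[Λ] Y) (g : Y →ₗ[Λ] Z) (hf : Function.Injective f) (hg : Function.Surjective g)
    (h : Function.Exact f g) : len Λ Y = len Λ X + len Λ Z := by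
  have := Module.length_eq_add_of_exact f g hf hg h
  rw [← coe_len, ← coe_len, ← coe_len] at this
  exact_mod_cast this

lemma len_quotient (N : Submodule Λ X) : len Λ X = len Λ N + len Λ (X ⧸ N) :=
  len_eq_of_exact N.subtype N.mkQ N.injective_subtype N.mkQ_surjective
    (LinearMap.exact_subtype_mkQ N)

lemma len_eq_ker_add_range (f : X →ₗ[Λ] Y) :
    len Λ X = len Λ (LinearMap.ker f) + len Λ (LinearMap.range f) := by
  rw [len_quotient (LinearMap.ker f), len_congr f.quotKerEquivRange]

lemma len_eq_zero_iff : len Λ X = 0 ↔ Subsingleton X := by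
  rw [← Module.length_eq_zero_iff (R := Λ), ← coe_len]
  simp

lemma len_submodule_eq_zero_iff {N : Submodule Λ X} : len Λ N = 0 ↔ N = ⊥ := by
  rw [len_eq_zero_iff, Submodule.subsingleton_iff_eq_bot]

lemma len_pos [Nontrivial X] : 0 < len Λ X := by
  rw [Nat.pos_iff_ne_zero, Ne, len_eq_zero_iff, not_subsingleton_iff_nontrivial]
  infer_instance

lemma len_le_of_injective (f : X →ₗ[Λ] Y) (hf : Function.Injective f) : len Λ X ≤ len Λ Y := by
  have := Module.length_le_of_injective f hf
  rw [← coe_len, ← coe_len] at this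
  exact_mod_cast this

lemma len_le_of_surjective (f : X →ₗ[Λ] Y) (hf : Function.Surjective f) :
    len Λ Y ≤ len Λ X := by
  have := Module.length_le_of_surjective f hf
  rw [← coe_len, ← coe_len] at this
  exact_mod_cast this

lemma len_mono {N₁ N₂ : Submodule Λ X} (h : N₁ ≤ N₂) : len Λ N₁ ≤ len Λ N₂ :=
  len_le_of_injective (Submodule.inclusion h) (Submodule.inclusion_injective h)

lemma len_submodule_le (N : Submodule Λ X) : len Λ N ≤ len Λ X :=
  len_le_of_injective N.subtype N.injective_subtype

lemma len_lt_of_lt {N₁ N₂ : Submodule Λ X} (h : N₁ < N₂) : len Λ N₁ < len Λ N₂ := by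
  have := Submodule.height_strictMono (R := Λ) (M := X) h
  rw [← Module.length_submodule, ← Module.length_submodule, ← coe_len, ← coe_len] at this
  exact_mod_cast this

lemma eq_of_le_of_len_le {N₁ N₂ : Submodule Λ X} (h : N₁ ≤ N₂) (h' : len Λ N₂ ≤ len Λ N₁) :
    N₁ = N₂ := by
  by_contra hne
  exact absurd (len_lt_of_lt (lt_of_le_of_ne h hne)) (not_lt.2 h')

lemma len_top : len Λ (⊤ : Submodule Λ X) = len Λ X := len_congr Submodule.topEquiv

lemma len_submodule_lt {N : Submodule Λ X} (h : N ≠ ⊤) : len Λ N < len Λ X := by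
  rw [← len_top (X := X)]
  exact len_lt_of_lt (lt_top_iff_ne_top.2 h)

lemma eq_top_of_len {N : Submodule Λ X} (h : len Λ X ≤ len Λ N) : N = ⊤ :=
  eq_of_le_of_len_le le_top (by rwa [len_top])

lemma len_prod : len Λ (X × Y) = len Λ X + len Λ Y :=
  len_eq_of_exact (LinearMap.inl Λ X Y) (LinearMap.snd Λ X Y) LinearMap.inl_injective
    LinearMap.snd_surjective Function.Exact.inl_snd

lemma len_comap (f : X →ₗ[Λ] Y) {N : Submodule Λ Y} (h : N ≤ LinearMap.range f) :
    len Λ (N.comap f) = len Λ (LinearMap.ker f) + len Λ N := by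
  have h₁ : LinearMap.ker f ≤ N.comap f := fun x hx => by
    rw [Submodule.mem_comap, LinearMap.mem_ker.1 hx]
    exact N.zero_mem
  let g : N.comap f →ₗ[Λ] N := f.restrict fun x hx => hx
  refine len_eq_of_exact (Submodule.inclusion h₁) g (Submodule.inclusion_injective h₁) ?_ ?_
  · rintro ⟨y, hy⟩
    obtain ⟨x, rfl⟩ := h hy
    exact ⟨⟨x, hy⟩, rfl⟩
  · rintro ⟨x, hx⟩
    refine ⟨fun hxx => ⟨⟨x, ?_⟩, rfl⟩, ?_⟩
    · simpa [g, LinearMap.restrict_apply] using congrArg Subtype.val hxx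
    · rintro ⟨⟨y, hy⟩, hyy⟩
      obtain rfl : y = x := congrArg Subtype.val hyy
      ext
      simpa [g, LinearMap.restrict_apply] using hy

lemma len_map (f : X →ₗ[Λ] Y) {N : Submodule Λ X} (h : LinearMap.ker f ≤ N) :
    len Λ N = len Λ (LinearMap.ker f) + len Λ (N.map f) := by
  rw [← len_comap f (LinearMap.map_le_range), Submodule.comap_map_eq, sup_eq_left.2 h]

lemma Uni.le_iff (h : Uni Λ X) {N₁ N₂ : Submodule Λ X} : N₁ ≤ N₂ ↔ len Λ N₁ ≤ len Λ N₂ := by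
  refine ⟨len_mono, fun hl => ?_⟩
  rcases h N₁ N₂ with h | h
  · exact h
  · exact (eq_of_le_of_len_le h hl).ge

lemma Uni.eq_of_len (h : Uni Λ X) {N₁ N₂ : Submodule Λ X} (hl : len Λ N₁ = len Λ N₂) :
    N₁ = N₂ :=
  le_antisymm (h.le_iff.2 hl.le) (h.le_iff.2 hl.ge)

lemma len_eq_one_iff : len Λ X = 1 ↔ IsSimpleModule Λ X := by
  rw [← Module.length_eq_one_iff, ← coe_len]
  exact_mod_cast Iff.rfl

lemma bijective_of_injective_of_len (f : X →ₗ[Λ] Y) (hf : Function.Injective f)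
    (h : len Λ Y ≤ len Λ X) : Function.Bijective f := by
  refine ⟨hf, LinearMap.range_eq_top.1 (eq_top_of_len ?_)⟩
  have := len_eq_ker_add_range f
  rw [LinearMap.ker_eq_bot.2 hf, len_submodule_eq_zero_iff.2 rfl] at this
  omega

lemma bijective_of_surjective_of_len (f : X →ₗ[Λ] Y) (hf : Function.Surjective f)
    (h : len Λ X ≤ len Λ Y) : Function.Bijective f := by
  refine ⟨LinearMap.ker_eq_bot.1 (len_submodule_eq_zero_iff.1 ?_), hf⟩
  have := len_eq_ker_add_range f
  rw [LinearMap.range_eq_top.2 hf, len_top] at this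
  omega

variable (Λ X) in
lemma exists_submodule_len (t : ℕ) (ht : t ≤ len Λ X) : ∃ N : Submodule Λ X, len Λ N = t := by
  obtain ⟨d, hd⟩ := Nat.exists_eq_add_of_le ht
  induction d generalizing t with
  | zero => exact ⟨⊤, by rw [len_top]; omega⟩
  | succ d ih =>
    obtain ⟨N, hN⟩ := ih (t + 1) (by omega) (by omega)
    have hN0 : Nontrivial N := by
      rw [← not_subsingleton_iff_nontrivial, ← len_eq_zero_iff (Λ := Λ)]; omega
    obtain ⟨K, hK, -⟩ := (eq_top_or_exists_le_coatom (⊥ : Submodule Λ N)).resolve_left bot_ne_top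
    have : IsSimpleModule Λ (N ⧸ K) := isSimpleModule_iff_isCoatom.2 hK
    have h₁ := len_quotient K
    rw [len_eq_one_iff.2 this] at h₁
    refine ⟨K.map N.subtype, ?_⟩
    rw [← len_congr (K.equivMapOfInjective N.subtype N.injective_subtype)]
    omega

/-- A coatom of a nonzero finitely generated uniserial module contains each proper submodule. -/
lemma Uni.exists_max (h : Uni Λ X) [Nontrivial X] :
    ∃ K : Submodule Λ X, IsSimpleModule Λ (X ⧸ K) ∧ ∀ N : Submodule Λ X, N ≠ ⊤ → N ≤ K := by
  obtain ⟨K, hK⟩ := exists_submodule_len Λ X (len Λ X - 1) (by omega)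
  have hp := len_pos (Λ := Λ) (X := X)
  refine ⟨K, len_eq_one_iff.1 ?_, fun N hN => h.le_iff.2 ?_⟩
  · have := len_quotient K
    omega
  · have := len_submodule_lt hN
    omega

end Length

section Uniserial
variable {Λ : Type u} [Ring Λ]

lemma nontrivial_of_not_isZero {X : ModuleCat.{u} Λ} (h : ¬ IsZero X) : Nontrivial X := by
  rw [← not_subsingleton_iff_nontrivial]
  exact fun h' => h (ModuleCat.isZero_of_subsingleton X)

lemma not_isZero_of_nontrivial (X : ModuleCat.{u} Λ) [Nontrivial X] : ¬ IsZero X := by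
  intro h
  have := ModuleCat.subsingleton_of_isZero h
  exact not_subsingleton X this

lemma len_iso {X Y : ModuleCat.{u} Λ} (e : X ≅ Y) : len Λ X = len Λ Y :=
  len_congr e.toLinearEquiv

lemma Uni.of_epi {X Y : ModuleCat.{u} Λ} (h : Uni Λ X) (f : X ⟶ Y) [Epi f] : Uni Λ Y :=
  h.of_surjective f.hom ((ModuleCat.epi_iff_surjective f).1 inferInstance)

lemma finite_of_epi {X Y : ModuleCat.{u} Λ} [Module.Finite Λ X] (f : X ⟶ Y) [Epi f] :
    Module.Finite Λ Y :=
  Module.Finite.of_surjective f.hom ((ModuleCat.epi_iff_surjective f).1 inferInstance)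

lemma finite_of_iso {X Y : ModuleCat.{u} Λ} [Module.Finite Λ X] (e : X ≅ Y) :
    Module.Finite Λ Y := finite_of_epi e.hom

variable [IsArtinianRing Λ]

lemma finite_of_mono {X Y : ModuleCat.{u} Λ} [Module.Finite Λ Y] (f : X ⟶ Y) [Mono f] :
    Module.Finite Λ X :=
  Module.Finite.of_injective f.hom ((ModuleCat.mono_iff_injective f).1 inferInstance)

lemma isIso_of_epi_of_len {X Y : ModuleCat.{u} Λ} [Module.Finite Λ X] [Module.Finite Λ Y]
    (f : X ⟶ Y) [Epi f] (h : len Λ X ≤ len Λ Y) : IsIso f :=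
  (ConcreteCategory.isIso_iff_bijective f).2
    (bijective_of_surjective_of_len f.hom ((ModuleCat.epi_iff_surjective f).1 inferInstance) h)

lemma len_le_of_epi {X Y : ModuleCat.{u} Λ} [Module.Finite Λ X] [Module.Finite Λ Y]
    (f : X ⟶ Y) [Epi f] : len Λ Y ≤ len Λ X :=
  len_le_of_surjective f.hom ((ModuleCat.epi_iff_surjective f).1 inferInstance)

lemma len_biprod {A B : ModuleCat.{u} Λ} [Module.Finite Λ A] [Module.Finite Λ B] :
    len Λ (A ⊞ B : ModuleCat.{u} Λ) = len Λ A + len Λ B := by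
  rw [len_iso (ModuleCat.biprodIsoProd A B)]
  exact len_prod

lemma isZero_iff_len {X : ModuleCat.{u} Λ} [Module.Finite Λ X] : IsZero X ↔ len Λ X = 0 := by
  rw [len_eq_zero_iff]
  exact ⟨ModuleCat.subsingleton_of_isZero, fun _ => ModuleCat.isZero_of_subsingleton X⟩

/-- Induction along the decomposition of a finitely generated module into uniserial modules. -/
lemma fg_induction
    (hU : ∀ X : ModuleCat.{u} Λ, Module.Finite Λ X → Indec Λ X → Uni Λ X)
    {P : ModuleCat.{u} Λ → Prop} (iso : ∀ X Y : ModuleCat.{u} Λ, (X ≅ Y) → P X → P Y)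
    (zero : ∀ X : ModuleCat.{u} Λ, IsZero X → P X)
    (biprod : ∀ A B : ModuleCat.{u} Λ, Module.Finite Λ A → Module.Finite Λ B →
      P A → P B → P (A ⊞ B))
    (uni : ∀ X : ModuleCat.{u} Λ, Module.Finite Λ X → Nontrivial X → Uni Λ X → P X)
    (X : ModuleCat.{u} Λ) (hX : Module.Finite Λ X) : P X := by
  induction h : len Λ X using Nat.strong_induction_on generalizing X with
  | _ l ih =>
    by_cases h0 : IsZero X
    · exact zero X h0
    by_cases hi : Indec Λ X
    · exact uni X hX (nontrivial_of_not_isZero h0) (hU X hX hi)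
    · have : ∃ A B : ModuleCat.{u} Λ, Nonempty (X ≅ A ⊞ B) ∧ ¬ IsZero A ∧ ¬ IsZero B := by
        by_contra! hcon
        exact hi ⟨h0, fun A B e => by
          by_cases hA : IsZero A
          · exact Or.inl hA
          · exact Or.inr (hcon A B e hA)⟩
      obtain ⟨A, B, ⟨e⟩, hA, hB⟩ := this
      have : Module.Finite Λ (A ⊞ B : ModuleCat.{u} Λ) := finite_of_iso e
      have : Module.Finite Λ A := finite_of_mono (Limits.biprod.inl : A ⟶ A ⊞ B)
      have : Module.Finite Λ B := finite_of_mono (Limits.biprod.inr : B ⟶ A ⊞ B)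
      have hl := len_biprod (A := A) (B := B)
      rw [← len_iso e] at hl
      rw [isZero_iff_len] at hA hB
      exact iso _ _ e.symm (biprod A B inferInstance inferInstance
        (ih _ (by omega) A inferInstance rfl) (ih _ (by omega) B inferInstance rfl))

lemma Uni.factor {P U V W : ModuleCat.{u} Λ} [Module.Finite Λ P] [Module.Finite Λ U]
    [Module.Finite Λ V] (hP : Uni Λ P) [Projective P] (hV : Uni Λ V) (π : P ⟶ U) [Epi π]
    (f : U ⟶ W) (g : V ⟶ W) (hf : f ≠ 0) (hr : LinearMap.range f.hom ≤ LinearMap.range g.hom)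
    (hl : len Λ ((LinearMap.range f.hom).comap g.hom) ≤ len Λ U) : ∃ h : U ⟶ V, h ≫ g = f := by
  have hπ : Function.Surjective π.hom := (ModuleCat.epi_iff_surjective π).1 inferInstance
  have : Module.Projective Λ P := (IsProjective.iff_projective P).2 inferInstance
  obtain ⟨h, hh⟩ := Module.projective_lifting_property g.hom.rangeRestrict
    ((f.hom.codRestrict _ fun x => hr ⟨x, rfl⟩) ∘ₗ π.hom) g.hom.surjective_rangeRestrict
  have hgh (x : P) : g.hom (h x) = f.hom (π.hom x) :=
    congrArg Subtype.val (LinearMap.congr_fun hh x)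
  have hnot : ¬ LinearMap.range h ≤ LinearMap.ker g.hom := by
    intro hle
    refine hf ?_
    ext x
    obtain ⟨p, rfl⟩ := hπ x
    have := hle ⟨p, rfl⟩
    rw [LinearMap.mem_ker, hgh] at this
    simpa using this
  have hker := (hV (LinearMap.range h) (LinearMap.ker g.hom)).resolve_left hnot
  have hrange : (LinearMap.range f.hom).comap g.hom ≤ LinearMap.range h := by
    rintro x ⟨y, hy⟩
    obtain ⟨p, rfl⟩ := hπ y
    have : x - h p ∈ LinearMap.ker g.hom := by
      rw [LinearMap.mem_ker, map_sub, hgh, hy, sub_self]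
    simpa using add_mem (hker this) ⟨p, rfl⟩
  have hkk : LinearMap.ker π.hom ≤ LinearMap.ker h := by
    rw [hP.le_iff]
    have h₁ := len_eq_ker_add_range h
    have h₂ := len_eq_ker_add_range π.hom
    rw [LinearMap.range_eq_top.2 hπ, len_top] at h₂
    have h₃ : len Λ (LinearMap.range h) ≤ len Λ ((LinearMap.range f.hom).comap g.hom) := by
      refine len_mono ?_
      rintro _ ⟨p, rfl⟩
      exact ⟨π.hom p, (hgh p).symm⟩
    omega
  let e := π.hom.quotKerEquivOfSurjective hπ
  refine ⟨ModuleCat.ofHom (((LinearMap.ker π.hom).liftQ h hkk) ∘ₗ e.symm.toLinearMap), ?_⟩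
  ext x
  obtain ⟨p, rfl⟩ := hπ x
  have : e.symm (π.hom p) = Submodule.Quotient.mk p := by
    rw [LinearEquiv.symm_apply_eq]
    rfl
  simp [this, hgh]

lemma Uni.exists_injective_of_sum {U : Type u} [AddCommGroup U] [Module Λ U] [Nontrivial U]
    (hU : Uni Λ U) {ι : Type*} [Fintype ι] (e : ι → U →ₗ[Λ] U)
    (he : ∑ j, e j = LinearMap.id) : ∃ j, Function.Injective (e j) := by
  by_contra! hcon
  have key (s : Finset ι) : ∃ x : U, x ≠ 0 ∧ ∀ j ∈ s, e j x = 0 := by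
    classical
    induction s using Finset.induction_on with
    | empty => simpa using exists_ne (0 : U)
    | insert a s ha ih =>
      obtain ⟨x, hx, hx'⟩ := ih
      rcases hU (LinearMap.ker (e a)) (Submodule.span Λ {x}) with h | h
      · have h0 : LinearMap.ker (e a) ≠ ⊥ := fun h => hcon a (LinearMap.ker_eq_bot.1 h)
        obtain ⟨y, hy, hy0⟩ := (Submodule.ne_bot_iff _).1 h0
        refine ⟨y, hy0, fun j hj => ?_⟩
        rcases Finset.mem_insert.1 hj with rfl | hj
        · exact hy
        · obtain ⟨c, rfl⟩ := Submodule.mem_span_singleton.1 (h hy)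
          rw [map_smul, hx' j hj, smul_zero]
      · refine ⟨x, hx, fun j hj => ?_⟩
        rcases Finset.mem_insert.1 hj with rfl | hj
        · exact h (Submodule.mem_span_singleton_self x)
        · exact hx' j hj
  obtain ⟨x, hx, hx'⟩ := key Finset.univ
  refine hx ?_
  have := LinearMap.congr_fun he x
  rw [LinearMap.sum_apply, Finset.sum_eq_zero fun j hj => hx' j hj] at this
  exact this.symm

/-- A retract up to an automorphism. -/
noncomputable def retractOfIsIso {C : Type*} [Category C] {X Y : C} (i : X ⟶ Y) (r : Y ⟶ X) [IsIso (i ≫ r)] :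
    Retract X Y where
  i := i
  r := r ≫ inv (i ≫ r)
  retract := by rw [← Category.assoc]; simp

lemma Uni.retract_biproduct {U : ModuleCat.{u} Λ} [Module.Finite Λ U] [Nontrivial U]
    (hU : Uni Λ U) {ι : Type} [Fintype ι] {f : ι → ModuleCat.{u} Λ}
    (r : Retract U (⨁ f)) : ∃ j, Nonempty (Retract U (f j)) := by
  obtain ⟨j, hj⟩ := hU.exists_injective_of_sum
    (fun j => ((r.i ≫ biproduct.π f j) ≫ (biproduct.ι f j ≫ r.r)).hom) (by
      have : ∑ j, (r.i ≫ biproduct.π f j) ≫ (biproduct.ι f j ≫ r.r) = 𝟙 U := by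
        have h := congrArg (fun t => r.i ≫ t ≫ r.r) (biproduct.total (f := f))
        simp only [Category.id_comp, Preadditive.sum_comp, Preadditive.comp_sum, r.retract] at h
        simpa using h
      ext x
      have := congrArg (fun t => t.hom x) this
      simpa [ModuleCat.hom_sum] using this)
  have : IsIso ((r.i ≫ biproduct.π f j) ≫ (biproduct.ι f j ≫ r.r)) :=
    (ConcreteCategory.isIso_iff_bijective _).2 (bijective_of_injective_of_len _ hj le_rfl)
  exact ⟨j, ⟨retractOfIsIso (r.i ≫ biproduct.π f j) (biproduct.ι f j ≫ r.r)⟩⟩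

lemma Uni.retract_biprod {U A B : ModuleCat.{u} Λ} [Module.Finite Λ U] [Nontrivial U]
    (hU : Uni Λ U) (r : Retract U (A ⊞ B)) :
    Nonempty (Retract U A) ∨ Nonempty (Retract U B) := by
  let g : Bool → (U ⟶ U) := fun j => cond j ((r.i ≫ biprod.fst) ≫ (biprod.inl ≫ r.r))
      ((r.i ≫ biprod.snd) ≫ (biprod.inr ≫ r.r))
  have hg : g true + g false = 𝟙 U := by
    have h := congrArg (fun t => r.i ≫ t ≫ r.r) (biprod.total (X := A) (Y := B))
    simp only [Category.id_comp, Preadditive.add_comp, Preadditive.comp_add, r.retract] at h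
    simpa [g] using h
  obtain ⟨j, hj⟩ := hU.exists_injective_of_sum (fun j => (g j).hom) (by
      ext x
      have := congrArg (fun t => t.hom x) hg
      simpa using this)
  have : IsIso (g j) :=
    (ConcreteCategory.isIso_iff_bijective _).2 (bijective_of_injective_of_len _ hj le_rfl)
  cases j
  · have : IsIso ((r.i ≫ biprod.snd) ≫ (biprod.inr ≫ r.r)) := this
    exact Or.inr ⟨retractOfIsIso (r.i ≫ biprod.snd) (biprod.inr ≫ r.r)⟩
  · have : IsIso ((r.i ≫ biprod.fst) ≫ (biprod.inl ≫ r.r)) := this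
    exact Or.inl ⟨retractOfIsIso (r.i ≫ biprod.fst) (biprod.inl ≫ r.r)⟩

lemma Uni.iso_of_retract {U V : ModuleCat.{u} Λ} [Nontrivial U] (hV : Uni Λ V)
    (r : Retract U V) : Nonempty (U ≅ V) := by
  have hi : Function.LeftInverse r.r.hom r.i.hom := fun x =>
    congrArg (fun t => t.hom x) r.retract
  have h0 : LinearMap.ker r.r.hom = ⊥ := by
    rcases hV (LinearMap.range r.i.hom) (LinearMap.ker r.r.hom) with h | h
    · obtain ⟨x, hx⟩ := exists_ne (0 : U)
      refine absurd ?_ hx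
      rw [← hi x]
      exact h ⟨x, rfl⟩
    · rw [eq_bot_iff]
      intro x hx
      obtain ⟨y, rfl⟩ := h hx
      rw [LinearMap.mem_ker, hi] at hx
      simp [hx]
  have : IsIso r.r := (ConcreteCategory.isIso_iff_bijective _).2
    ⟨LinearMap.ker_eq_bot.1 h0, hi.surjective⟩
  exact ⟨(asIso r.r).symm⟩

end Uniserial

/-- Representatives of the simple modules of a self-injective Nakayama algebra, together with
their projective covers. -/
structure SimpleCovers (Λ : Type u) [Ring Λ] (n : ℕ) where
  uni : ∀ X : ModuleCat.{u} Λ, Module.Finite Λ X → Indec Λ X → Uni Λ X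
  S : Fin n → ModuleCat.{u} Λ
  simple : ∀ i, IsSimpleModule Λ (S i)
  S_inj : ∀ i j, Nonempty (S i ≅ S j) → i = j
  S_complete : ∀ T : ModuleCat.{u} Λ, IsSimpleModule Λ T → ∃ i, Nonempty (T ≅ S i)
  P : Fin n → ModuleCat.{u} Λ
  P_finite : ∀ i, Module.Finite Λ (P i)
  P_uni : ∀ i, Uni Λ (P i)
  P_retract : ∀ i, Nonempty (Retract (P i) (ModuleCat.of Λ Λ))
  P_proj : ∀ i, Projective (P i)
  P_inj : ∀ i, Injective (P i)
  π : ∀ i, P i ⟶ S i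
  π_ne : ∀ i, π i ≠ 0

section
variable {Λ : Type u} [Ring Λ]

lemma epi_of_simple {X T : ModuleCat.{u} Λ} [IsSimpleModule Λ T] (f : X ⟶ T) (h : f ≠ 0) :
    Epi f := by
  rw [ModuleCat.epi_iff_surjective]
  exact LinearMap.surjective_of_ne_zero (f := f.hom) fun h' => h (ModuleCat.hom_ext h')

lemma mono_of_simple {X T : ModuleCat.{u} Λ} [IsSimpleModule Λ T] (f : T ⟶ X) (h : f ≠ 0) :
    Mono f := by
  rw [ModuleCat.mono_iff_injective]
  exact LinearMap.injective_of_ne_zero (f := f.hom) fun h' => h (ModuleCat.hom_ext h')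

lemma ne_zero_of_epi {X Y : ModuleCat.{u} Λ} [Nontrivial Y] (f : X ⟶ Y) [Epi f] : f ≠ 0 := by
  rintro rfl
  exact not_isZero_of_nontrivial Y (IsZero.of_epi_zero X Y)

lemma ne_zero_of_mono {X Y : ModuleCat.{u} Λ} [Nontrivial X] (f : X ⟶ Y) [Mono f] : f ≠ 0 := by
  rintro rfl
  exact not_isZero_of_nontrivial X (IsZero.of_mono_zero X Y)

end

namespace SimpleCovers
variable {Λ : Type u} [Ring Λ] {n : ℕ} (D : SimpleCovers Λ n)

attribute [instance] simple P_finite P_proj P_inj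

instance (i : Fin n) : Nontrivial (D.S i) := IsSimpleModule.nontrivial Λ _

instance π_epi (i : Fin n) : Epi (D.π i) := epi_of_simple _ (D.π_ne i)

instance (i : Fin n) : Nontrivial (D.P i) := by
  refine nontrivial_of_not_isZero fun h => D.π_ne i (h.eq_of_src _ _)

instance (i : Fin n) : Module.Finite Λ (D.S i) := finite_of_epi (D.π i)

/-- `S i` is a quotient of `X`. -/
def Top (X : ModuleCat.{u} Λ) (i : Fin n) : Prop := ∃ f : X ⟶ D.S i, f ≠ 0

/-- `S i` is a submodule of `X`. -/
def Soc (X : ModuleCat.{u} Λ) (i : Fin n) : Prop := ∃ f : D.S i ⟶ X, f ≠ 0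

variable {D}

lemma top_P (i : Fin n) : D.Top (D.P i) i := ⟨D.π i, D.π_ne i⟩

lemma Top.of_epi {X Y : ModuleCat.{u} Λ} {i : Fin n} (h : D.Top Y i) (p : X ⟶ Y) [Epi p] :
    D.Top X i := by
  obtain ⟨f, hf⟩ := h
  exact ⟨p ≫ f, fun h => hf (by rwa [← cancel_epi p, comp_zero])⟩

variable [IsArtinianRing Λ] {X Y : ModuleCat.{u} Λ} [Module.Finite Λ X] [Module.Finite Λ Y]

lemma len_S (i : Fin n) : len Λ (D.S i) = 1 := len_eq_one_iff.2 inferInstance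

variable (D) in
lemma exists_top (hX : Uni Λ X) [Nontrivial X] : ∃ i, D.Top X i := by
  obtain ⟨K, hK, -⟩ := hX.exists_max
  obtain ⟨i, ⟨e⟩⟩ := D.S_complete (ModuleCat.of Λ (X ⧸ K)) hK
  have : Epi (ModuleCat.ofHom K.mkQ) := by
    rw [ModuleCat.epi_iff_surjective]; exact K.mkQ_surjective
  exact ⟨i, _, ne_zero_of_epi (ModuleCat.ofHom K.mkQ ≫ e.hom)⟩

lemma len_ker_of_top {i : Fin n} (f : X ⟶ D.S i) (hf : f ≠ 0) :
    len Λ (LinearMap.ker f.hom) + 1 = len Λ X := by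
  have := epi_of_simple f hf
  have h := len_eq_ker_add_range f.hom
  rw [LinearMap.range_eq_top.2 ((ModuleCat.epi_iff_surjective f).1 this), len_top, len_S] at h
  exact h.symm

lemma Top.unique (hX : Uni Λ X) {i j : Fin n} (hi : D.Top X i) (hj : D.Top X j) : i = j := by
  obtain ⟨f, hf⟩ := hi
  obtain ⟨g, hg⟩ := hj
  have hk : LinearMap.ker f.hom = LinearMap.ker g.hom := hX.eq_of_len (by
    have := len_ker_of_top f hf
    have := len_ker_of_top g hg
    omega)
  have := epi_of_simple f hf
  have := epi_of_simple g hg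
  let e := (f.hom.quotKerEquivOfSurjective
    ((ModuleCat.epi_iff_surjective f).1 inferInstance)).symm.trans
    ((Submodule.quotEquivOfEq _ _ hk).trans (g.hom.quotKerEquivOfSurjective
    ((ModuleCat.epi_iff_surjective g).1 inferInstance)))
  exact D.S_inj i j ⟨e.toModuleIso⟩

lemma Top.of_epi' (hX : Uni Λ X) {i : Fin n} (h : D.Top X i) (p : X ⟶ Y) [Epi p] [Nontrivial Y] :
    D.Top Y i := by
  obtain ⟨j, hj⟩ := D.exists_top (hX.of_epi p)
  rwa [h.unique hX (hj.of_epi p)]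

lemma Top.exists_epi (hX : Uni Λ X) {i : Fin n} (h : D.Top X i) : ∃ p : D.P i ⟶ X, Epi p := by
  obtain ⟨f, hf⟩ := h
  have := epi_of_simple f hf
  refine ⟨Projective.factorThru (D.π i) f, ?_⟩
  set p := Projective.factorThru (D.π i) f
  have hp : p ≫ f = D.π i := Projective.factorThru_comp _ _
  rw [ModuleCat.epi_iff_surjective]
  change Function.Surjective p.hom
  rw [← LinearMap.range_eq_top]
  by_contra hne
  have h₁ := len_ker_of_top f hf
  have h₂ := len_submodule_lt hne
  have h₃ : LinearMap.range p.hom ≤ LinearMap.ker f.hom := hX.le_iff.2 (by omega)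
  refine D.π_ne i ?_
  rw [← hp]
  ext x
  exact h₃ ⟨x, rfl⟩

lemma Top.iso (hX : Uni Λ X) (hY : Uni Λ Y) {i : Fin n} (h : D.Top X i) (h' : D.Top Y i)
    (hl : len Λ X = len Λ Y) : Nonempty (X ≅ Y) := by
  obtain ⟨p, hp⟩ := h.exists_epi hX
  obtain ⟨q, hq⟩ := h'.exists_epi hY
  rw [ModuleCat.epi_iff_surjective] at hp hq
  have hk : LinearMap.ker p.hom = LinearMap.ker q.hom := (D.P_uni i).eq_of_len (by
    have h₁ := len_eq_ker_add_range p.hom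
    have h₂ := len_eq_ker_add_range q.hom
    rw [LinearMap.range_eq_top.2 hp, len_top] at h₁
    rw [LinearMap.range_eq_top.2 hq, len_top] at h₂
    omega)
  exact ⟨((p.hom.quotKerEquivOfSurjective hp).symm.trans
    ((Submodule.quotEquivOfEq _ _ hk).trans (q.hom.quotKerEquivOfSurjective hq))).toModuleIso⟩

lemma nontrivial_of_len_pos (h : 0 < len Λ X) : Nontrivial X := by
  rw [← not_subsingleton_iff_nontrivial, ← len_eq_zero_iff (Λ := Λ)]; omega

variable (D) in
lemma exists_soc [Nontrivial X] : ∃ i, D.Soc X i := by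
  obtain ⟨N, hN⟩ := exists_submodule_len Λ X 1 (len_pos (Λ := Λ) (X := X))
  have := len_eq_one_iff.1 hN
  obtain ⟨i, ⟨e⟩⟩ := D.S_complete (ModuleCat.of Λ N) this
  have : Mono (ModuleCat.ofHom N.subtype) := by
    rw [ModuleCat.mono_iff_injective]; exact N.injective_subtype
  exact ⟨i, _, ne_zero_of_mono (e.inv ≫ ModuleCat.ofHom N.subtype)⟩

lemma mono_of_soc (hX : Uni Λ X) {i : Fin n} (f : D.S i ⟶ X) (g : X ⟶ Y) (h : f ≫ g ≠ 0) :
    Mono g := by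
  have hf : Mono f := mono_of_simple f fun h0 => h (by rw [h0, zero_comp])
  rw [ModuleCat.mono_iff_injective] at hf ⊢
  change Function.Injective g.hom
  rw [← LinearMap.ker_eq_bot]
  have hl : len Λ (LinearMap.range f.hom) = 1 := by
    rw [← len_congr (LinearEquiv.ofInjective f.hom hf), len_S]
  have hnot : ¬ LinearMap.range f.hom ≤ LinearMap.ker g.hom := fun hle => h (by
    ext x
    exact hle ⟨x, rfl⟩)
  rw [hX.le_iff] at hnot
  rw [← len_submodule_eq_zero_iff (Λ := Λ)]
  omega

lemma Soc.exists_mono (hX : Uni Λ X) {i : Fin n} (h : D.Soc X i) (h' : D.Soc Y i)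
    [Injective Y] : ∃ g : X ⟶ Y, Mono g := by
  obtain ⟨f, hf⟩ := h
  obtain ⟨g, hg⟩ := h'
  have := mono_of_simple f hf
  have hh : f ≫ Injective.factorThru g f = g := Injective.comp_factorThru _ _
  exact ⟨Injective.factorThru g f, mono_of_soc hX f _ (by rwa [hh])⟩

lemma iso_of_mono_injective [Nontrivial X] (hY : Uni Λ Y) [Injective X] (g : X ⟶ Y) [Mono g] :
    Nonempty (X ≅ Y) :=
  hY.iso_of_retract ⟨g, Injective.factorThru (𝟙 X) g, Injective.comp_factorThru _ _⟩

variable (D)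

lemma exists_soc_P (i : Fin n) : ∃ j, D.Soc (D.P i) j := D.exists_soc

lemma exists_P_soc (j : Fin n) : ∃ i, D.Soc (D.P i) j := by
  choose τ hτ using D.exists_soc_P
  have hinj : Function.Injective τ := by
    intro i j hij
    obtain ⟨g, hg⟩ := (hτ i).exists_mono (D.P_uni i) (hij ▸ hτ j)
    obtain ⟨e⟩ := iso_of_mono_injective (D.P_uni j) g
    exact ((top_P j).of_epi e.hom).unique (D.P_uni i) (top_P i) |>.symm
  obtain ⟨i, rfl⟩ := Finite.surjective_of_injective hinj j
  exact ⟨i, hτ i⟩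

end SimpleCovers

lemma IsSelfInjNakayama.isArtinianRing {k Λ : Type u} [Field k] [Ring Λ] [Algebra k Λ] {n m : ℕ}
    (h : IsSelfInjNakayama k Λ n m) : IsArtinianRing Λ := by
  have := h.findim
  exact IsArtinianRing.of_finite k Λ

lemma IsSelfInjNakayama.nonempty_simpleCovers {k Λ : Type u} [Field k] [Ring Λ] [Algebra k Λ]
    {n m : ℕ} (h : IsSelfInjNakayama k Λ n m) : Nonempty (SimpleCovers Λ n) := by
  have := h.isArtinianRing
  obtain ⟨S, hS, hinj, hcompl⟩ := h.simples
  have key (i : Fin n) : ∃ P : ModuleCat.{u} Λ, Module.Finite Λ P ∧ Uni Λ P ∧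
      Nonempty (Retract P (ModuleCat.of Λ Λ)) ∧ ∃ f : P ⟶ S i, f ≠ 0 := by
    have main := fg_induction h.uniserial
      (P := fun X => Retract X (ModuleCat.of Λ Λ) → (∃ f : X ⟶ S i, f ≠ 0) →
        ∃ P : ModuleCat.{u} Λ, Module.Finite Λ P ∧ Uni Λ P ∧
        Nonempty (Retract P (ModuleCat.of Λ Λ)) ∧ ∃ f : P ⟶ S i, f ≠ 0)
      (fun X Y e hX r ⟨f, hf⟩ => hX ((Retract.ofIso e).trans r) ⟨e.hom ≫ f, fun h0 => hf (by
        rwa [← cancel_epi e.hom, comp_zero])⟩)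
      (fun X hX r ⟨f, hf⟩ => absurd (hX.eq_of_src _ _) hf)
      (fun A B _ _ hA hB r ⟨f, hf⟩ => by
        by_cases h1 : biprod.inl ≫ f = 0
        · refine hB (Retract.trans ⟨biprod.inr, biprod.snd, by simp⟩ r) ⟨biprod.inr ≫ f, ?_⟩
          intro h2
          exact hf (biprod.hom_ext' _ _ (by simpa using h1) (by simpa using h2))
        · exact hA (Retract.trans ⟨biprod.inl, biprod.fst, by simp⟩ r) ⟨biprod.inl ≫ f, h1⟩)
      (fun X hX _ hU r hf => ⟨X, hX, hU, ⟨r⟩, hf⟩)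
    refine main (ModuleCat.of Λ Λ) inferInstance (Retract.refl _) ?_
    have := hS i
    have : Nontrivial (S i) := IsSimpleModule.nontrivial Λ _
    obtain ⟨x, hx⟩ := exists_ne (0 : S i)
    refine ⟨ModuleCat.ofHom (LinearMap.toSpanSingleton Λ (S i) x), fun h0 => hx ?_⟩
    have := congrArg (fun t => t.hom (1 : Λ)) h0
    simpa using this
  choose P hfin huni hret hf using key
  choose f hf using hf
  have : Injective (ModuleCat.of Λ Λ) := h.selfinj
  have : Projective (ModuleCat.of Λ Λ) :=
    (IsProjective.iff_projective (R := Λ) Λ).1 inferInstance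
  exact ⟨{
    uni := h.uniserial
    S := S
    simple := hS
    S_inj := hinj
    S_complete := hcompl
    P := P
    P_finite := hfin
    P_uni := huni
    P_retract := hret
    P_proj := fun i => (hret i).some.projective
    P_inj := fun i => (hret i).some.injective
    π := f
    π_ne := hf }⟩

namespace SimpleCovers
variable {Λ : Type u} [Ring Λ] [IsArtinianRing Λ] {n : ℕ} (D : SimpleCovers Λ n)

/-- The top of the radical of `P i`, if the latter is nonzero. -/
lemma exists_next (i : Fin n) : ∃ j : Fin n,
    (len Λ (D.P i) = 1 → j = i) ∧
    ∀ N : Submodule Λ (D.P i), 0 < len Λ N → len Λ N + 1 = len Λ (D.P i) →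
      D.Top (ModuleCat.of Λ N) j := by
  by_cases h : len Λ (D.P i) = 1
  · exact ⟨i, fun _ => rfl, fun N h₁ h₂ => by omega⟩
  · have hp := len_pos (Λ := Λ) (X := D.P i)
    obtain ⟨N, hN⟩ := exists_submodule_len Λ (D.P i) (len Λ (D.P i) - 1) (by omega)
    have : Nontrivial N := nontrivial_of_len_pos (X := ModuleCat.of Λ N) (by
      change 0 < len Λ N; omega)
    obtain ⟨j, hj⟩ := D.exists_top (X := ModuleCat.of Λ N)
      ((D.P_uni i).of_injective N.subtype N.injective_subtype)
    refine ⟨j, fun h' => absurd h' h, fun N' h₁ h₂ => ?_⟩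
    obtain rfl : N' = N := (D.P_uni i).eq_of_len (by omega)
    exact hj

/-- The permutation of the simple modules given by the top of the radical. -/
noncomputable def next (i : Fin n) : Fin n := (D.exists_next i).choose

lemma next_eq (i : Fin n) (h : len Λ (D.P i) = 1) : D.next i = i :=
  (D.exists_next i).choose_spec.1 h

variable {D}

lemma uni_submodule {X : ModuleCat.{u} Λ} (h : Uni Λ X) (N : Submodule Λ X) :
    Uni Λ (ModuleCat.of Λ N) :=
  h.of_injective N.subtype N.injective_subtype

lemma uni_quotient {X : ModuleCat.{u} Λ} (h : Uni Λ X) (N : Submodule Λ X) :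
    Uni Λ (ModuleCat.of Λ (X ⧸ N)) :=
  h.of_surjective N.mkQ N.mkQ_surjective

instance mono_subtype {X : ModuleCat.{u} Λ} (N : Submodule Λ X) :
    Mono (ModuleCat.ofHom N.subtype) := by
  rw [ModuleCat.mono_iff_injective]; exact N.injective_subtype

instance epi_mkQ {X : ModuleCat.{u} Λ} (N : Submodule Λ X) :
    Epi (ModuleCat.ofHom N.mkQ) := by
  rw [ModuleCat.epi_iff_surjective]; exact N.mkQ_surjective

/-- The map from the preimage of a submodule in the image of a map. -/
lemma exists_epi_comap {X Y : ModuleCat.{u} Λ} (p : X ⟶ Y) (N : Submodule Λ Y)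
    (h : N ≤ LinearMap.range p.hom) :
    ∃ q : ModuleCat.of Λ (N.comap p.hom) ⟶ ModuleCat.of Λ N, Epi q ∧
      q ≫ ModuleCat.ofHom N.subtype = ModuleCat.ofHom (N.comap p.hom).subtype ≫ p := by
  refine ⟨ModuleCat.ofHom (p.hom.restrict fun x hx => hx), ?_, by ext; rfl⟩
  rw [ModuleCat.epi_iff_surjective]
  rintro ⟨y, hy⟩
  obtain ⟨x, rfl⟩ := h hy
  exact ⟨⟨x, hy⟩, rfl⟩

lemma range_eq_top_of_epi {X Y : ModuleCat.{u} Λ} (p : X ⟶ Y) [Epi p] :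
    LinearMap.range p.hom = ⊤ :=
  LinearMap.range_eq_top.2 ((ModuleCat.epi_iff_surjective p).1 inferInstance)

lemma len_ker_of_epi {X Y : ModuleCat.{u} Λ} [Module.Finite Λ X] [Module.Finite Λ Y]
    (p : X ⟶ Y) [Epi p] : len Λ X = len Λ (LinearMap.ker p.hom) + len Λ Y := by
  have := len_eq_ker_add_range p.hom
  rwa [range_eq_top_of_epi, len_top] at this

lemma top_next (i : Fin n) (N : Submodule Λ (D.P i)) (h : 0 < len Λ N)
    (h' : len Λ N + 1 = len Λ (D.P i)) : D.Top (ModuleCat.of Λ N) (D.next i) :=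
  (D.exists_next i).choose_spec.2 N h h'

section
variable {X : ModuleCat.{u} Λ} [Module.Finite Λ X]

lemma Top.next (hX : Uni Λ X) {i : Fin n} (h : D.Top X i) (N : Submodule Λ X)
    (hN : 0 < len Λ N) (h' : len Λ N + 1 = len Λ X) : D.Top (ModuleCat.of Λ N) (D.next i) := by
  obtain ⟨p, hp⟩ := h.exists_epi hX
  obtain ⟨q, hq, -⟩ := exists_epi_comap p N (by rw [range_eq_top_of_epi]; exact le_top)
  have h₁ := len_comap p.hom (N := N) (by rw [range_eq_top_of_epi]; exact le_top)
  have h₂ := len_ker_of_epi p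
  have : Nontrivial (ModuleCat.of Λ N) := nontrivial_of_len_pos hN
  exact (top_next i (N.comap p.hom) (by omega) (by omega)).of_epi'
    (uni_submodule (D.P_uni i) _) q

lemma Top.next_iterate (hX : Uni Λ X) {i : Fin n} (h : D.Top X i) (t : ℕ) (N : Submodule Λ X)
    (hN : 0 < len Λ N) (h' : len Λ N + t = len Λ X) :
    D.Top (ModuleCat.of Λ N) (D.next^[t] i) := by
  induction t generalizing N with
  | zero =>
    obtain rfl : N = ⊤ := eq_top_of_len (by omega)
    exact h.of_epi (Submodule.topEquiv (R := Λ) (M := X)).toModuleIso.hom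
  | succ t ih =>
    obtain ⟨N', hN'⟩ := exists_submodule_len Λ X (len Λ N + 1) (by omega)
    have hle : N ≤ N' := hX.le_iff.2 (by omega)
    have hT := ih N' (by omega) (by omega)
    have hl : len Λ (N.submoduleOf N') = len Λ N :=
      len_congr (Submodule.submoduleOfEquivOfLe hle)
    rw [Function.iterate_succ_apply']
    have hT' := hT.next (uni_submodule hX N') (N.submoduleOf N')
      (by rwa [hl]) (by rw [hl]; exact hN'.symm)
    exact hT'.of_epi (Submodule.submoduleOfEquivOfLe hle).symm.toModuleIso.hom

end

lemma next_eq_of_len_one {i j : Fin n} (hi : len Λ (D.P i) = 1) (h : D.next j = i) : j = i := by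
  by_contra hne
  have hj : len Λ (D.P j) ≠ 1 := fun hj => hne ((D.next_eq j hj).symm.trans h)
  have hp := len_pos (Λ := Λ) (X := D.P j)
  obtain ⟨N, hN⟩ := exists_submodule_len Λ (D.P j) (len Λ (D.P j) - 1) (by omega)
  have hT := top_next j N (by omega) (by omega)
  rw [h] at hT
  obtain ⟨p, hp⟩ := hT.exists_epi (uni_submodule (D.P_uni j) N)
  have : IsIso p := isIso_of_epi_of_len p (by
    have : 0 < len Λ (ModuleCat.of Λ N) := by change 0 < len Λ N; omega
    omega)
  obtain ⟨e⟩ := iso_of_mono_injective (D.P_uni j) (p ≫ ModuleCat.ofHom N.subtype)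
  have := len_iso e
  omega

variable (D)

lemma next_injective : Function.Injective D.next := by
  intro i j hij
  by_cases hi : len Λ (D.P i) = 1
  · have h := D.next_eq i hi
    exact (next_eq_of_len_one hi (hij.symm.trans h)).symm
  by_cases hj : len Λ (D.P j) = 1
  · have h := D.next_eq j hj
    exact next_eq_of_len_one hj (hij.trans h)
  have key (i : Fin n) (hi : len Λ (D.P i) ≠ 1) : ∃ X : ModuleCat.{u} Λ, Module.Finite Λ X ∧
      Uni Λ X ∧ len Λ X = 2 ∧ D.Top X i ∧ D.Soc X (D.next i) := by
    have hp := len_pos (Λ := Λ) (X := D.P i)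
    obtain ⟨N, hN⟩ := exists_submodule_len Λ (D.P i) (len Λ (D.P i) - 2) (by omega)
    have hq := len_quotient N
    have hl : len Λ (ModuleCat.of Λ (D.P i ⧸ N)) = 2 := by
      change len Λ (D.P i ⧸ N) = 2
      omega
    have hU := uni_quotient (D.P_uni i) N
    have : Nontrivial (ModuleCat.of Λ (D.P i ⧸ N)) := nontrivial_of_len_pos (by omega)
    have hT := (top_P (D := D) i).of_epi' (D.P_uni i) (ModuleCat.ofHom N.mkQ)
    refine ⟨_, inferInstance, hU, hl, hT, ?_⟩
    obtain ⟨L, hL⟩ := exists_submodule_len Λ (ModuleCat.of Λ (D.P i ⧸ N)) 1 (by omega)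
    obtain ⟨f, hf⟩ := hT.next hU L (by omega) (by omega)
    have : IsSimpleModule Λ L := len_eq_one_iff.1 hL
    have : IsSimpleModule Λ (ModuleCat.of Λ L) := this
    have := epi_of_simple f hf
    have := mono_of_simple f hf
    have : IsIso f := isIso_of_mono_of_epi f
    have := mono_subtype L
    exact ⟨inv f ≫ ModuleCat.ofHom L.subtype, ne_zero_of_mono _⟩
  obtain ⟨X, _, hXU, hXl, hXT, hXS⟩ := key i hi
  obtain ⟨Y, _, hYU, hYl, hYT, hYS⟩ := key j hj
  obtain ⟨t, ht⟩ := D.exists_P_soc (D.next i)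
  obtain ⟨f, hf⟩ := hXS.exists_mono hXU ht
  obtain ⟨g, hg⟩ := hYS.exists_mono hYU (hij ▸ ht)
  rw [ModuleCat.mono_iff_injective] at hf hg
  have hk : LinearMap.range f.hom = LinearMap.range g.hom := (D.P_uni t).eq_of_len (by
    rw [← len_congr (LinearEquiv.ofInjective f.hom hf),
      ← len_congr (LinearEquiv.ofInjective g.hom hg), hXl, hYl])
  let e : X ≃ₗ[Λ] Y := (LinearEquiv.ofInjective f.hom hf).trans
    ((LinearEquiv.ofEq _ _ hk).trans (LinearEquiv.ofInjective g.hom hg).symm)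
  exact (hXT.unique hXU (hYT.of_epi e.toModuleIso.hom))

/-- The permutation of the simple modules induced by `next`. -/
noncomputable def perm : Equiv.Perm (Fin n) :=
  Equiv.ofBijective D.next (Finite.injective_iff_bijective.1 D.next_injective)

lemma len_P_le_next (i : Fin n) : len Λ (D.P i) ≤ len Λ (D.P (D.next i)) := by
  by_cases hi : len Λ (D.P i) = 1
  · rw [D.next_eq i hi]
  have hp := len_pos (Λ := Λ) (X := D.P i)
  by_contra hlt
  obtain ⟨N, hN⟩ := exists_submodule_len Λ (D.P i) (len Λ (D.P i) - 1) (by omega)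
  obtain ⟨p, hp⟩ := (top_next i N (by omega) (by omega)).exists_epi (uni_submodule (D.P_uni i) N)
  have : IsIso p := isIso_of_epi_of_len p (by change _ ≤ len Λ N; omega)
  obtain ⟨e⟩ := iso_of_mono_injective (D.P_uni i) (p ≫ ModuleCat.ofHom N.subtype)
  have := len_iso e
  omega

lemma len_P_next (i : Fin n) : len Λ (D.P (D.next i)) = len Λ (D.P i) := by
  have h₁ : ∑ i, len Λ (D.P i) = ∑ i, len Λ (D.P (D.perm i)) :=
    (Equiv.sum_comp D.perm fun i => len Λ (D.P i)).symm
  exact ((Finset.sum_eq_sum_iff_of_le fun i _ => D.len_P_le_next i).1 h₁ i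
    (Finset.mem_univ i)).symm

end SimpleCovers

namespace SimpleCovers
variable {Λ : Type u} [Ring Λ] [IsArtinianRing Λ] {n : ℕ} (D : SimpleCovers Λ n)

lemma P_induction {P : ModuleCat.{u} Λ → Prop}
    (iso : ∀ X Y : ModuleCat.{u} Λ, (X ≅ Y) → P X → P Y)
    (zero : ∀ X : ModuleCat.{u} Λ, IsZero X → P X)
    (biprod : ∀ A B : ModuleCat.{u} Λ, Module.Finite Λ A → Module.Finite Λ B →
      P A → P B → P (A ⊞ B))
    (uni : ∀ (X : ModuleCat.{u} Λ) (i : Fin n) (p : D.P i ⟶ X), Module.Finite Λ X →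
      Nontrivial X → Uni Λ X → Epi p → P X)
    (X : ModuleCat.{u} Λ) (hX : Module.Finite Λ X) : P X :=
  fg_induction D.uni iso zero biprod (fun X hX hX' hU => by
    obtain ⟨i, hi⟩ := D.exists_top hU
    obtain ⟨p, hp⟩ := hi.exists_epi hU
    exact uni X i p hX hX' hU hp) X hX

lemma hom_ext_P {X Y : ModuleCat.{u} Λ} (hX : Module.Finite Λ X) (u v : X ⟶ Y)
    (h : ∀ (i : Fin n) (f : D.P i ⟶ X), f ≫ u = f ≫ v) : u = v := by
  refine D.P_induction (P := fun X => ∀ u v : X ⟶ Y,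
    (∀ (i : Fin n) (f : D.P i ⟶ X), f ≫ u = f ≫ v) → u = v) ?_ ?_ ?_ ?_ X hX u v h
  · intro X Y e hX u v h
    rw [← cancel_epi e.hom]
    exact hX _ _ fun i f => by simpa using h i (f ≫ e.hom)
  · intro X hX u v h
    exact hX.eq_of_src _ _
  · intro A B _ _ hA hB u v h
    refine biprod.hom_ext' _ _ (hA _ _ fun i f => ?_) (hB _ _ fun i f => ?_)
    · simpa using h i (f ≫ biprod.inl)
    · simpa using h i (f ≫ biprod.inr)
  · intro X i p _ _ _ _ u v h
    rw [← cancel_epi p]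
    exact h i p

variable {D} in
lemma exists_iterate_of_ne_zero {X : ModuleCat.{u} Λ} [Module.Finite Λ X] (hX : Uni Λ X)
    {i s : Fin n} (h : D.Top X i) (f : D.P s ⟶ X) (hf : f ≠ 0) :
    s = D.next^[len Λ X - len Λ (LinearMap.range f.hom)] i := by
  have h0 : 0 < len Λ (LinearMap.range f.hom) := by
    rw [Nat.pos_iff_ne_zero, Ne, len_submodule_eq_zero_iff, LinearMap.range_eq_bot]
    exact fun h => hf (ModuleCat.hom_ext h)
  have h₁ := h.next_iterate hX (len Λ X - len Λ (LinearMap.range f.hom))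
    (LinearMap.range f.hom) h0 (by have := len_submodule_le (LinearMap.range f.hom); omega)
  let q : D.P s ⟶ ModuleCat.of Λ (LinearMap.range f.hom) := ModuleCat.ofHom f.hom.rangeRestrict
  have : Epi q := by
    rw [ModuleCat.epi_iff_surjective]; exact f.hom.surjective_rangeRestrict
  exact (top_P s).unique (D.P_uni s) (h₁.of_epi q)

lemma exists_orbit_projection (O : Fin n → Prop) (hO : ∀ i, O (D.next i) ↔ O i)
    (X : ModuleCat.{u} Λ) (hX : Module.Finite Λ X) :
    ∃ ε : X ⟶ X, ∀ (s : Fin n) (f : D.P s ⟶ X),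
      (O s → f ≫ ε = f) ∧ (¬ O s → f ≫ ε = 0) := by
  refine D.P_induction (P := fun X => ∃ ε : X ⟶ X, ∀ (s : Fin n) (f : D.P s ⟶ X),
      (O s → f ≫ ε = f) ∧ (¬ O s → f ≫ ε = 0)) ?_ ?_ ?_ ?_ X hX
  · rintro X Y e ⟨ε, hε⟩
    refine ⟨e.inv ≫ ε ≫ e.hom, fun s f => ⟨fun hs => ?_, fun hs => ?_⟩⟩
    · rw [← Category.assoc, ← Category.assoc, (hε s (f ≫ e.inv)).1 hs]
      simp
    · rw [← Category.assoc, ← Category.assoc, (hε s (f ≫ e.inv)).2 hs, zero_comp]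
  · intro X hX
    exact ⟨0, fun s f => ⟨fun _ => hX.eq_of_tgt _ _, fun _ => hX.eq_of_tgt _ _⟩⟩
  · rintro A B _ _ ⟨ε, hε⟩ ⟨ε', hε'⟩
    refine ⟨biprod.map ε ε', fun s f => ⟨fun hs => ?_, fun hs => ?_⟩⟩
    · refine biprod.hom_ext _ _ ?_ ?_
      · simpa using (hε s (f ≫ biprod.fst)).1 hs
      · simpa using (hε' s (f ≫ biprod.snd)).1 hs
    · refine biprod.hom_ext _ _ ?_ ?_
      · simpa using (hε s (f ≫ biprod.fst)).2 hs
      · simpa using (hε' s (f ≫ biprod.snd)).2 hs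
  · intro X i p _ _ hU _
    have hO' (t : ℕ) : O (D.next^[t] i) ↔ O i := by
      induction t with
      | zero => rfl
      | succ t ih => rw [Function.iterate_succ_apply', hO, ih]
    have key (s : Fin n) (f : D.P s ⟶ X) (hf : f ≠ 0) : O s ↔ O i := by
      rw [exists_iterate_of_ne_zero hU ((top_P i).of_epi' (D.P_uni i) p) f hf, hO']
    by_cases hi : O i
    · refine ⟨𝟙 X, fun s f => ⟨fun _ => Category.comp_id f, fun hs => ?_⟩⟩
      rw [Category.comp_id]
      by_contra hf
      exact hs ((key s f hf).2 hi)
    · refine ⟨0, fun s f => ⟨fun hs => ?_, fun _ => comp_zero⟩⟩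
      by_contra hf
      exact hi ((key s f fun h0 => hf (by simp [h0])).1 hs)

lemma orbit_eq_univ
    (hconn : ∀ e : Λ, IsIdempotentElem e → e ∈ Set.center Λ → e = 0 ∨ e = 1)
    (O : Fin n → Prop) (hO : ∀ i, O (D.next i) ↔ O i) (i : Fin n) (hi : O i) (s : Fin n) :
    O s := by
  obtain ⟨ε, hε⟩ := D.exists_orbit_projection O hO (ModuleCat.of Λ Λ) inferInstance
  have hcomm (g : ModuleCat.of Λ Λ ⟶ ModuleCat.of Λ Λ) : ε ≫ g = g ≫ ε := by
    refine D.hom_ext_P inferInstance _ _ fun s f => ?_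
    by_cases hs : O s
    · rw [← Category.assoc, (hε s f).1 hs, ← Category.assoc, (hε s (f ≫ g)).1 hs]
    · rw [← Category.assoc, (hε s f).2 hs, ← Category.assoc, (hε s (f ≫ g)).2 hs, zero_comp]
  have hidem : ε ≫ ε = ε := by
    refine D.hom_ext_P inferInstance _ _ fun s f => ?_
    by_cases hs : O s
    · rw [← Category.assoc, (hε s f).1 hs, (hε s f).1 hs]
    · rw [← Category.assoc, (hε s f).2 hs, zero_comp]
  have hval (x : Λ) : ε.hom x = x * ε.hom (1 : Λ) := by
    have := ε.hom.map_smul x (1 : Λ)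
    rwa [smul_eq_mul, mul_one] at this
  have hmono (s : Fin n) : ∃ f : D.P s ⟶ ModuleCat.of Λ Λ, f ≠ 0 := by
    obtain ⟨r⟩ := D.P_retract s
    exact ⟨r.i, ne_zero_of_mono _⟩
  have he := hconn (ε.hom (1 : Λ)) (by
    have := congrArg (fun t => t.hom (1 : Λ)) hidem
    change ε.hom (ε.hom (1 : Λ)) = _ at this
    rwa [hval (ε.hom (1 : Λ))] at this) (by
    rw [Semigroup.mem_center_iff]
    intro g
    have := congrArg (fun t => t.hom (1 : Λ))
      (hcomm (ModuleCat.ofHom (LinearMap.toSpanSingleton Λ Λ g)))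
    change (ε.hom (1 : Λ)) • g = ε.hom ((1 : Λ) • g) at this
    rw [one_smul, hval g] at this
    exact this.symm)
  rcases he with he | he
  · obtain ⟨f, hf⟩ := hmono i
    refine absurd ?_ hf
    rw [← (hε i f).1 hi]
    ext x
    change ε.hom (f.hom x) = 0
    rw [hval, he, mul_zero]
  · by_contra hs
    obtain ⟨f, hf⟩ := hmono s
    refine hf ?_
    rw [← (hε s f).2 hs]
    ext x
    change f.hom x = ε.hom (f.hom x)
    rw [hval, he, mul_one]

lemma isCycleOn_perm
    (hconn : ∀ e : Λ, IsIdempotentElem e → e ∈ Set.center Λ → e = 0 ∨ e = 1) :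
    D.perm.IsCycleOn (Finset.univ : Finset (Fin n)) := by
  refine ⟨by simp, fun i _ j _ => ?_⟩
  exact D.orbit_eq_univ hconn (fun s => D.perm.SameCycle i s)
    (fun s => D.perm.sameCycle_apply_right (x := i) (y := s)) i (Equiv.Perm.SameCycle.refl _ _) j

lemma len_P_eq
    (hconn : ∀ e : Λ, IsIdempotentElem e → e ∈ Set.center Λ → e = 0 ∨ e = 1) (i j : Fin n) :
    len Λ (D.P i) = len Λ (D.P j) :=
  D.orbit_eq_univ hconn (fun s => len Λ (D.P s) = len Λ (D.P j))
    (fun s => by rw [D.len_P_next]) j rfl i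

lemma jacobson_smul_simple {T : Type u} [AddCommGroup T] [Module Λ T] [IsSimpleModule Λ T]
    {a : Λ} (ha : a ∈ Ideal.jacobson (⊥ : Ideal Λ)) (x : T) : a • x = 0 := by
  have := IsSemisimpleModule.jacobson_le_annihilator Λ T
  rw [Ring.jacobson_eq_sInf_isMaximal] at this
  rw [Ideal.jacobson] at ha
  simp only [bot_le, true_and] at ha
  exact Module.mem_annihilator.1 (this ha) x

lemma radPow_smul (r : ℕ) {X : ModuleCat.{u} Λ} (hX : Module.Finite Λ X) (h : len Λ X ≤ r)
    {a : Λ} (ha : a ∈ radPow Λ r) (x : X) : a • x = 0 := by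
  induction r generalizing X a with
  | zero =>
    have : Subsingleton X := len_eq_zero_iff.1 (by omega : len Λ X = 0)
    exact Subsingleton.elim _ _
  | succ r ih =>
    by_cases h0 : len Λ X = 0
    · have : Subsingleton X := len_eq_zero_iff.1 h0
      exact Subsingleton.elim _ _
    obtain ⟨N, hN⟩ := exists_submodule_len Λ X 1 (by omega)
    have hNs : IsSimpleModule Λ N := len_eq_one_iff.1 hN
    have hq := len_quotient N
    refine Submodule.span_induction (p := fun a _ => a • x = 0) ?_ (zero_smul _ _) ?_ ?_ ha
    · rintro _ ⟨b, hb, c, hc, rfl⟩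
      have := ih (X := ModuleCat.of Λ (X ⧸ N)) inferInstance
        (by change len Λ (X ⧸ N) ≤ r; omega) hc (N.mkQ x)
      change c • N.mkQ x = 0 at this
      rw [← map_smul, Submodule.mkQ_apply, Submodule.Quotient.mk_eq_zero] at this
      rw [mul_smul]
      exact congrArg Subtype.val (jacobson_smul_simple hb (⟨c • x, this⟩ : N))
    · intro a b _ _ h₁ h₂
      rw [add_smul, h₁, h₂, add_zero]
    · intro c a _ h₁
      rw [smul_eq_mul, mul_smul, h₁, smul_zero]

lemma radPow_eq_bot (r : ℕ) (h : ∀ i, len Λ (D.P i) ≤ r) : radPow Λ r = ⊥ := by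
  rw [eq_bot_iff]
  intro a ha
  have key := D.P_induction (P := fun X => ∀ x : X, a • x = 0)
    (fun X Y e hX y => by
      have := congrArg e.hom.hom (hX (e.inv.hom y))
      rw [map_smul, map_zero] at this
      have he : e.hom.hom (e.inv.hom y) = y := congrArg (fun t => t.hom y) e.inv_hom_id
      rwa [he] at this)
    (fun X hX x => by
      have := ModuleCat.subsingleton_of_isZero hX
      exact Subsingleton.elim _ _)
    (fun A B _ _ hA hB x => by
      have e : x = (Limits.biprod.inl : A ⟶ A ⊞ B).hom ((Limits.biprod.fst : A ⊞ B ⟶ A).hom x) +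
          (Limits.biprod.inr : B ⟶ A ⊞ B).hom ((Limits.biprod.snd : A ⊞ B ⟶ B).hom x) :=
        (congrArg (fun t => t.hom x) (biprod.total (X := A) (Y := B))).symm
      rw [e, smul_add, ← map_smul (Limits.biprod.inl : A ⟶ A ⊞ B).hom, ← map_smul (Limits.biprod.inr : B ⟶ A ⊞ B).hom, hA, hB,
        map_zero, map_zero, add_zero])
    (fun X i p _ _ _ hp x => by
      obtain ⟨y, rfl⟩ := (ModuleCat.epi_iff_surjective p).1 hp x
      change a • p.hom y = 0
      rw [← map_smul, radPow_smul r inferInstance (h i) ha, map_zero])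
    (ModuleCat.of Λ Λ) inferInstance
  have := key (1 : Λ)
  change a * 1 = 0 at this
  rwa [mul_one] at this

variable {D} in
lemma exists_smul_of_mem_radical {i : Fin n} {N : Submodule Λ (D.P i)} (hN : N ≠ ⊤)
    {x : D.P i} (hx : x ∈ N) : ∃ a ∈ Ideal.jacobson (⊥ : Ideal Λ), ∃ y : D.P i, x = a • y := by
  obtain ⟨r⟩ := D.P_retract i
  have hr : r.r.hom (r.i.hom x) = x := congrArg (fun t => t.hom x) r.retract
  refine ⟨r.i.hom x, ?_, r.r.hom (1 : Λ), ?_⟩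
  · rw [Ideal.jacobson, Submodule.mem_sInf]
    rintro I ⟨-, hI⟩
    have : IsSimpleModule Λ (Λ ⧸ I) := isSimpleModule_iff_isCoatom.2 hI.out
    by_contra hxI
    let g : D.P i →ₗ[Λ] Λ ⧸ I := (Submodule.mkQ I) ∘ₗ r.i.hom
    have hg : g x ≠ 0 := by
      intro h0
      exact hxI ((Submodule.Quotient.mk_eq_zero I).1 h0)
    have hgs : Function.Surjective g := LinearMap.surjective_of_ne_zero fun h0 => hg (by
      rw [h0, LinearMap.zero_apply])
    have hk := len_eq_ker_add_range g
    rw [LinearMap.range_eq_top.2 hgs, len_top, len_eq_one_iff.2 this] at hk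
    have hlt := len_submodule_lt hN
    exact hg ((D.P_uni i).le_iff.2 (by omega : len Λ N ≤ len Λ (LinearMap.ker g)) hx)
  · rw [← map_smul, smul_eq_mul, mul_one, hr]

lemma exists_smul_radPow {c : ℕ} (hc : ∀ i, len Λ (D.P i) = c) (t : ℕ) (i : Fin n)
    (N : Submodule Λ (D.P i)) (hN : len Λ N + t = c) (x : D.P i) (hx : x ∈ N) :
    ∃ a ∈ radPow Λ t, ∃ y : D.P i, x = a • y := by
  induction t generalizing N x with
  | zero => exact ⟨1, trivial, x, (one_smul _ _).symm⟩
  | succ t ih =>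
    have hci := hc i
    obtain ⟨N', hN'⟩ := exists_submodule_len Λ (D.P i) (len Λ N + 1) (by omega)
    have hle : N ≤ N' := (D.P_uni i).le_iff.2 (by omega)
    have hU := uni_submodule (D.P_uni i) N'
    have : Nontrivial (ModuleCat.of Λ N') :=
      nontrivial_of_len_pos (by change 0 < len Λ N'; omega)
    obtain ⟨j, hj⟩ := D.exists_top hU
    obtain ⟨p, hp⟩ := hj.exists_epi hU
    obtain ⟨z, hz⟩ := (ModuleCat.epi_iff_surjective p).1 hp (⟨x, hle hx⟩ : N')
    have hl : len Λ (N.submoduleOf N') = len Λ N :=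
      len_congr (Submodule.submoduleOfEquivOfLe hle)
    have hz' : z ∈ Submodule.comap p.hom (N.submoduleOf N') := by
      change p.hom z ∈ N.submoduleOf N'
      change p.hom z = _ at hz
      rw [hz]
      exact hx
    obtain ⟨a, ha, y, rfl⟩ := exists_smul_of_mem_radical (N := Submodule.comap p.hom
      (N.submoduleOf N')) (fun htop => by
        have := range_eq_top_of_epi p
        have h2 : (⊤ : Submodule Λ (ModuleCat.of Λ N')) ≤ N.submoduleOf N' := by
          rw [← this]
          rintro _ ⟨w, rfl⟩
          have : w ∈ Submodule.comap p.hom (N.submoduleOf N') := htop ▸ Submodule.mem_top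
          exact this
        have := len_mono h2
        rw [len_top, hl] at this
        change len Λ N' ≤ _ at this
        omega) hz'
    obtain ⟨b, hb, w, hw⟩ := ih N' (by omega) (p.hom y).1 (p.hom y).2
    refine ⟨a * b, Submodule.subset_span ⟨a, ha, b, hb, rfl⟩, w, ?_⟩
    have := congrArg Subtype.val hz
    change (p.hom (a • y)).1 = x at this
    rw [← this, map_smul, mul_smul, ← hw]
    rfl

lemma len_P {m : ℕ} (hconn : ∀ e : Λ, IsIdempotentElem e → e ∈ Set.center Λ → e = 0 ∨ e = 1)
    (htop : radPow Λ m = ⊥) (hbot : radPow Λ (m - 1) ≠ ⊥) (i : Fin n) : len Λ (D.P i) = m := by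
  have hc (j : Fin n) : len Λ (D.P j) = len Λ (D.P i) := D.len_P_eq hconn j i
  apply le_antisymm
  · by_contra hlt
    obtain ⟨N, hN⟩ := exists_submodule_len Λ (D.P i) (len Λ (D.P i) - m) (by omega)
    have hne : N ≠ ⊥ := by
      rw [Ne, ← len_submodule_eq_zero_iff (Λ := Λ)]; omega
    obtain ⟨x, hx, hx0⟩ := (Submodule.ne_bot_iff _).1 hne
    obtain ⟨a, ha, y, rfl⟩ := D.exists_smul_radPow hc m i N (by omega) x hx
    rw [htop, Submodule.mem_bot] at ha
    exact hx0 (by rw [ha, zero_smul])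
  · by_contra hlt
    exact hbot (D.radPow_eq_bot (m - 1) fun j => by rw [hc]; omega)

end SimpleCovers

/-- The finitely generated indecomposable modules of a self-injective Nakayama algebra with `n`
simple modules and Loewy length `m`: the module `U a b` has composition factors
`S a, …, S (b - 1)` from top to socle, the indices being taken modulo `n`. -/
structure StripModel (Λ : Type u) [Ring Λ] (n m : ℕ) where
  dec : ∀ X : ModuleCat.{u} Λ, Module.Finite Λ X → Indec Λ X → Uni Λ X
  U : ℤ → ℤ → ModuleCat.{u} Λ
  finite : ∀ a b : ℤ, Module.Finite Λ (U a b)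
  uni : ∀ a b, Uni Λ (U a b)
  len_eq : ∀ a b : ℤ, a ≤ b → b ≤ a + m → len Λ (U a b) = (b - a).toNat
  proj : ∀ a : ℤ, Projective (U a (a + m))
  inj : ∀ a : ℤ, Injective (U a (a + m))
  sub : ∀ a a' b : ℤ, a ≤ a' → a' ≤ b → b ≤ a + m → ∃ f : U a' b ⟶ U a b, Mono f
  quo : ∀ a b b' : ℤ, a ≤ b → b ≤ b' → b' ≤ a + m → ∃ f : U a b' ⟶ U a b, Epi f
  shift : ∀ a b : ℤ, a ≤ b → b ≤ a + m → Nonempty (U (a + n) (b + n) ≅ U a b)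
  hom : ∀ a b c d : ℤ, a ≤ b → b ≤ a + m → c ≤ d → d ≤ c + m → ∀ f : U c d ⟶ U a b, f ≠ 0 →
    ∃ t : ℤ, len Λ (LinearMap.range f.hom) = (b - (c + t * n)).toNat ∧ a ≤ c + t * n ∧
      c + t * n < b ∧ b ≤ d + t * n
  complete : ∀ X : ModuleCat.{u} Λ, Module.Finite Λ X → Nontrivial X → Uni Λ X →
    ∃ a b : ℤ, a < b ∧ b ≤ a + m ∧ Nonempty (X ≅ U a b)

namespace SimpleCovers
variable {Λ : Type u} [Ring Λ] [IsArtinianRing Λ] {n : ℕ} [NeZero n] (D : SimpleCovers Λ n)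

/-- The simple modules along the cycle. -/
noncomputable def cyc (a : ℤ) : Fin n := (D.perm ^ a) 0

lemma next_iterate_cyc (t : ℕ) (a : ℤ) : D.next^[t] (D.cyc a) = D.cyc (a + t) := by
  have h (i : Fin n) : D.next^[t] i = (D.perm ^ t) i := by
    induction t with
    | zero => rfl
    | succ t ih => rw [Function.iterate_succ_apply', ih, pow_succ', Equiv.Perm.mul_apply]; rfl
  rw [h, cyc, cyc, add_comm, zpow_add, zpow_natCast, Equiv.Perm.mul_apply]

variable {D} in
lemma cyc_eq_iff (hcyc : D.perm.IsCycleOn (Finset.univ : Finset (Fin n))) {a b : ℤ} :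
    D.cyc a = D.cyc b ↔ a ≡ b [ZMOD n] := by
  have := hcyc.zpow_apply_eq_zpow_apply (Finset.mem_univ 0) (m := a) (n := b)
  rwa [Finset.card_univ, Fintype.card_fin] at this

variable {D} in
lemma exists_cyc (hcyc : D.perm.IsCycleOn (Finset.univ : Finset (Fin n))) (i : Fin n) :
    ∃ a, D.cyc a = i :=
  hcyc.2 (by simp) (by simp)

/-- The property of being isomorphic to the module of length `b - a` with top `cyc a`. -/
structure IsStrip (X : ModuleCat.{u} Λ) (a b : ℤ) : Prop where
  finite : Module.Finite Λ X
  uni : Uni Λ X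
  len_eq : len Λ X = (b - a).toNat
  top : a < b → D.Top X (D.cyc a)

variable {D}

lemma IsStrip.iso {X Y : ModuleCat.{u} Λ} {a b c d : ℤ} (hX : D.IsStrip X a b)
    (hY : D.IsStrip Y c d) (h : D.cyc a = D.cyc c) (h' : b - a = d - c) : Nonempty (X ≅ Y) := by
  have := hX.finite
  have := hY.finite
  have h₁ := hX.len_eq
  have h₂ := hY.len_eq
  by_cases hab : a < b
  · have ht := hX.top hab
    rw [h] at ht
    exact ht.iso hX.uni hY.uni (hY.top (by omega)) (by rw [h₁, h₂, h'])
  · exact ⟨(isZero_iff_len.2 (by omega)).iso (isZero_iff_len.2 (by omega))⟩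

lemma IsStrip.of_epi {X Y : ModuleCat.{u} Λ} {a b b' : ℤ} (hX : D.IsStrip X a b') (p : X ⟶ Y)
    [Epi p] (hl : len Λ Y = (b - a).toNat) (h : a ≤ b) : D.IsStrip Y a b := by
  have := hX.finite
  have hf := finite_of_epi p
  have h₁ := hX.len_eq
  have h₂ := len_le_of_epi p
  refine ⟨hf, hX.uni.of_epi p, hl, fun hab => ?_⟩
  have : Nontrivial Y := nontrivial_of_len_pos (by omega)
  exact (hX.top (by omega)).of_epi' hX.uni p

lemma IsStrip.submodule {X : ModuleCat.{u} Λ} {a b a' : ℤ} (hX : D.IsStrip X a b)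
    (N : Submodule Λ X) (hl : len Λ N = (b - a').toNat) (h : a ≤ a') :
    D.IsStrip (ModuleCat.of Λ N) a' b := by
  have := hX.finite
  have h₁ := hX.len_eq
  refine ⟨inferInstance, uni_submodule hX.uni N, hl, fun hab => ?_⟩
  have := (hX.top (by omega)).next_iterate hX.uni (a' - a).toNat N (by omega) (by omega)
  rw [D.next_iterate_cyc] at this
  convert this using 2
  omega

lemma exists_isStrip {m : ℕ} (hlen : ∀ i, len Λ (D.P i) = m) (a b : ℤ) :
    ∃ X : ModuleCat.{u} Λ, Module.Finite Λ X ∧ Uni Λ X ∧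
      (a ≤ b → b ≤ a + m → D.IsStrip X a b) := by
  have hP : D.IsStrip (D.P (D.cyc a)) a (a + m) :=
    ⟨inferInstance, D.P_uni _, by rw [hlen]; omega, fun _ => top_P _⟩
  obtain ⟨N, hN⟩ := exists_submodule_len Λ (D.P (D.cyc a)) (m - (b - a).toNat)
    (by rw [hlen]; omega)
  refine ⟨ModuleCat.of Λ (D.P (D.cyc a) ⧸ N), inferInstance, uni_quotient (D.P_uni _) N,
    fun hab hbm => hP.of_epi (ModuleCat.ofHom N.mkQ) ?_ hab⟩
  have := len_quotient N
  rw [hlen, hN] at this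
  change len Λ (D.P (D.cyc a) ⧸ N) = _
  omega

variable (D) in
lemma nonempty_stripModel {m : ℕ} (hlen : ∀ i, len Λ (D.P i) = m)
    (hcyc : D.perm.IsCycleOn (Finset.univ : Finset (Fin n))) : Nonempty (StripModel Λ n m) := by
  choose U hfin huni hU using exists_isStrip hlen
  have hP (a : ℤ) : D.IsStrip (D.P (D.cyc a)) a (a + m) :=
    ⟨inferInstance, D.P_uni _, by rw [hlen]; omega, fun _ => top_P _⟩
  have hPU (a : ℤ) : Nonempty (D.P (D.cyc a) ≅ U a (a + m)) :=
    (hP a).iso (hU a (a + m) (by omega) le_rfl) rfl rfl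
  exact ⟨{
    dec := D.uni
    U := U
    finite := hfin
    uni := huni
    len_eq := fun a b hab hbm => (hU a b hab hbm).len_eq
    proj := fun a => (Retract.ofIso (hPU a).some.symm).projective
    inj := fun a => (Retract.ofIso (hPU a).some.symm).injective
    sub := by
      intro a a' b h₁ h₂ h₃
      have hX := hU a b (by omega) h₃
      have h := hX.len_eq
      obtain ⟨N, hN⟩ := exists_submodule_len Λ (U a b) (b - a').toNat (by omega)
      obtain ⟨e⟩ := (hU a' b h₂ (by omega)).iso (hX.submodule N hN h₁) rfl rfl
      exact ⟨e.hom ≫ ModuleCat.ofHom N.subtype, inferInstance⟩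
    quo := by
      intro a b b' h₁ h₂ h₃
      have hX := hU a b' (by omega) h₃
      have h := hX.len_eq
      obtain ⟨N, hN⟩ := exists_submodule_len Λ (U a b') (b' - b).toNat (by omega)
      have hq := len_quotient N
      have hY := hX.of_epi (b := b) (ModuleCat.ofHom N.mkQ)
        (by change len Λ (U a b' ⧸ N) = _; omega) h₁
      obtain ⟨e⟩ := hY.iso (hU a b h₁ (by omega)) rfl rfl
      exact ⟨ModuleCat.ofHom N.mkQ ≫ e.hom, epi_comp _ _⟩
    shift := by
      intro a b h₁ h₂
      refine (hU (a + n) (b + n) (by omega) (by omega)).iso (hU a b h₁ h₂) ?_ (by omega)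
      rw [cyc_eq_iff hcyc]
      simp
    hom := by
      intro a b c d h₁ h₂ h₃ h₄ f hf
      have hX := hU a b h₁ h₂
      have hY := hU c d h₃ h₄
      have hlX := hX.len_eq
      have hlY := hY.len_eq
      have h0 : 0 < len Λ (LinearMap.range f.hom) := by
        rw [Nat.pos_iff_ne_zero, Ne, len_submodule_eq_zero_iff, LinearMap.range_eq_bot]
        exact fun h => hf (ModuleCat.hom_ext h)
      have hle := len_submodule_le (LinearMap.range f.hom)
      have hle' := len_eq_ker_add_range f.hom
      set l := len Λ (LinearMap.range f.hom) with hl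
      have hs := hX.submodule (a' := b - l) (LinearMap.range f.hom) (by omega) (by omega)
      let q : U c d ⟶ ModuleCat.of Λ (LinearMap.range f.hom) :=
        ModuleCat.ofHom f.hom.rangeRestrict
      have : Epi q := by
        rw [ModuleCat.epi_iff_surjective]; exact f.hom.surjective_rangeRestrict
      have hq := hY.of_epi (b := c + l) q (by change l = _; omega) (by omega)
      have ht := (hs.top (by omega)).unique hs.uni (hq.top (by omega))
      rw [cyc_eq_iff hcyc] at ht
      obtain ⟨t, ht⟩ := ht.symm.dvd
      refine ⟨t, ?_, ?_, ?_, ?_⟩ <;> rw [mul_comm] <;> omega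
    complete := by
      intro X hX hX' hXU
      obtain ⟨i, hi⟩ := D.exists_top hXU
      obtain ⟨a, rfl⟩ := exists_cyc hcyc i
      obtain ⟨p, hp⟩ := hi.exists_epi hXU
      have hl := len_le_of_epi p
      rw [hlen] at hl
      have hpos := len_pos (Λ := Λ) (X := X)
      refine ⟨a, a + len Λ X, by omega, by omega, ?_⟩
      exact IsStrip.iso ⟨hX, hXU, by omega, fun _ => hi⟩ (hU a (a + len Λ X) (by omega) (by omega))
        rfl rfl }⟩

end SimpleCovers

lemma IsSelfInjNakayama.nonempty_stripModel {k Λ : Type u} [Field k] [Ring Λ] [Algebra k Λ]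
    {n m : ℕ} [NeZero n] (h : IsSelfInjNakayama k Λ n m) : Nonempty (StripModel Λ n m) := by
  have := h.isArtinianRing
  obtain ⟨D⟩ := h.nonempty_simpleCovers
  exact D.nonempty_stripModel (D.len_P h.connected h.loewy_top h.loewy_bot)
    (D.isCycleOn_perm h.connected)

lemma exists_lift_of_range_le {Λ : Type u} [Ring Λ] {X Y Z : ModuleCat.{u} Λ} (f : X ⟶ Z)
    (g : Y ⟶ Z) [Mono g] (h : LinearMap.range f.hom ≤ LinearMap.range g.hom) :
    ∃ x : X ⟶ Y, x ≫ g = f := by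
  have hg : Function.Injective g.hom := (ModuleCat.mono_iff_injective g).1 inferInstance
  let e := LinearEquiv.ofInjective g.hom hg
  refine ⟨ModuleCat.ofHom (e.symm.toLinearMap ∘ₗ
    f.hom.codRestrict (LinearMap.range g.hom) fun x => h ⟨x, rfl⟩), ?_⟩
  ext x
  exact congrArg Subtype.val (e.apply_symm_apply _)

lemma range_comp_eq_map {Λ : Type u} [Ring Λ] {X Y Z : ModuleCat.{u} Λ} (f : X ⟶ Y)
    (g : Y ⟶ Z) : LinearMap.range (f ≫ g).hom = (LinearMap.range f.hom).map g.hom := by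
  rw [ModuleCat.hom_comp, LinearMap.range_comp]

lemma len_range_of_mono {Λ : Type u} [Ring Λ] {X Y : ModuleCat.{u} Λ} (f : X ⟶ Y) [Mono f] :
    len Λ (LinearMap.range f.hom) = len Λ X :=
  (len_congr (LinearEquiv.ofInjective f.hom
    ((ModuleCat.mono_iff_injective f).1 inferInstance))).symm

namespace StripModel
variable {Λ : Type u} [Ring Λ] [IsArtinianRing Λ] {n m : ℕ} (D : StripModel Λ n m)

attribute [instance] finite proj inj

lemma isZero_U (a : ℤ) : IsZero (D.U a a) := by
  rw [isZero_iff_len, D.len_eq a a le_rfl (by omega)]; omega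

lemma nontrivial_U {a b : ℤ} (h : a < b) (h' : b ≤ a + m) : Nontrivial (D.U a b) :=
  nontrivial_of_not_isZero (by
    rw [isZero_iff_len, D.len_eq a b h.le h']; omega)

lemma shift_int (t : ℤ) {a b : ℤ} (h : a ≤ b) (h' : b ≤ a + m) :
    Nonempty (D.U (a + t * n) (b + t * n) ≅ D.U a b) := by
  induction t using Int.induction_on with
  | zero =>
    rw [zero_mul, add_zero, add_zero]
    exact ⟨Iso.refl _⟩
  | succ i ih =>
    obtain ⟨e⟩ := ih
    obtain ⟨e'⟩ := D.shift (a + i * n) (b + i * n) (by omega) (by omega)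
    rw [add_one_mul, ← add_assoc, ← add_assoc]
    exact ⟨e' ≪≫ e⟩
  | pred i ih =>
    obtain ⟨e⟩ := ih
    obtain ⟨e'⟩ := D.shift (a + (-i - 1) * n) (b + (-i - 1) * n) (by omega) (by omega)
    rw [sub_one_mul] at e' ⊢
    rw [add_assoc, sub_add_cancel, add_assoc, sub_add_cancel] at e'
    exact ⟨e'.symm ≪≫ e⟩

lemma shift_eq {a b c d t : ℤ} (h : a ≤ b) (h' : b ≤ a + m) (hc : c = a + t * n)
    (hd : d = b + t * n) : Nonempty (D.U c d ≅ D.U a b) := by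
  subst hc hd
  exact D.shift_int t h h'

lemma len_ker_quo {a b b' : ℤ} (h₁ : a ≤ b) (h₂ : b ≤ b') (h₃ : b' ≤ a + m)
    (g : D.U a b' ⟶ D.U a b) [Epi g] : len Λ (LinearMap.ker g.hom) = (b' - b).toNat := by
  have := SimpleCovers.len_ker_of_epi g
  rw [D.len_eq a b' (by omega) h₃, D.len_eq a b h₁ (by omega)] at this
  omega

lemma exists_hom {a b c d : ℤ} (h₁ : a ≤ c) (h₂ : c < b) (h₃ : b ≤ d) (h₄ : b ≤ a + m)
    (h₅ : d ≤ c + m) : ∃ y : D.U c d ⟶ D.U a b, y ≠ 0 ∧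
      len Λ (LinearMap.range y.hom) = (b - c).toNat := by
  obtain ⟨p, hp⟩ := D.quo c b d h₂.le h₃ h₅
  obtain ⟨i, hi⟩ := D.sub a c b h₁ h₂.le h₄
  have hl : len Λ (LinearMap.range (p ≫ i).hom) = (b - c).toNat := by
    rw [range_comp_eq_map, SimpleCovers.range_eq_top_of_epi, Submodule.map_top,
      len_range_of_mono, D.len_eq c b h₂.le (by omega)]
  refine ⟨p ≫ i, fun h0 => ?_, hl⟩
  rw [h0] at hl
  have : LinearMap.range (0 : D.U c d ⟶ D.U a b).hom = ⊥ := LinearMap.range_zero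
  rw [this, len_submodule_eq_zero_iff.2 rfl] at hl
  omega

/-- Some map `U c d ⟶ U a b` does not lift to `U a b'`. -/
lemma exists_no_lift {a b b' c d : ℤ} (h₁ : a ≤ c) (h₂ : c < b) (h₃ : b ≤ d) (h₄ : d < b')
    (h₅ : b' ≤ a + m) (h₆ : d ≤ c + m) : ∃ y : D.U c d ⟶ D.U a b,
      ∀ g : D.U a b' ⟶ D.U a b, Epi g → ¬ ∃ x : D.U c d ⟶ D.U a b', x ≫ g = y := by
  obtain ⟨y, hy, hl⟩ := D.exists_hom h₁ h₂ h₃ (by omega) h₆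
  refine ⟨y, ?_⟩
  rintro g hg ⟨x, rfl⟩
  have hx : x ≠ 0 := by
    rintro rfl
    exact hy zero_comp
  have hk : LinearMap.ker g.hom ≤ LinearMap.range x.hom := by
    refine ((D.uni a b') _ _).resolve_right fun hle => hy ?_
    ext z
    exact hle ⟨z, rfl⟩
  obtain ⟨t, ht₁, ht₂, ht₃, ht₄⟩ := D.hom a b' c d (by omega) h₅ (by omega) h₆ x hx
  have hm := len_map g.hom hk
  rw [← range_comp_eq_map, hl, D.len_ker_quo (by omega) (by omega) h₅ g, ht₁] at hm
  omega

lemma exists_shortExact {a b c : ℤ} (h₁ : a ≤ b) (h₂ : b ≤ c) (h₃ : c ≤ a + m) :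
    ∃ (f : D.U b c ⟶ D.U a c) (g : D.U a c ⟶ D.U a b) (w : f ≫ g = 0),
      (ShortComplex.mk f g w).ShortExact := by
  obtain ⟨f, hf⟩ := D.sub a b c h₁ h₂ h₃
  obtain ⟨g, hg⟩ := D.quo a b c h₁ h₂ h₃
  have hk : LinearMap.range f.hom = LinearMap.ker g.hom := (D.uni a c).eq_of_len (by
    rw [len_range_of_mono f, D.len_ker_quo h₁ h₂ h₃, D.len_eq b c h₂ (by omega)])
  refine ⟨f, g, ?_, ?_⟩
  · ext x
    exact hk.le ⟨x, rfl⟩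
  · exact { exact := (ShortComplex.moduleCat_exact_iff_range_eq_ker _).2 hk }

/-- Any map to `U a b` whose image has length at most `b - a'` lifts to `U a' b`. -/
lemma lift_sub {a a' b : ℤ} (h₁ : a ≤ a') (h₂ : a' ≤ b) (h₃ : b ≤ a + m)
    (v : D.U a' b ⟶ D.U a b) [Mono v] {X : ModuleCat.{u} Λ} (y : X ⟶ D.U a b)
    (h : len Λ (LinearMap.range y.hom) ≤ (b - a').toNat) : ∃ x, x ≫ v = y := by
  refine exists_lift_of_range_le y v ((D.uni a b).le_iff.2 ?_)
  rwa [len_range_of_mono v, D.len_eq a' b h₂ (by omega)]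

lemma lift_quo {a b b' c d : ℤ} (h₁ : a ≤ b) (h₂ : b ≤ b') (h₃ : b' ≤ a + m) (h₄ : c ≤ d)
    (h₅ : d ≤ c + m) (p : D.U a b' ⟶ D.U a b) [Epi p] (y : D.U c d ⟶ D.U a b)
    (h : y ≠ 0 → b' - b + len Λ (LinearMap.range y.hom) ≤ d - c) : ∃ x, x ≫ p = y := by
  by_cases hy : y = 0
  · exact ⟨0, by rw [hy, zero_comp]⟩
  obtain ⟨π, hπ⟩ := D.quo c d (c + m) h₄ h₅ le_rfl
  have htop := SimpleCovers.range_eq_top_of_epi p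
  refine (D.uni c (c + m)).factor (D.uni a b') π y p hy (by rw [htop]; exact le_top) ?_
  rw [len_comap _ (by rw [htop]; exact le_top), D.len_ker_quo h₁ h₂ h₃, D.len_eq c d h₄ h₅]
  have := h hy
  omega

/-- The short exact sequence attached to a rectangle in the Auslander–Reiten quiver. -/
lemma exists_rectangle {a a' b b' : ℤ} (h₁ : a ≤ a') (h₂ : a' ≤ b) (h₃ : b ≤ b')
    (h₄ : b' ≤ a + m) : ∃ (u : D.U a' b' ⟶ D.U a b') (q : D.U a' b' ⟶ D.U a' b)
      (p : D.U a b' ⟶ D.U a b) (v : D.U a' b ⟶ D.U a b)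
      (w : biprod.lift u q ≫ biprod.desc p (-v) = 0),
      Mono u ∧ Epi q ∧ Epi p ∧ Mono v ∧
        (ShortComplex.mk (biprod.lift u q) (biprod.desc p (-v)) w).ShortExact := by
  obtain ⟨u, hu⟩ := D.sub a a' b' h₁ (by omega) h₄
  obtain ⟨p, hp⟩ := D.quo a b b' (by omega) h₃ h₄
  obtain ⟨v, hv⟩ := D.sub a a' b h₁ h₂ (by omega)
  have hk : LinearMap.ker p.hom ≤ LinearMap.range u.hom := (D.uni a b').le_iff.2 (by
    rw [len_range_of_mono u, D.len_ker_quo (by omega) h₃ h₄, D.len_eq a' b' (by omega) (by omega)]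
    omega)
  have hr : LinearMap.range (u ≫ p).hom = LinearMap.range v.hom := (D.uni a b).eq_of_len (by
    have := len_map p.hom hk
    rw [← range_comp_eq_map, len_range_of_mono u, D.len_ker_quo (by omega) h₃ h₄,
      D.len_eq a' b' (by omega) (by omega)] at this
    rw [len_range_of_mono v, D.len_eq a' b h₂ (by omega)]
    omega)
  obtain ⟨q, hq⟩ := exists_lift_of_range_le (u ≫ p) v hr.le
  have hqe : Epi q := by
    rw [ModuleCat.epi_iff_surjective]
    intro x
    obtain ⟨y, hy⟩ : v.hom x ∈ LinearMap.range (u ≫ p).hom := hr ▸ ⟨x, rfl⟩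
    refine ⟨y, (ModuleCat.mono_iff_injective v).1 hv ?_⟩
    change v.hom (q.hom y) = v.hom x
    rw [← hy, ← hq]
    rfl
  have w : biprod.lift u q ≫ biprod.desc p (-v) = 0 := by
    rw [biprod.lift_desc, hq.symm]
    simp
  refine ⟨u, q, p, v, w, hu, hqe, hp, hv, ?_⟩
  have hmono : Mono (biprod.lift u q) := by
    have : Mono (biprod.lift u q ≫ biprod.fst) := by rwa [biprod.lift_fst]
    exact mono_of_mono _ biprod.fst
  have hepi : Epi (biprod.desc p (-v)) := by
    have : Epi (biprod.inl ≫ biprod.desc p (-v)) := by rwa [biprod.inl_desc]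
    exact epi_of_epi biprod.inl _
  refine ⟨?_⟩
  refine ShortComplex.exact_of_f_is_kernel _ (KernelFork.IsLimit.ofι' _ _ fun {T} k hkk => ?_)
  suffices h : ∃ l, l ≫ biprod.lift u q = k from ⟨h.choose, h.choose_spec⟩
  have hkk' : (k ≫ biprod.fst) ≫ p = (k ≫ biprod.snd) ≫ v := by
    have : k = biprod.lift (k ≫ biprod.fst) (k ≫ biprod.snd) :=
      biprod.hom_ext _ _ (by simp) (by simp)
    change k ≫ biprod.desc p (-v) = 0 at hkk
    rw [this, biprod.lift_desc, Preadditive.comp_neg, ← sub_eq_add_neg, sub_eq_zero] at hkk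
    exact hkk
  obtain ⟨x, hxu⟩ : ∃ x, x ≫ u = k ≫ biprod.fst := by
    refine exists_lift_of_range_le _ _ ?_
    rintro _ ⟨z, rfl⟩
    obtain ⟨y, hy⟩ : p.hom ((k ≫ biprod.fst).hom z) ∈ LinearMap.range (u ≫ p).hom := by
      rw [hr]
      exact ⟨(k ≫ biprod.snd).hom z, (congrArg (fun t => t.hom z) hkk').symm⟩
    have hmem : (k ≫ biprod.fst).hom z - u.hom y ∈ LinearMap.ker p.hom := by
      rw [LinearMap.mem_ker, map_sub, ← hy]
      exact sub_self _
    have := add_mem (hk hmem) (⟨y, rfl⟩ : u.hom y ∈ LinearMap.range u.hom)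
    rwa [sub_add_cancel] at this
  have hxq : x ≫ q = k ≫ biprod.snd := by
    rw [← cancel_mono v, Category.assoc, hq, ← hkk', ← hxu, Category.assoc]
  exact ⟨x, biprod.hom_ext _ _ (by simpa using hxu) (by simpa using hxq)⟩

end StripModel

open Abelian in
lemma hasProjectiveDimensionLT_X₁_of_factors {A : Type u} [Ring A]
    {S : ShortComplex (ModuleCat.{u} A)} (hS : S.ShortExact) {Q : ModuleCat.{u} A}
    (hQ : Projective Q) (i : S.X₁ ⟶ Q) (j : Q ⟶ S.X₂) (hij : i ≫ j = S.f) (r : ℕ)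
    (h : HasProjectiveDimensionLT S.X₃ (r + 2)) : HasProjectiveDimensionLT S.X₁ (r + 1) := by
  rw [hasProjectiveDimensionLT_iff] at h ⊢
  intro l hl Y e
  obtain ⟨l, rfl⟩ : ∃ l', l = l' + 1 := ⟨l - 1, by omega⟩
  obtain ⟨x, rfl⟩ := Ext.contravariant_sequence_exact₁ hS Y e (add_comm 1 (l + 1))
    (h _ (by omega) _)
  have h0 : (Ext.mk₀ j).comp x (zero_add _) = 0 := Ext.eq_zero_of_projective _
  rw [← hij, ← Ext.mk₀_comp_mk₀_assoc, h0, Ext.comp_zero]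

namespace StripModel
variable {Λ : Type u} [Ring Λ] [IsArtinianRing Λ] {n m : ℕ} (D : StripModel Λ n m)

/-- The indecomposable module `U c d` is a summand of a finite sum of copies of `M`. -/
def Mem (M : ModuleCat.{u} Λ) (c d : ℤ) : Prop := c < d ∧ d ≤ c + m ∧ InAdd Λ M (D.U c d)

/-- No summand `U c d` of `M` obstructs the exactness of `Hom(M, -)` on the rectangle. -/
def RectExact (M : ModuleCat.{u} Λ) (a a' b b' : ℤ) : Prop :=
  ∀ c d, D.Mem M c d → a ≤ c → c < a' → c < b → b ≤ d → b' ≤ d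

variable {D} {M : ModuleCat.{u} Λ}

lemma Mem.shift {c d c' d' t : ℤ} (h : D.Mem M c d) (hc : c' = c + t * n) (hd : d' = d + t * n) :
    D.Mem M c' d' :=
  ⟨by have := h.1; omega, by have := h.2.1; omega,
    h.2.2.of_iso (D.shift_eq h.1.le h.2.1 hc hd).some⟩

variable (D)

lemma lifts_of_uni {X B C : ModuleCat.{u} Λ} (hX : Module.Finite Λ X) (h : InAdd Λ M X)
    (g : B ⟶ C) (H : ∀ c d, D.Mem M c d → ∀ y : D.U c d ⟶ C, ∃ x, x ≫ g = y) (y : X ⟶ C) :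
    ∃ x, x ≫ g = y := by
  revert y h
  refine fg_induction D.dec (P := fun X => InAdd Λ M X → ∀ y : X ⟶ C, ∃ x, x ≫ g = y)
    ?_ ?_ ?_ ?_ X hX
  · intro X Y e hP hY y
    obtain ⟨x, hx⟩ := hP (hY.of_iso e) (e.hom ≫ y)
    exact ⟨e.inv ≫ x, by rw [Category.assoc, hx, e.inv_hom_id_assoc]⟩
  · intro X hX _ y
    exact ⟨0, hX.eq_of_src _ _⟩
  · intro A B _ _ hA hB h y
    obtain ⟨x, hx⟩ := hA (h.of_retract ⟨biprod.inl, biprod.fst, by simp⟩) (biprod.inl ≫ y)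
    obtain ⟨x', hx'⟩ := hB (h.of_retract ⟨biprod.inr, biprod.snd, by simp⟩) (biprod.inr ≫ y)
    exact ⟨biprod.desc x x', biprod.hom_ext' _ _ (by simp [hx]) (by simp [hx'])⟩
  · intro X hf hn hu h y
    obtain ⟨a, b, h₁, h₂, ⟨e⟩⟩ := D.complete X hf hn hu
    obtain ⟨x, hx⟩ := H a b ⟨h₁, h₂, h.of_iso e.symm⟩ (e.inv ≫ y)
    exact ⟨e.hom ≫ x, by rw [Category.assoc, hx, e.hom_inv_id_assoc]⟩

lemma lift_rect {a a' b b' : ℤ} (h₁ : a ≤ a') (h₂ : a' ≤ b) (h₃ : b ≤ b')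
    (h₄ : b' ≤ a + m) (p : D.U a b' ⟶ D.U a b) (v : D.U a' b ⟶ D.U a b) [Epi p] [Mono v]
    (H : D.RectExact M a a' b b') {c d : ℤ} (h : D.Mem M c d) (y : D.U c d ⟶ D.U a b) :
    ∃ x, x ≫ biprod.desc p (-v) = y := by
  by_cases hy : y = 0
  · exact ⟨0, by rw [hy, zero_comp]⟩
  obtain ⟨t, ht₁, ht₂, ht₃, ht₄⟩ := D.hom a b c d (by omega) (by omega) h.1.le h.2.1 y hy
  by_cases hc : a' ≤ c + t * n
  · obtain ⟨x, hx⟩ := D.lift_sub h₁ h₂ (by omega) v y (by omega)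
    exact ⟨(-x) ≫ biprod.inr, by simp [hx]⟩
  · have := H _ _ (h.shift rfl rfl) ht₂ (by omega) ht₃ ht₄
    obtain ⟨x, hx⟩ := D.lift_quo (by omega) h₃ h₄ h.1.le h.2.1 p y (fun _ => by
      rw [ht₁]; omega)
    exact ⟨x ≫ biprod.inl, by simp [hx]⟩

lemma exists_rectangle_homF [Module.Finite Λ M] {a a' b b' : ℤ} (h₁ : a ≤ a') (h₂ : a' ≤ b)
    (h₃ : b ≤ b') (h₄ : b' ≤ a + m) (H : D.RectExact M a a' b b') :
    ∃ (u : D.U a' b' ⟶ D.U a b') (q : D.U a' b' ⟶ D.U a' b)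
      (g : D.U a b' ⊞ D.U a' b ⟶ D.U a b) (w : biprod.lift u q ≫ g = 0), Mono u ∧ Epi q ∧
        (∀ y : M ⟶ D.U a b, ∃ x, x ≫ g = y) ∧
        ((ShortComplex.mk (biprod.lift u q) g w).map (homF M)).ShortExact := by
  obtain ⟨u, q, p, v, w, hu, hq, hp, hv, hS⟩ := D.exists_rectangle h₁ h₂ h₃ h₄
  have hl := D.lifts_of_uni inferInstance (InAdd.self M) (biprod.desc p (-v))
    fun c d h y => D.lift_rect h₁ h₂ h₃ h₄ p v H h y
  exact ⟨u, q, _, w, hu, hq, hl, shortExact_homF M hS hl⟩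

lemma not_projective_of_rectExact [Module.Finite Λ M] (hM : InAdd Λ M (ModuleCat.of Λ Λ))
    {a a' b b' : ℤ} (h₁ : a < a') (h₂ : a' ≤ b)
    (h₃ : b < b') (h₄ : b' ≤ a + m) (H : D.RectExact M a a' b b') :
    ¬ Projective ((homF M).obj (D.U a b)) := by
  intro hp
  obtain ⟨u, q, g, w, -, -, hl, -⟩ := D.exists_rectangle_homF h₁.le h₂ h₃.le h₄ H
  obtain ⟨s, hs⟩ := exists_lift_of_projective_homF (isSeparator_of_inAdd hM) hp g hl (𝟙 _)
  have := D.nontrivial_U (show a < b by omega) (by omega)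
  rcases (D.uni a b).retract_biprod ⟨s, g, hs⟩ with ⟨⟨r⟩⟩ | ⟨⟨r⟩⟩
  · obtain ⟨e⟩ := (D.uni _ _).iso_of_retract r
    have := len_iso e
    rw [D.len_eq _ _ (by omega) (by omega), D.len_eq _ _ (by omega) (by omega)] at this
    omega
  · obtain ⟨e⟩ := (D.uni _ _).iso_of_retract r
    have := len_iso e
    rw [D.len_eq _ _ (by omega) (by omega), D.len_eq _ _ (by omega) (by omega)] at this
    omega

/-- Dimension shifting along a rectangle whose first map factors through projectives. -/
lemma hasProjectiveDimensionLT_syzygy [Module.Finite Λ M] {a s b d c : ℤ} (h₁ : a ≤ s)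
    (h₂ : s ≤ b) (h₃ : b ≤ d) (h₄ : d ≤ a + m) (H : D.RectExact M a s b d) (hc : D.Mem M c d)
    (hac : a ≤ c) (hcs : c ≤ s) (hb : s = b ∨ ∃ d', D.Mem M s d' ∧ b ≤ d' ∧ d' ≤ d) (r : ℕ)
    (h : HasProjectiveDimensionLT ((homF M).obj (D.U a b)) (r + 2)) :
    HasProjectiveDimensionLT ((homF M).obj (D.U s d)) (r + 1) := by
  obtain ⟨u, q, g, w, hu, hq, -, hS⟩ := D.exists_rectangle_homF h₁ h₂ h₃ h₄ H
  have := hc.1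
  obtain ⟨ι, hι⟩ := D.sub a c d hac (by omega) h₄
  obtain ⟨u', hu'⟩ := D.lift_sub hac (by omega) h₄ ι u (by
    rw [len_range_of_mono u, D.len_eq s d (by omega) (by omega)]
    omega)
  obtain ⟨Q, hQ, q', π, hq'⟩ : ∃ (Q : ModuleCat.{u} Λ) (_ : InAdd Λ M Q) (q' : D.U s d ⟶ Q)
      (π : Q ⟶ D.U s b), q' ≫ π = q := by
    rcases hb with rfl | ⟨d', hd, h₅, h₆⟩
    · exact ⟨D.U c d, hc.2.2, 0, 0, (D.isZero_U s).eq_of_tgt _ _⟩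
    · obtain ⟨π, hπ⟩ := D.quo s b d' h₂ h₅ hd.2.1
      obtain ⟨q', hq'⟩ := D.lift_quo h₂ h₅ hd.2.1 (by omega) (by omega) π q (fun _ => by
        have := len_submodule_le (LinearMap.range q.hom)
        rw [D.len_eq s b h₂ (by omega)] at this
        omega)
      exact ⟨_, hd.2.2, q', π, hq'⟩
  refine hasProjectiveDimensionLT_X₁_of_factors hS (projective_homF (hc.2.2.biprod hQ))
    ((homF M).map (biprod.lift u' q')) ((homF M).map (biprod.map ι π)) ?_ r h
  exact ((homF M).map_comp _ _).symm.trans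
    (congrArg (homF M).map (biprod.hom_ext _ _ (by simp [hu']) (by simp [hq'])))

lemma hasProjectiveDimensionLT_rect [Module.Finite Λ M] {a a' b b' : ℤ} (h₁ : a ≤ a')
    (h₂ : a' ≤ b) (h₃ : b ≤ b') (h₄ : b' ≤ a + m) (H : D.RectExact M a a' b b') (r : ℕ)
    (h : HasProjectiveDimensionLT ((homF M).obj (D.U a' b')) r)
    (h' : HasProjectiveDimensionLT ((homF M).obj (D.U a b')) (r + 1))
    (h'' : HasProjectiveDimensionLT ((homF M).obj (D.U a' b)) (r + 1)) :
    HasProjectiveDimensionLT ((homF M).obj (D.U a b)) (r + 1) := by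
  obtain ⟨u, q, g, w, hu, hq, -, hS⟩ := D.exists_rectangle_homF h₁ h₂ h₃ h₄ H
  have := preservesBinaryBiproducts_of_preservesBiproducts (homF M)
  have e : (homF M).obj (D.U a b' ⊞ D.U a' b) ≅
    (homF M).obj (D.U a b') ⊞ (homF M).obj (D.U a' b) := (homF M).mapBiprod _ _
  have h2 : HasProjectiveDimensionLT ((homF M).obj (D.U a b') ⊞ (homF M).obj (D.U a' b)) (r + 1) :=
    inferInstance
  exact hS.hasProjectiveDimensionLT_X₃ r h (hasProjectiveDimensionLT_of_iso e.symm (r + 1))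

end StripModel

namespace StripModel
variable {Λ : Type u} [Ring Λ] [IsArtinianRing Λ] {n m : ℕ} (D : StripModel Λ n m)
  {M : ModuleCat.{u} Λ} {s : ℕ}

lemma not_mem_of_domdimGE_three [Module.Finite Λ M] (hM : InAdd Λ M (ModuleCat.of Λ Λ)) {r : ℕ}
    (hr : 3 ≤ r) (h : DomdimGE (End (op M)) r) (hn : 0 < n) {c d : ℤ} (h₁ : n ≤ d - c)
    (h₂ : d - c ≤ m - n) : ¬ D.Mem M c d := by
  intro hc
  obtain ⟨f, g, w, hS⟩ := D.exists_shortExact (a := d - m) (b := c) (c := d) (by omega) (by omega)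
    (by omega)
  have := hS.epi_g
  obtain ⟨y, hy⟩ := D.exists_no_lift (a := d - m) (b := c) (b' := d) (c := c - n) (d := d - n)
    (by omega) (by omega) (by omega) (by omega) (by omega) (by omega)
  exact hy g this (exists_lift_of_domdimGE_three hM hr h hS hc.2.2
    (hc.shift (t := -1) (by ring) (by ring)).2.2 y)

lemma not_mem_of_domdimGE_four [Module.Finite Λ M] (hM : InAdd Λ M (ModuleCat.of Λ Λ)) {r : ℕ}
    (hr : 4 ≤ r) (h : DomdimGE (End (op M)) r) (hn : 0 < n) {c d : ℤ} (h₁ : m - 2 * n < d - c)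
    (h₂ : d - c < 2 * n) (h₃ : 2 * n ≤ m) : ¬ D.Mem M c d := by
  intro hc
  obtain ⟨f, g, w, hS⟩ := D.exists_shortExact (a := d - m) (b := c) (c := d) (by omega) (by omega)
    (by omega)
  obtain ⟨f', g', w', hT⟩ := D.exists_shortExact (a := c - m) (b := d - m) (c := c) (by omega)
    (by omega) (by omega)
  have := hT.epi_g
  have h₂ : Injective (D.U (d - m) d) := by
    have := D.inj (d - m)
    rwa [sub_add_cancel] at this
  obtain ⟨y, hy⟩ := D.exists_no_lift (a := c - m) (b := d - m) (b' := c) (c := c - 2 * n)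
    (d := d - 2 * n) (by omega) (by omega) (by omega) (by omega) (by omega) (by omega)
  exact hy g' this (exists_lift_of_domdimGE_four hM hr h hS hc.2.2 h₂ hT (Iso.refl _)
    (hc.shift (t := -2) (by ring) (by ring)).2.2 y)

/-- `d` is the least end of a summand `U c d` of `M` with `a ≤ c` and length at least `2 * n`. -/
def LeastLong (M : ModuleCat.{u} Λ) (a d : ℤ) : Prop :=
  (∃ c, a ≤ c ∧ 2 * n ≤ d - c ∧ D.Mem M c d) ∧
    ∀ x y, a ≤ x → 2 * n ≤ y - x → D.Mem M x y → d ≤ y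

/-- `t` is the least start of a summand `U t d` of `M` of length at most `s` containing the
step ending at `b`, or `b` if there is none. -/
def LeastShort (M : ModuleCat.{u} Λ) (s : ℕ) (b t : ℤ) : Prop :=
  (t = b ∨ t < b ∧ ∃ d, b ≤ d ∧ d - t ≤ s ∧ D.Mem M t d) ∧
    ∀ c d, c < b → b ≤ d → d - c ≤ s → D.Mem M c d → t ≤ c

variable {D}

lemma exists_leastLong (hP : ∀ a, InAdd Λ M (D.U a (a + m))) (hn : 0 < n) (hm : 2 * n ≤ m)
    (a : ℤ) : ∃ d, D.LeastLong M a d ∧ a + 2 * n ≤ d ∧ d ≤ a + m := by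
  obtain ⟨d, ⟨c, h₁, h₂, h₃⟩, h⟩ := Int.exists_least_of_bdd
    (P := fun d => ∃ c, a ≤ c ∧ 2 * n ≤ d - c ∧ D.Mem M c d)
    ⟨a, fun z ⟨c, h₁, h₂, _⟩ => by omega⟩
    ⟨a + m, a, le_rfl, by omega, by omega, le_rfl, hP a⟩
  exact ⟨d, ⟨⟨c, h₁, h₂, h₃⟩, fun c' d' h₁ h₂ h₃ => h d' ⟨c', h₁, h₂, h₃⟩⟩, by omega,
    h _ ⟨a, le_rfl, by omega, by omega, le_rfl, hP a⟩⟩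

lemma exists_leastShort (b : ℤ) : ∃ t, D.LeastShort M s b t ∧ b - s ≤ t ∧ t ≤ b := by
  obtain ⟨t, h₁, h⟩ := Int.exists_least_of_bdd
    (P := fun t => t = b ∨ t < b ∧ ∃ d, b ≤ d ∧ d - t ≤ s ∧ D.Mem M t d)
    ⟨b - s, fun z hz => by rcases hz with h | ⟨h, d, h₁, h₂, _⟩ <;> omega⟩ ⟨b, Or.inl rfl⟩
  refine ⟨t, ⟨h₁, fun c d h₁ h₂ h₃ h₄ => h c (Or.inr ⟨h₁, d, h₂, h₃, h₄⟩)⟩, ?_,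
    h _ (Or.inl rfl)⟩
  rcases h₁ with h | ⟨h, d, h₁, h₂, _⟩ <;> omega

lemma LeastLong.shift {a d : ℤ} (h : D.LeastLong M a d) : D.LeastLong M (a + n) (d + n) := by
  obtain ⟨⟨c, h₁, h₂, h₃⟩, h⟩ := h
  refine ⟨⟨c + n, by omega, by omega, h₃.shift (t := 1) (by ring) (by ring)⟩, ?_⟩
  intro c' d' h₁ h₂ h₃
  have := h (c' - n) (d' - n) (by omega) (by omega) (h₃.shift (t := -1) (by ring) (by ring))
  omega

lemma LeastLong.bounds {a d : ℤ} (h : D.LeastLong M a d) (hP : ∀ a, InAdd Λ M (D.U a (a + m)))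
    (hn : 0 < n) (hm : 2 * n ≤ m) : a + 2 * n ≤ d ∧ d ≤ a + m := by
  obtain ⟨⟨c, h₁, h₂, h₃⟩, h⟩ := h
  exact ⟨by omega, h a _ le_rfl (by omega) ⟨by omega, le_rfl, hP a⟩⟩

lemma LeastShort.bounds {b t : ℤ} (h : D.LeastShort M s b t) : b - s ≤ t ∧ t ≤ b := by
  obtain ⟨h | ⟨h, d, h₁, h₂, -⟩, -⟩ := h <;> omega

lemma rectExact_of_least (hd : ∀ c d, D.Mem M c d → d - c ≤ s ∨ 2 * n ≤ d - c) {a t b d : ℤ}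
    (hT : D.LeastLong M a d) (hS : D.LeastShort M s b t) : D.RectExact M a t b d := by
  intro c d' h h₁ h₂ h₃ h₄
  rcases hd c d' h with h₅ | h₅
  · have := hS.2 c d' h₃ h₄ h₅ h
    omega
  · exact hT.2 c d' h₁ h₅ h

variable (D) in
/-- If `M` only has short and long indecomposable summands, then some modules of the form
`Hom(M, U a b)` have infinite projective dimension. -/
lemma not_hasProjectiveDimensionLT [Module.Finite Λ M] (hM : InAdd Λ M (ModuleCat.of Λ Λ))
    (hP : ∀ a, InAdd Λ M (D.U a (a + m)))
    (hm : m = 2 * n + s) (hs : s < n)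
    (hd : ∀ c d, D.Mem M c d → d - c ≤ s ∨ 2 * n ≤ d - c) (k : ℕ) :
    (∀ a d, D.LeastLong M a d →
      ¬ HasProjectiveDimensionLT ((homF M).obj (D.U a (d - n))) (k + 1)) ∧
    ∀ b t, D.LeastShort M s b t →
      ¬ HasProjectiveDimensionLT ((homF M).obj (D.U (t - n) b)) (k + 1) := by
  have aux (a t b d : ℤ) (hT : D.LeastLong M a d) (hS : D.LeastShort M s b t)
      (hat : a < t ∧ t ≤ b ∧ b < d ∧ t + s ≤ d ∧ d ≤ a + m ∧ d ≤ t + 2 * n) (k : ℕ)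
      (h : HasProjectiveDimensionLT ((homF M).obj (D.U a b)) (k + 1)) :
      ∃ l, k = l + 1 ∧ HasProjectiveDimensionLT ((homF M).obj (D.U t d)) (l + 1) := by
    have H := rectExact_of_least hd hT hS
    cases k with
    | zero =>
      exact absurd (projective_iff_hasProjectiveDimensionLT_one.2 h)
        (D.not_projective_of_rectExact hM (by omega) (by omega) (by omega) (by omega) H)
    | succ l =>
      obtain ⟨⟨c, h₁, h₂, h₃⟩, -⟩ := hT
      refine ⟨l, rfl, D.hasProjectiveDimensionLT_syzygy (by omega) (by omega) (by omega) (by omega)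
        H h₃ h₁ (by omega) ?_ l h⟩
      rcases hS.1 with h | ⟨h, d', h₁, h₂, h₃⟩
      · exact Or.inl h
      · exact Or.inr ⟨d', h₃, h₁, by omega⟩
  induction k with
  | zero =>
    constructor
    · intro a d hT h
      obtain ⟨t, hS, ht⟩ := exists_leastShort (D := D) (M := M) (s := s) (d - n)
      have := hT.bounds hP (by omega) (by omega)
      obtain ⟨l, hl, -⟩ := aux a t (d - n) d hT hS (by omega) 0 h
      omega
    · intro b t hS h
      obtain ⟨d, hT, hd⟩ := exists_leastLong hP (by omega) (by omega) (t - n)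
      have := hS.bounds
      obtain ⟨l, hl, -⟩ := aux (t - n) t b d hT hS (by omega) 0 h
      omega
  | succ k ih =>
    constructor
    · intro a d hT h
      obtain ⟨t, hS, ht⟩ := exists_leastShort (D := D) (M := M) (s := s) (d - n)
      have := hT.bounds hP (by omega) (by omega)
      obtain ⟨l, hl, h'⟩ := aux a t (d - n) d hT hS (by omega) _ h
      obtain rfl : k = l := by omega
      obtain ⟨e⟩ := D.shift_eq (a := t) (b := d) (c := t - n) (d := d - n) (t := -1) (by omega)
        (by omega) (by ring) (by ring)
      exact ih.2 _ _ hS (hasProjectiveDimensionLT_of_iso ((homF M).mapIso e.symm) _)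
    · intro b t hS h
      obtain ⟨d, hT, hd⟩ := exists_leastLong hP (by omega) (by omega) (t - n)
      have := hS.bounds
      obtain ⟨l, hl, h'⟩ := aux (t - n) t b d hT hS (by omega) _ h
      obtain rfl : k = l := by omega
      have hT' := hT.shift
      rw [sub_add_cancel] at hT'
      refine ih.1 t (d + n) hT' ?_
      rwa [add_sub_cancel_right]

lemma not_gldimLE [Module.Finite Λ M] (hM : IsGenCogen Λ M)
    (hm : m = 2 * n + s) (hs : s < n)
    (hd : ∀ c d, D.Mem M c d → d - c ≤ s ∨ 2 * n ≤ d - c) (r : ℕ) :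
    ¬ GldimLE (End (op M)) r := by
  rw [gldimLE_iff]
  intro h
  have hP (a : ℤ) : InAdd Λ M (D.U a (a + m)) := hM.2 _ (D.finite _ _) (D.inj a)
  obtain ⟨d, hT, -⟩ := exists_leastLong hP (by omega) (by omega) 0
  exact (D.not_hasProjectiveDimensionLT hM.1 hP hm hs hd r).1 0 d hT (h _)

end StripModel

open Abelian in
lemma subsingleton_ext_of_iso {Λ : Type u} [Ring Λ] {X Y Z : ModuleCat.{u} Λ} {j : ℕ} (e : Y ≅ Z)
    (h : Subsingleton (Ext X Y j)) : Subsingleton (Ext X Z j) :=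
  subsingleton_ext_of_inAdd h ((InAdd.self Y).of_iso e.symm)

open Abelian in
lemma subsingleton_ext_biprod {Λ : Type u} [Ring Λ] {X A B : ModuleCat.{u} Λ} {j : ℕ}
    (hA : Subsingleton (Ext X A j)) (hB : Subsingleton (Ext X B j)) :
    Subsingleton (Ext X (A ⊞ B) j) :=
  Ext.addEquivBiprod.subsingleton

namespace StripModel
variable {Λ : Type u} [Ring Λ] [IsArtinianRing Λ] {n m : ℕ} (D : StripModel Λ n m)
  {M : ModuleCat.{u} Λ}

lemma exists_mono_injective (hP : ∀ a, InAdd Λ M (D.U a (a + m))) (X : ModuleCat.{u} Λ)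
    (hX : Module.Finite Λ X) :
    ∃ (I : ModuleCat.{u} Λ) (i : X ⟶ I), Mono i ∧ Injective I ∧ InAdd Λ M I := by
  refine fg_induction D.dec (P := fun X => ∃ (I : ModuleCat.{u} Λ) (i : X ⟶ I),
    Mono i ∧ Injective I ∧ InAdd Λ M I) ?_ ?_ ?_ ?_ X hX
  · rintro X Y e ⟨I, i, hi, h⟩
    exact ⟨I, e.inv ≫ i, mono_comp _ _, h⟩
  · intro X hX
    have r : Retract X (D.U 0 (0 + m)) := ⟨0, 0, hX.eq_of_src _ _⟩
    have := D.inj 0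
    exact ⟨X, 𝟙 X, inferInstance, r.injective, InAdd.zero hX⟩
  · rintro A B - - ⟨I, i, hi, hI, hI'⟩ ⟨J, j, hj, hJ, hJ'⟩
    exact ⟨I ⊞ J, biprod.map i j, inferInstance, inferInstance, hI'.biprod hJ'⟩
  · intro X hf hn hu
    obtain ⟨a, b, h₁, h₂, ⟨e⟩⟩ := D.complete X hf hn hu
    obtain ⟨i, hi⟩ := D.sub (b - m) a b (by omega) h₁.le (by omega)
    have h := D.inj (b - m)
    have h' := hP (b - m)
    rw [sub_add_cancel] at h h'
    exact ⟨_, e.hom ≫ i, mono_comp _ _, h, h'⟩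

lemma isGenCogen (hΛ : Injective (ModuleCat.of Λ Λ)) (hP : ∀ a, InAdd Λ M (D.U a (a + m))) :
    IsGenCogen Λ M := by
  have key (X : ModuleCat.{u} Λ) (hX : Module.Finite Λ X) (h : Injective X) : InAdd Λ M X := by
    obtain ⟨I, i, hi, -, h'⟩ := D.exists_mono_injective hP X hX
    exact h'.of_retract ⟨i, Injective.factorThru (𝟙 X) i, Injective.comp_factorThru _ _⟩
  exact ⟨key _ (inferInstanceAs (Module.Finite Λ Λ)) hΛ, key⟩

lemma domdimGE_two (D : StripModel Λ n m) [Module.Finite Λ M] (hM : IsGenCogen Λ M) : DomdimGE (End (op M)) 2 := by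
  have hP (a : ℤ) : InAdd Λ M (D.U a (a + m)) := hM.2 _ (D.finite _ _) (D.inj a)
  obtain ⟨I, i, hi, hI, hI'⟩ := D.exists_mono_injective hP M inferInstance
  exact (domdimGE_of_exists_lift hM.1 (D.exists_mono_injective hP) i hi hI hI').1

open Abelian in
lemma subsingleton_ext [Module.Finite Λ M]
    (H : ∀ a b c d, D.Mem M a b → D.Mem M c d → b - m ≤ c → c < a → a ≤ d → b ≤ d)
    (X : ModuleCat.{u} Λ) (hX : Module.Finite Λ X) (h : InAdd Λ M X) :
    Subsingleton (Ext M X 1) := by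
  revert h
  refine fg_induction D.dec (P := fun X => InAdd Λ M X → Subsingleton (Ext M X 1)) ?_ ?_ ?_ ?_ X hX
  · intro X Y e hX hY
    exact subsingleton_ext_of_iso e (hX (hY.of_iso e))
  · intro X hX _
    have r : Retract X (D.U 0 (0 + m)) := ⟨0, 0, hX.eq_of_src _ _⟩
    have := D.inj 0
    have := r.injective
    exact ⟨fun x y => (Ext.eq_zero_of_injective x).trans (Ext.eq_zero_of_injective y).symm⟩
  · intro A B _ _ hA hB h
    exact subsingleton_ext_biprod (hA (h.of_retract ⟨biprod.inl, biprod.fst, by simp⟩))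
      (hB (h.of_retract ⟨biprod.inr, biprod.snd, by simp⟩))
  · intro X hf hn hu h
    obtain ⟨a, b, h₁, h₂, ⟨e⟩⟩ := D.complete X hf hn hu
    have hab : D.Mem M a b := ⟨h₁, h₂, h.of_iso e.symm⟩
    obtain ⟨f, g, w, hS⟩ := D.exists_shortExact (a := b - m) (b := a) (c := b) (by omega) h₁.le
      (by omega)
    have hI := D.inj (b - m)
    rw [sub_add_cancel] at hI
    have := hS.epi_g
    refine subsingleton_ext_of_iso e.symm (ext_one_of_exists_lift hS hI ?_)
    refine D.lifts_of_uni inferInstance (InAdd.self M) g fun c d hcd y => ?_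
    by_cases hy : y = 0
    · exact ⟨0, by rw [hy, zero_comp]⟩
    obtain ⟨t, ht₁, ht₂, ht₃, ht₄⟩ := D.hom (b - m) a c d (by omega) (by omega) hcd.1.le hcd.2.1 y hy
    have := H a b _ _ hab (hcd.shift rfl rfl) ht₂ ht₃ ht₄
    exact D.lift_quo (by omega) h₁.le (by omega) hcd.1.le hcd.2.1 g y (fun _ => by
      rw [ht₁]; omega)

lemma domdimGE_three [Module.Finite Λ M] (hM : IsGenCogen Λ M)
    (H : ∀ a b c d, D.Mem M a b → D.Mem M c d → b - m ≤ c → c < a → a ≤ d → b ≤ d) :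
    DomdimGE (End (op M)) 3 := by
  have hP (a : ℤ) : InAdd Λ M (D.U a (a + m)) := hM.2 _ (D.finite _ _) (D.inj a)
  obtain ⟨I, i, hi, hI, hI'⟩ := D.exists_mono_injective hP M inferInstance
  refine (domdimGE_of_exists_lift hM.1 (D.exists_mono_injective hP) i hi hI hI').2 ?_
  exact exists_lift_of_ext_one (shortExact_cokernel i)
    (D.subsingleton_ext H M inferInstance (InAdd.self M))

/-- The direct sum of finitely many of the modules `U a b`. -/
noncomputable def sum (T : Finset (ℤ × ℤ)) : ModuleCat.{u} Λ :=
  ⨁ fun i : Fin T.card => D.U (T.equivFin.symm i).1.1 (T.equivFin.symm i).1.2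

instance (T : Finset (ℤ × ℤ)) : Module.Finite Λ (D.sum T) :=
  finite_biproduct _

lemma inAdd_sum {T : Finset (ℤ × ℤ)} {p : ℤ × ℤ} (hp : p ∈ T) : InAdd Λ (D.sum T) (D.U p.1 p.2) := by
  let f : Fin T.card → ModuleCat.{u} Λ :=
    fun i => D.U (T.equivFin.symm i).1.1 (T.equivFin.symm i).1.2
  have h : InAdd Λ (⨁ f) (f (T.equivFin ⟨p, hp⟩)) :=
    (InAdd.self _).of_retract ⟨biproduct.ι f _, biproduct.π f _, biproduct.ι_π_self f _⟩
  have e : f (T.equivFin ⟨p, hp⟩) = D.U p.1 p.2 := by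
    simp only [f, Equiv.symm_apply_apply]
  rwa [e] at h

lemma exists_shift_of_iso {a b c d : ℤ} (h₁ : a < b) (h₂ : b ≤ a + m) (h₃ : c < d)
    (h₄ : d ≤ c + m) (e : D.U c d ≅ D.U a b) : ∃ t : ℤ, a = c + t * n ∧ b = d + t * n := by
  have hl := len_iso e
  rw [D.len_eq _ _ h₁.le h₂, D.len_eq _ _ h₃.le h₄] at hl
  have := D.nontrivial_U h₃ h₄
  have hr : len Λ (LinearMap.range e.hom.hom) = (b - a).toNat := by
    rw [SimpleCovers.range_eq_top_of_epi, len_top, D.len_eq _ _ h₁.le h₂]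
  obtain ⟨t, ht₁, ht₂, ht₃, ht₄⟩ := D.hom a b c d h₁.le h₂ h₃.le h₄ e.hom (by
    intro h0
    rw [h0] at hr
    have : LinearMap.range (0 : D.U c d ⟶ D.U a b).hom = ⊥ := LinearMap.range_zero
    rw [this, len_submodule_eq_zero_iff.2 rfl] at hr
    omega)
  exact ⟨t, by omega, by omega⟩

lemma exists_of_mem_sum {T : Finset (ℤ × ℤ)} (hT : ∀ p ∈ T, p.1 < p.2 ∧ p.2 ≤ p.1 + m) {c d : ℤ}
    (h : D.Mem (D.sum T) c d) : ∃ p ∈ T, ∃ t : ℤ, p.1 = c + t * n ∧ p.2 = d + t * n := by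
  obtain ⟨h₁, h₂, h⟩ := h
  obtain ⟨r, ⟨ρ⟩⟩ := (inAdd_iff _ _).1 h
  have := D.nontrivial_U h₁ h₂
  obtain ⟨-, ⟨ρ'⟩⟩ := (D.uni c d).retract_biproduct ρ
  obtain ⟨i, ⟨ρ''⟩⟩ := (D.uni c d).retract_biproduct ρ'
  obtain ⟨e⟩ := (D.uni _ _).iso_of_retract ρ''
  have hp := hT _ (T.equivFin.symm i).2
  exact ⟨_, (T.equivFin.symm i).2, D.exists_shift_of_iso hp.1 hp.2 h₁ h₂ e⟩

end StripModel

namespace StripModel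
variable {Λ : Type u} [Ring Λ] [IsArtinianRing Λ] {n m : ℕ} (D : StripModel Λ n m)
  {M : ModuleCat.{u} Λ}

open Classical in
/-- A module whose indecomposable summands are prescribed up to shift. -/
lemma exists_module (P : ℤ → ℤ → Prop) (N : ℤ)
    (hP : ∀ a b, P a b → -N ≤ a ∧ b ≤ N ∧ a < b ∧ b ≤ a + m) :
    ∃ M : ModuleCat.{u} Λ, Module.Finite Λ M ∧ (∀ a b, P a b → InAdd Λ M (D.U a b)) ∧
      ∀ c d, D.Mem M c d → ∃ t : ℤ, P (c + t * n) (d + t * n) := by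
  let T : Finset (ℤ × ℤ) :=
    (Finset.Icc (-N) N ×ˢ Finset.Icc (-N) N).filter fun p => P p.1 p.2
  have hT (p : ℤ × ℤ) : p ∈ T ↔ P p.1 p.2 := by
    simp only [T, Finset.mem_filter, Finset.mem_product, Finset.mem_Icc, and_iff_right_iff_imp]
    intro h
    have := hP _ _ h
    omega
  refine ⟨D.sum T, inferInstance, fun a b h => D.inAdd_sum ((hT (a, b)).2 h), fun c d h => ?_⟩
  obtain ⟨p, hp, t, h₁, h₂⟩ := D.exists_of_mem_sum
    (fun p hp => (hP _ _ ((hT p).1 hp)).2.2) h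
  exact ⟨t, by rw [← h₁, ← h₂]; exact (hT p).1 hp⟩

variable {D} in
lemma inAdd_shift {a b t : ℤ} (h : InAdd Λ M (D.U (a + t * n) (b + t * n))) (h₁ : a ≤ b)
    (h₂ : b ≤ a + m) : InAdd Λ M (D.U a b) :=
  h.of_iso (D.shift_int t h₁ h₂).some.symm

lemma exists_reduce (hn : 0 < n) (a c : ℤ) : ∃ t : ℤ, c ≤ a + t * n ∧ a + t * n < c + n := by
  have h₁ := Int.emod_nonneg (a - c) (b := n) (by omega)
  have h₂ := Int.emod_lt_of_pos (a - c) (b := n) (by omega)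
  have h₃ := Int.emod_add_mul_ediv (a - c) n
  refine ⟨-((a - c) / n), ?_⟩
  have : -((a - c) / n) * n = -(n * ((a - c) / n)) := by ring
  omega

/-- A bound for the modules `U a b` with `a` in a fundamental domain bounds all modules. -/
lemma hasProjectiveDimensionLT_of_reduced (hn : 0 < n) (e : ℤ) (r : ℕ)
    (h : ∀ a b, e ≤ a → a < e + n → a < b → b ≤ a + m →
      HasProjectiveDimensionLT ((homF M).obj (D.U a b)) r)
    (X : ModuleCat.{u} Λ) (hX : Module.Finite Λ X) :
    HasProjectiveDimensionLT ((homF M).obj X) r := by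
  refine fg_induction D.dec (P := fun X => HasProjectiveDimensionLT ((homF M).obj X) r)
    ?_ ?_ ?_ ?_ X hX
  · intro X Y e h
    exact hasProjectiveDimensionLT_of_iso ((homF M).mapIso e) r
  · intro X hX
    have : HasProjectiveDimensionLT ((homF M).obj X) 0 :=
      ((homF M).map_isZero hX).hasProjectiveDimensionLT_zero
    exact hasProjectiveDimensionLT_of_ge _ 0 r (by omega)
  · intro A B _ _ hA hB
    have := preservesBinaryBiproducts_of_preservesBiproducts (homF M)
    have e : (homF M).obj (A ⊞ B) ≅ (homF M).obj A ⊞ (homF M).obj B := (homF M).mapBiprod _ _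
    have h2 : HasProjectiveDimensionLT ((homF M).obj A ⊞ (homF M).obj B) r := inferInstance
    exact hasProjectiveDimensionLT_of_iso e.symm r
  · intro X hf hn' hu
    obtain ⟨a, b, h₁, h₂, ⟨φ⟩⟩ := D.complete X hf hn' hu
    obtain ⟨t, ht⟩ := exists_reduce hn a e
    have := h (a + t * n) (b + t * n) ht.1 ht.2 (by omega) (by omega)
    exact hasProjectiveDimensionLT_of_iso
      ((homF M).mapIso ((D.shift_int t h₁.le h₂).some ≪≫ φ.symm)) r

lemma pdLT_of_inAdd {X : ModuleCat.{u} Λ} (h : InAdd Λ M X) (r : ℕ) :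
    HasProjectiveDimensionLT ((homF M).obj X) (r + 1) := by
  have := projective_homF h
  have := projective_iff_hasProjectiveDimensionLT_one.1 this
  exact hasProjectiveDimensionLT_of_ge _ 1 _ (by omega)

/-- An Auslander generator: the sum of all indecomposable modules. -/
lemma exists_auslander (D : StripModel Λ n m) (hn : 0 < n) (hΛ : Injective (ModuleCat.of Λ Λ)) :
    ∃ M : ModuleCat.{u} Λ, Module.Finite Λ M ∧ IsGenCogen Λ M ∧
      (∀ Z : ModuleCat.{u} Λ, Module.Finite Λ Z →
        HasProjectiveDimensionLT ((homF M).obj Z) 1) ∧ DomdimGE (End (op M)) 2 := by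
  obtain ⟨M, hf, hM, -⟩ := D.exists_module (fun a b => 0 ≤ a ∧ a < n ∧ a < b ∧ b ≤ a + m)
    (n + m) (by omega)
  have hall (a b : ℤ) (h₁ : a < b) (h₂ : b ≤ a + m) : InAdd Λ M (D.U a b) := by
    obtain ⟨t, ht⟩ := exists_reduce hn a 0
    exact inAdd_shift (t := t) (hM _ _ (by omega)) h₁.le h₂
  have hgc : IsGenCogen Λ M := D.isGenCogen hΛ fun a => by
    rcases Nat.eq_zero_or_pos m with rfl | hm
    · exact InAdd.zero (by simpa using D.isZero_U a)
    · exact hall _ _ (by omega) le_rfl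
  exact ⟨M, hf, hgc, D.hasProjectiveDimensionLT_of_reduced hn 0 1 fun a b _ _ h₁ h₂ =>
    pdLT_of_inAdd (hall a b h₁ h₂) 0, D.domdimGE_two hgc⟩

end StripModel

namespace StripModel
variable {Λ : Type u} [Ring Λ] [IsArtinianRing Λ] {n m : ℕ} (D : StripModel Λ n m)
  {M : ModuleCat.{u} Λ}

lemma mul_cases (t n : ℤ) (hn : 0 ≤ n) :
    (t * n ≤ -(4 * n) ∨ t * n = -(3 * n) ∨ t * n = -(2 * n) ∨ t * n = -n) ∨
      t * n = 0 ∨ t * n = n ∨ t * n = 2 * n ∨ t * n = 3 * n ∨ 4 * n ≤ t * n := by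
  obtain h | h | h | h | h | h | h | h | h :
      t ≤ -4 ∨ t = -3 ∨ t = -2 ∨ t = -1 ∨ t = 0 ∨ t = 1 ∨ t = 2 ∨ t = 3 ∨ 4 ≤ t := by omega
  · exact Or.inl (Or.inl (by nlinarith))
  all_goals first | (subst h; omega) | skip
  have : 4 * n ≤ t * n := by nlinarith
  omega

/-- The intervals of the indecomposable summands of a module of rigidity degree one. -/
def RigidInterval (n m s : ℕ) (a b : ℤ) : Prop :=
  (0 ≤ a ∧ a < n ∧ b = a + m) ∨ (a = 0 ∧ 1 ≤ b ∧ b < n) ∨ (b = 2 * n - 1 ∧ -s ≤ a ∧ a ≤ 0)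

variable {s : ℕ}

variable {D} in
lemma rigidInterval_rigid (hm : m = 2 * n + s) (hs : s + 1 < n)
    (hC : ∀ c d, D.Mem M c d → ∃ t : ℤ, RigidInterval n m s (c + t * n) (d + t * n))
    (a b c d : ℤ) (hab : D.Mem M a b) (hcd : D.Mem M c d) (h₁ : b - m ≤ c) (h₂ : c < a)
    (h₃ : a ≤ d) : b ≤ d := by
  obtain ⟨t, ht⟩ := hC a b hab
  obtain ⟨t', ht'⟩ := hC _ _ (hcd.shift (t := t) rfl rfl)
  have hn := mul_cases t' n (by omega)
  unfold RigidInterval at ht ht'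
  generalize t * (n : ℤ) = x at *
  generalize t' * (n : ℤ) = y at *
  have := hab.1
  have := hcd.1
  rcases hn with (h | h | h | h) | h | h | h | h | h <;> rcases ht with h' | h' | h' <;>
    rcases ht' with h'' | h'' | h'' <;> omega

variable {D} in
lemma hasProjectiveDimensionLT_rigid [Module.Finite Λ M] (hm : m = 2 * n + s) (hs : s + 1 < n)
    (hP : ∀ a b, RigidInterval n m s a b → InAdd Λ M (D.U a b))
    (hC : ∀ c d, D.Mem M c d → ∃ t : ℤ, RigidInterval n m s (c + t * n) (d + t * n))
    (a b : ℤ) (h₁ : -n < a) (h₂ : a ≤ 0) (h₃ : a < b) (h₄ : b ≤ a + m) :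
    HasProjectiveDimensionLT ((homF M).obj (D.U a b)) 4 := by
  have hC' (c d : ℤ) (h : D.Mem M c d) : ∃ x : ℤ, RigidInterval n m s (c + x) (d + x) ∧
      ((x ≤ -(4 * n) ∨ x = -(3 * n) ∨ x = -(2 * n) ∨ x = -n) ∨
      x = 0 ∨ x = n ∨ x = 2 * n ∨ x = 3 * n ∨ 4 * n ≤ x) := by
    obtain ⟨t, ht⟩ := hC c d h
    exact ⟨t * n, ht, mul_cases t n (by omega)⟩
  have hR {a a' b b' : ℤ} (h : ∀ c d : ℤ, d ≤ c + m → (∃ x : ℤ, RigidInterval n m s (c + x) (d + x) ∧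
      ((x ≤ -(4 * n) ∨ x = -(3 * n) ∨ x = -(2 * n) ∨ x = -n) ∨
      x = 0 ∨ x = n ∨ x = 2 * n ∨ x = 3 * n ∨ 4 * n ≤ x)) → a ≤ c → c < a' → c < b → b ≤ d → b' ≤ d) :
      D.RectExact M a a' b b' := fun c d hcd => h c d hcd.2.1 (hC' c d hcd)
  have ge {X : ModuleCat.{u} Λ} {i j : ℕ} (h : HasProjectiveDimensionLT ((homF M).obj X) i)
      (hij : i ≤ j) : HasProjectiveDimensionLT ((homF M).obj X) j :=
    hasProjectiveDimensionLT_of_ge _ i j hij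
  have iP (a : ℤ) : InAdd Λ M (D.U a (a + m)) := by
    obtain ⟨t, ht⟩ := exists_reduce (n := n) (by omega) a 0
    exact inAdd_shift (t := t) (hP _ _ (Or.inl (by omega))) (by omega) (by omega)
  have iA (b : ℤ) (h₀ : 0 ≤ b) (h : b < n) : InAdd Λ M (D.U 0 b) := by
    rcases h₀.eq_or_lt with rfl | h₀
    · exact InAdd.zero (D.isZero_U 0)
    · exact hP _ _ (Or.inr (Or.inl (by omega)))
  have iB (a : ℤ) (h₀ : -s ≤ a) (h : a ≤ 0) : InAdd Λ M (D.U a (2 * n - 1)) :=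
    hP _ _ (Or.inr (Or.inr (by omega)))
  have step₀ (b : ℤ) (h₁ : 0 < b) (h₂ : b ≤ m) :
      HasProjectiveDimensionLT ((homF M).obj (D.U 0 b)) 2 := by
    obtain h | h | h | h | h : b < n ∨ b = 2 * n - 1 ∨ b = m ∨ (n ≤ b ∧ b < 2 * n - 1) ∨
      (2 * n - 1 < b ∧ b < m) := by omega
    · exact pdLT_of_inAdd (iA b h₁.le h) 1
    · exact pdLT_of_inAdd (h ▸ iB 0 (by omega) le_rfl) 1
    · have := iP 0
      rw [zero_add, ← h] at this
      exact pdLT_of_inAdd this 1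
    · refine D.hasProjectiveDimensionLT_rect (a' := n) (b' := 2 * n - 1) (by omega) (by omega)
        (by omega) (by omega) (hR ?_) 1 (pdLT_of_inAdd ?_ 0) (pdLT_of_inAdd ?_ 1)
        (pdLT_of_inAdd ?_ 1)
      · rintro c d hcd ⟨x, h | h | h, (h' | h' | h' | h') | h' | h' | h' | h' | h'⟩ <;> omega
      · refine inAdd_shift (t := -1) ?_ (by omega) (by omega)
        convert iA (n - 1) (by omega) (by omega) using 2 <;> ring
      · exact iB 0 (by omega) le_rfl
      · refine inAdd_shift (t := -1) ?_ (by omega) (by omega)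
        convert iA (b - n) (by omega) (by omega) using 2 <;> ring
    · refine D.hasProjectiveDimensionLT_rect (a' := 2 * n) (b' := m) (by omega) (by omega)
        (by omega) (by omega) (hR ?_) 1 (pdLT_of_inAdd ?_ 0) (pdLT_of_inAdd ?_ 1)
        (pdLT_of_inAdd ?_ 1)
      · rintro c d hcd ⟨x, h | h | h, (h' | h' | h' | h') | h' | h' | h' | h' | h'⟩ <;> omega
      · refine inAdd_shift (t := -2) ?_ (by omega) (by omega)
        convert iA s (by omega) (by omega) using 2
        · ring
        · rw [hm]; push_cast; ring
      · simpa using iP 0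
      · refine inAdd_shift (t := -2) ?_ (by omega) (by omega)
        convert iA (b - 2 * n) (by omega) (by omega) using 2 <;> ring
  have step₁ (a b : ℤ) (h₁ : -s ≤ a) (h₂ : a < 0) (h₃ : 0 < b) (h₄ : b ≤ 2 * n - 1) :
      HasProjectiveDimensionLT ((homF M).obj (D.U a b)) 2 := by
    refine D.hasProjectiveDimensionLT_rect (a' := 0) (b' := 2 * n - 1) (by omega) (by omega)
        (by omega) (by omega) (hR ?_) 1 (pdLT_of_inAdd ?_ 0) (pdLT_of_inAdd ?_ 1)
        (step₀ b (by omega) (by omega))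
    · rintro c d hcd ⟨x, h | h | h, (h' | h' | h' | h') | h' | h' | h' | h' | h'⟩ <;> omega
    · exact iB 0 (by omega) le_rfl
    · exact iB a (by omega) (by omega)
  have step₂ (a b : ℤ) (h₁ : -n < a) (h₂ : a < 0) (h₃ : 0 < b) (h₄ : b ≤ a + m) :
      HasProjectiveDimensionLT ((homF M).obj (D.U a b)) 3 := by
    by_cases h : -s ≤ a ∧ b ≤ 2 * n - 1
    · exact ge (step₁ a b h.1 h₂ h₃ h.2) (by omega)
    refine D.hasProjectiveDimensionLT_rect (a' := 0) (b' := a + m) (by omega) (by omega)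
        (by omega) (by omega) (hR ?_) 2 (step₀ _ (by omega) (by omega)) (pdLT_of_inAdd (iP a) 2)
        (ge (step₀ b (by omega) (by omega)) (by omega))
    rintro c d hcd ⟨x, h | h | h, (h' | h' | h' | h') | h' | h' | h' | h' | h'⟩ <;> omega
  have step₃ (a b : ℤ) (h₁ : -s ≤ a) (h₂ : a < b) (h₃ : b ≤ 0) :
      HasProjectiveDimensionLT ((homF M).obj (D.U a b)) 2 := by
    refine D.hasProjectiveDimensionLT_rect (a' := b) (b' := 2 * n - 1) (by omega) (by omega)
        (by omega) (by omega) (hR ?_) 1 (pdLT_of_inAdd ?_ 0) (pdLT_of_inAdd ?_ 1)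
        (pdLT_of_inAdd (InAdd.zero (D.isZero_U b)) 1)
    · rintro c d hcd ⟨x, h | h | h, (h' | h' | h' | h') | h' | h' | h' | h' | h'⟩ <;> omega
    · exact iB b (by omega) (by omega)
    · exact iB a (by omega) (by omega)
  obtain rfl | h₂ := h₂.eq_or_lt
  · exact ge (step₀ b h₃ (by omega)) (by omega)
  by_cases hb : 0 < b
  · exact ge (step₂ a b h₁ h₂ hb h₄) (by omega)
  by_cases ha : -s ≤ a
  · exact ge (step₃ a b ha h₃ (by omega)) (by omega)
  by_cases hb' : b ≤ -s
  · refine D.hasProjectiveDimensionLT_rect (a' := b) (b' := a + m) (by omega) (by omega)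
        (by omega) (by omega) (hR ?_) 3 ?_ (pdLT_of_inAdd (iP a) 3)
        (pdLT_of_inAdd (InAdd.zero (D.isZero_U b)) 3)
    · rintro c d hcd ⟨x, h | h | h, (h' | h' | h' | h') | h' | h' | h' | h' | h'⟩ <;> omega
    · obtain h | rfl : b < 0 ∨ b = 0 := by omega
      · exact step₂ b _ (by omega) h (by omega) (by omega)
      · exact ge (step₀ _ (by omega) (by omega)) (by omega)
  · refine D.hasProjectiveDimensionLT_rect (a' := -s) (b' := a + m) (by omega) (by omega)
        (by omega) (by omega) (hR ?_) 3 (step₂ _ _ (by omega) (by omega) (by omega) (by omega))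
        (pdLT_of_inAdd (iP a) 3) (ge (step₃ _ _ le_rfl (by omega) (by omega)) (by omega))
    rintro c d hcd ⟨x, h | h | h, (h' | h' | h' | h') | h' | h' | h' | h' | h'⟩ <;> omega

lemma exists_rigid (D : StripModel Λ n m) (hm : m = 2 * n + s) (hs : s + 1 < n)
    (hΛ : Injective (ModuleCat.of Λ Λ)) :
    ∃ M : ModuleCat.{u} Λ, Module.Finite Λ M ∧ IsGenCogen Λ M ∧
      (∀ Z : ModuleCat.{u} Λ, Module.Finite Λ Z →
        HasProjectiveDimensionLT ((homF M).obj Z) 4) ∧ DomdimGE (End (op M)) 3 := by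
  obtain ⟨M, hf, hM, hC⟩ := D.exists_module (RigidInterval n m s) (n + m) (by
    intro a b h
    unfold RigidInterval at h
    omega)
  have hgc : IsGenCogen Λ M := D.isGenCogen hΛ fun a => by
    obtain ⟨t, ht⟩ := exists_reduce (n := n) (by omega) a 0
    exact inAdd_shift (t := t) (hM _ _ (Or.inl (by omega))) (by omega) (by omega)
  exact ⟨M, hf, hgc, D.hasProjectiveDimensionLT_of_reduced (by omega) (1 - n) 4
    fun a b _ _ h₁ h₂ => hasProjectiveDimensionLT_rigid hm hs hM hC a b (by omega) (by omega) h₁ h₂,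
    D.domdimGE_three hgc (rigidInterval_rigid hm hs hC)⟩

end StripModel

section RigidityDimension
variable {Λ : Type u} [Ring Λ]

lemma rigdim_le {r : ℕ} (h : ∀ M : ModuleCat.{u} Λ, Module.Finite Λ M → IsGenCogen Λ M →
    ∀ d, GldimLE (End (op M)) d → ¬ ∃ t, r + 1 ≤ t ∧ DomdimGE (End (op M)) t) :
    rigdim Λ ≤ r := by
  refine sSup_le ?_
  rintro _ ⟨M, hf, hM, ⟨d, hd⟩, rfl⟩
  refine sSup_le ?_
  rintro _ ⟨t, rfl, ht⟩
  by_contra hlt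
  exact h M hf hM d hd ⟨t, by exact_mod_cast not_le.1 hlt, ht⟩

lemma le_rigdim {M : ModuleCat.{u} Λ} [Module.Finite Λ M] (hM : IsGenCogen Λ M) {d r : ℕ}
    (hd : GldimLE (End (op M)) d) (h : DomdimGE (End (op M)) r) : (r : ℕ∞) ≤ rigdim Λ := by
  have h₁ : (r : ℕ∞) ≤ domdim (End (op M)) := le_sSup ⟨r, rfl, h⟩
  have h₂ : domdim (End (op M)) ≤ rigdim Λ := le_sSup ⟨M, inferInstance, hM, ⟨d, hd⟩, rfl⟩
  exact h₁.trans h₂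

end RigidityDimension

/-- Theorem `K012eq`(2): for `Λ = A_{n,m}` with `n > 1` and `m = 2n + s₁`,
`0 ≤ s₁ < n` (so `k₀ = 2`), one has `rigdim(Λ) = 2` if `s₁ = n - 1` and `rigdim(Λ) = 3`
if `s₁ < n - 1`. -/
theorem statement18 (k : Type u) [Field k] (Λ : Type u) [Ring Λ] [Algebra k Λ]
    (n m : ℕ) (hn : 1 < n)
    (hΛ : IsSelfInjNakayama k Λ n m)
    (s1 : ℕ) (hm : m = 2 * n + s1) (hs1 : s1 < n) :
    (s1 = n - 1 → rigdim Λ = 2) ∧ (s1 < n - 1 → rigdim Λ = 3) := by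
  have := hΛ.findim
  have := hΛ.isArtinianRing
  have : NeZero n := ⟨by omega⟩
  obtain ⟨D⟩ := hΛ.nonempty_stripModel
  refine ⟨fun hs => le_antisymm ?_ ?_, fun hs => le_antisymm ?_ ?_⟩
  · refine rigdim_le (r := 2) ?_
    rintro M hf hM d hd ⟨t, ht, h⟩
    refine D.not_gldimLE hM hm hs1 (fun a b hab => ?_) d hd
    by_contra! hc
    exact D.not_mem_of_domdimGE_three hM.1 ht h (by omega) (by omega) (by omega) hab
  · obtain ⟨M, hf, hM, hpd, hdd⟩ := D.exists_auslander (by omega) hΛ.selfinj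
    have := isNoetherian_end_op (k := k) M
    exact le_rigdim hM (gldimLE_end_op hM.1 0 hpd) hdd
  · refine rigdim_le (r := 3) ?_
    rintro M hf hM d hd ⟨t, ht, h⟩
    refine D.not_gldimLE hM hm hs1 (fun a b hab => ?_) d hd
    by_contra! hc
    exact D.not_mem_of_domdimGE_four hM.1 ht h (by omega) (by omega) (by omega) (by omega) hab
  · obtain ⟨M, hf, hM, hpd, hdd⟩ := D.exists_rigid hm (by omega) hΛ.selfinj
    have := isNoetherian_end_op (k := k) M
    exact le_rigdim hM (gldimLE_end_op hM.1 3 hpd) hdd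

end Rigidity
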